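/- arXiv:2112.01255 — 3 statements merged into one kernel-verified Lean document; each statement's English description precedes it below -/
import Mathlib

section
/- For every α ∈ [0,1) and every g ∈ 𝒟, the function g admits a representative that is continuous on ℝ∖{0} and for which the four limits g_0^± := lim_{x→0^±} |x|^{α/2} g(x) and g_1^± := lim_{x→0^±} |x|^{−(1+α/2)} ( g(x) − g_0^± |x|^{−α/2} ) exist and are finite. -/
open MeasureTheory Filter Set

noncomputable section

/-- The Hilbert space `L²(ℝ, ℂ)`. -/
abbrev L2R := MeasureTheory.Lp ℂ 2 (volume : Measure ℝ)

/-- Smooth functions compactly supported in `ℝ ∖ {0}`. -/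
def TestFun (φ : ℝ → ℂ) : Prop :=
  ContDiff ℝ (⊤ : ℕ∞) φ ∧ HasCompactSupport φ ∧ tsupport φ ⊆ {x : ℝ | x ≠ 0}

/-- `h = -g'' + C_α |x|⁻² g` in the distributional sense on `ℝ ∖ {0}`. -/
def ActsAs (α : ℝ) (g h : L2R) : Prop :=
  ∀ φ : ℝ → ℂ, TestFun φ →
    ∫ x : ℝ, g x * (-(deriv (deriv φ) x) + ((α * (α + 2) / 4 / x ^ 2 : ℝ) : ℂ) * φ x)
      = ∫ x : ℝ, h x * φ x

/-- The maximal domain `𝒟` of `-d²/dx² + C_α/x²` in `L²(ℝ)`. -/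
def InD (α : ℝ) (g : L2R) : Prop := ∃ h : L2R, ActsAs α g h

/-- Existence of the four boundary limits `g₀^±`, `g₁^±` for a function `G` near `x = 0`. -/
def HasBoundary (α : ℝ) (G : ℝ → ℂ) (g0p g0m g1p g1m : ℂ) : Prop :=
  Tendsto (fun x : ℝ => ((|x| ^ (α / 2) : ℝ) : ℂ) * G x) (nhdsWithin 0 (Set.Ioi 0)) (nhds g0p) ∧
  Tendsto (fun x : ℝ => ((|x| ^ (α / 2) : ℝ) : ℂ) * G x) (nhdsWithin 0 (Set.Iio 0)) (nhds g0m) ∧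
  Tendsto (fun x : ℝ => ((|x| ^ (-(1 + α / 2)) : ℝ) : ℂ) *
      (G x - g0p * ((|x| ^ (-(α / 2)) : ℝ) : ℂ))) (nhdsWithin 0 (Set.Ioi 0)) (nhds g1p) ∧
  Tendsto (fun x : ℝ => ((|x| ^ (-(1 + α / 2)) : ℝ) : ℂ) *
      (G x - g0m * ((|x| ^ (-(α / 2)) : ℝ) : ℂ))) (nhdsWithin 0 (Set.Iio 0)) (nhds g1m)

/-- Smooth functions compactly supported in `(0,∞)`. -/
def PT (φ : ℝ → ℂ) : Prop :=
  ContDiff ℝ (⊤ : ℕ∞) φ ∧ HasCompactSupport φ ∧ tsupport φ ⊆ Ioi 0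

lemma PT.deriv {φ : ℝ → ℂ} (h : PT φ) : PT (deriv φ) :=
  ⟨(contDiff_infty_iff_deriv.1 h.1).2, h.2.1.deriv, (tsupport_deriv_subset).trans h.2.2⟩

lemma PT.hasDerivAt {φ : ℝ → ℂ} (h : PT φ) (x : ℝ) : HasDerivAt φ (_root_.deriv φ x) x :=
  ((h.1.differentiable (by simp)) x).hasDerivAt

lemma PT.continuous {φ : ℝ → ℂ} (h : PT φ) : Continuous φ := h.1.continuous

lemma PT.sub {φ ψ : ℝ → ℂ} (h : PT φ) (h' : PT ψ) : PT (fun x => φ x - ψ x) :=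
  ⟨h.1.sub h'.1, h.2.1.sub h'.2.1,
    (tsupport_sub φ ψ).trans (union_subset h.2.2 h'.2.2)⟩

lemma PT.const_mul {φ : ℝ → ℂ} (h : PT φ) (c : ℂ) : PT (fun x => c * φ x) :=
  ⟨contDiff_const.mul h.1, h.2.1.mul_left, (tsupport_mul_subset_right).trans h.2.2⟩

lemma PT.eq_zero {φ : ℝ → ℂ} (h : PT φ) {x : ℝ} (hx : x ≤ 0) : φ x = 0 := by
  by_contra hne
  exact absurd (h.2.2 (subset_tsupport φ hne)) (not_lt.2 hx)

lemma PT.rpow_mul {φ : ℝ → ℂ} (h : PT φ) (r : ℝ) : PT (fun x => ((x ^ r : ℝ) : ℂ) * φ x) := by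
  refine ⟨?_, h.2.1.mul_left, (tsupport_mul_subset_right).trans h.2.2⟩
  rw [contDiff_iff_contDiffAt]
  intro x
  by_cases hx : x ∈ tsupport φ
  · have hx0 : 0 < x := h.2.2 hx
    refine ContDiffAt.mul ?_ h.1.contDiffAt
    exact Complex.ofRealCLM.contDiff.contDiffAt.comp x
      (Real.contDiffAt_rpow_const_of_ne hx0.ne')
  · have : (fun x => ((x ^ r : ℝ) : ℂ) * φ x) =ᶠ[nhds x] fun _ => 0 := by
      filter_upwards [notMem_tsupport_iff_eventuallyEq.1 hx] with y hy
      simp [hy]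
    exact contDiffAt_const.congr_of_eventuallyEq this

/-- support in an interval -/
lemma PT.bound {φ : ℝ → ℂ} (h : PT φ) :
    ∃ ε M : ℝ, 0 < ε ∧ ε < M ∧ ∀ x, x ∉ Ioo ε M → φ x = 0 := by
  rcases (tsupport φ).eq_empty_or_nonempty with he | hne
  · refine ⟨1, 2, one_pos, by norm_num, fun x _ => ?_⟩
    rw [tsupport_eq_empty_iff] at he
    simp [he]
  · obtain ⟨m, hm, hm'⟩ := h.2.1.isCompact.exists_isLeast hne
    obtain ⟨M, hM, hM'⟩ := h.2.1.isCompact.exists_isGreatest hne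
    have h0 : 0 < m := h.2.2 hm
    have h1 : m ≤ M := hm' hM
    refine ⟨m / 2, M + 1, by linarith, by linarith, fun x hx => ?_⟩
    by_contra hne
    have hx' := subset_tsupport φ hne
    have h2 := hm' hx'
    have h3 := hM' hx'
    exact hx ⟨by linarith, by linarith⟩

lemma PT.integral_eq {φ : ℝ → ℂ} {ε M : ℝ} (hε : 0 < ε) 
    (h : ∀ x, x ∉ Ioo ε M → φ x = 0) (k : ℝ → ℂ) :
    ∫ x, k x * φ x = ∫ x in Ioc 0 M, k x * φ x := by
  rw [setIntegral_eq_integral_of_forall_compl_eq_zero]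
  intro x hx
  rw [h x, mul_zero]
  exact fun h' => hx ⟨hε.trans h'.1, h'.2.le⟩

lemma ibp {k φ : ℝ → ℂ} (hk : LocallyIntegrable k) (h : PT φ) :
    ∫ x, (∫ t in (0 : ℝ)..x, k t) * deriv φ x = - ∫ x, k x * φ x := by
  obtain ⟨ε, M, hε, hM, hz⟩ := h.bound
  have hz' : ∀ x, x ∉ Icc ε M → deriv φ x = 0 := by
    intro x hx
    have : φ =ᶠ[nhds x] fun _ => 0 := by
      filter_upwards [isClosed_Icc.isOpen_compl.mem_nhds hx] with y hy
      exact hz y fun h => hy ⟨h.1.le, h.2.le⟩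
    rw [this.deriv_eq]; simp
  have hM0 : 0 < M := hε.trans hM
  rw [PT.integral_eq hε hz k]
  have e1 : ∫ x, (∫ t in (0 : ℝ)..x, k t) * deriv φ x
      = ∫ x in Ioc 0 M, ∫ t in Ioc 0 M, (if t ≤ x then k t * deriv φ x else 0) := by
    rw [← setIntegral_eq_integral_of_forall_compl_eq_zero (s := Ioc 0 M)]
    · refine setIntegral_congr_fun measurableSet_Ioc fun x hx => ?_
      rw [intervalIntegral.integral_of_le hx.1.le, ← integral_mul_const]
      have : (fun t => if t ≤ x then k t * deriv φ x else 0)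
          = (Iic x).indicator (fun t => k t * deriv φ x) := by
        ext t; simp [indicator]
      rw [this, setIntegral_indicator measurableSet_Iic]
      congr 2
      ext t
      simp only [mem_Ioc, mem_inter_iff, mem_Iic]
      constructor
      · rintro ⟨a, b⟩; exact ⟨⟨a, b.trans hx.2⟩, b⟩
      · rintro ⟨⟨a, b⟩, c⟩; exact ⟨a, c⟩
    · intro x hx
      rw [hz' x, mul_zero]
      exact fun h' => hx ⟨hε.trans_le h'.1, h'.2⟩
  have hki : Integrable k (volume.restrict (Ioc 0 M)) :=
    (hk.integrableOn_isCompact isCompact_Icc).mono_set Ioc_subset_Icc_self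
  have hdi : Integrable (deriv φ) (volume.restrict (Ioc 0 M)) :=
    (h.deriv.continuous.integrable_of_hasCompactSupport h.deriv.2.1).integrableOn
  have hint : Integrable (Function.uncurry fun x t => if t ≤ x then k t * deriv φ x else 0)
      ((volume.restrict (Ioc 0 M)).prod (volume.restrict (Ioc 0 M))) := by
    have := (hdi.mul_prod hki).indicator (measurableSet_le measurable_snd measurable_fst)
    refine this.congr (Eventually.of_forall fun p => ?_)
    simp only [indicator, mem_ofPred_eq, Function.uncurry]
    split_ifs <;> ring
  rw [e1, integral_integral_swap hint, ← integral_neg]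
  refine setIntegral_congr_fun measurableSet_Ioc fun t ht => ?_
  have : (fun x => if t ≤ x then k t * deriv φ x else 0)
      = (Ici t).indicator (fun x => k t * deriv φ x) := by
    ext x; simp [indicator]
  rw [this, setIntegral_indicator measurableSet_Ici]
  have hs : Ioc 0 M ∩ Ici t = Icc t M := by
    ext x
    simp only [mem_Ioc, mem_inter_iff, mem_Ici, mem_Icc]
    constructor
    · rintro ⟨⟨a, b⟩, c⟩; exact ⟨c, b⟩
    · rintro ⟨a, b⟩; exact ⟨⟨ht.1.trans_le a, b⟩, a⟩
  rw [hs, integral_const_mul, integral_Icc_eq_integral_Ioc, ← intervalIntegral.integral_of_le ht.2,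
    intervalIntegral.integral_deriv_eq_sub (fun x _ => (h.hasDerivAt x).differentiableAt)
      (h.deriv.continuous.intervalIntegrable _ _), hz M (by simp)]
  ring

/-- test functions of zero integral are derivatives of test functions -/
lemma PT_primitive {χ : ℝ → ℂ} (h : PT χ) (h0 : ∫ x, χ x = 0) :
    ∃ φ, PT φ ∧ deriv φ = χ := by
  obtain ⟨ε, M, hε, hM, hz⟩ := h.bound
  have hd : ∀ x, HasDerivAt (fun x => ∫ t in (0:ℝ)..x, χ t) (χ x) x := fun x =>
    intervalIntegral.integral_hasDerivAt_right (h.continuous.intervalIntegrable _ _)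
      (h.continuous.stronglyMeasurableAtFilter _ _) h.continuous.continuousAt
  have hde : deriv (fun x => ∫ t in (0:ℝ)..x, χ t) = χ := funext fun x => (hd x).deriv
  have hsupp : ∀ x, x ∉ Icc ε M → ∫ t in (0:ℝ)..x, χ t = 0 := by
    intro x hx
    by_cases hx1 : x < ε
    · rw [intervalIntegral.integral_congr (g := fun _ => 0)]
      · simp
      · intro t ht
        refine hz t fun h' => ?_
        have h2 : t ≤ max 0 x := ht.2
        have h3 : max 0 x < ε := max_lt hε hx1
        exact absurd h'.1 (by linarith)
    · have hx2 : M < x := by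
        by_contra hh; exact hx ⟨not_lt.1 hx1, not_lt.1 hh⟩
      rw [intervalIntegral.integral_of_le (by linarith),
        setIntegral_eq_integral_of_forall_compl_eq_zero, h0]
      intro t ht
      refine hz t fun h' => ht ⟨hε.trans h'.1, h'.2.le.trans hx2.le⟩
  have hts : tsupport (fun x => ∫ t in (0:ℝ)..x, χ t) ⊆ Icc ε M := by
    refine closure_minimal ?_ isClosed_Icc
    intro x hx
    by_contra hh
    exact hx (hsupp x hh)
  refine ⟨_, ⟨?_, ?_, ?_⟩, hde⟩
  · rw [contDiff_infty_iff_deriv, hde]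
    exact ⟨fun x => (hd x).differentiableAt, h.1⟩
  · exact isCompact_Icc.of_isClosed_subset (isClosed_tsupport _) hts
  · exact hts.trans fun x hx => hε.trans_le hx.1

lemma exists_PT : ∃ χ, PT χ ∧ ∫ x, χ x = 1 := by
  let f : ContDiffBump (2 : ℝ) := ⟨1/2, 1, by norm_num, by norm_num⟩
  refine ⟨fun x => ((f.normed volume x : ℝ) : ℂ), ⟨?_, ?_, ?_⟩, ?_⟩
  · exact Complex.ofRealCLM.contDiff.comp f.contDiff_normed
  · exact f.hasCompactSupport_normed.comp_left (g := fun x : ℝ => (x : ℂ)) (by simp)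
  · refine (tsupport_comp_subset (g := fun x : ℝ => (x : ℂ)) (by simp) _).trans ?_
    rw [f.tsupport_normed_eq]
    intro x hx
    have : |x - 2| ≤ 1 := by simpa [Real.dist_eq] using hx
    have := abs_le.1 this
    simp only [mem_Ioi]; linarith
  · rw [integral_complex_ofReal, f.integral_normed]; simp

lemma duBois (T : (ℝ → ℂ) → ℂ)
    (hT : ∀ φ ψ c, PT φ → PT ψ → T (fun x => φ x - c * ψ x) = T φ - c * T ψ)
    (h0 : ∀ φ, PT φ → T (deriv φ) = 0) : ∃ d, ∀ χ, PT χ → T χ = d * ∫ x, χ x := by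
  obtain ⟨χ₀, h1, h2⟩ := exists_PT
  refine ⟨T χ₀, fun χ hχ => ?_⟩
  have hp := hχ.sub (h1.const_mul (∫ x, χ x))
  obtain ⟨φ, hφ, he⟩ := PT_primitive hp (by
    rw [integral_sub (hχ.continuous.integrable_of_hasCompactSupport hχ.2.1)
      ((h1.continuous.integrable_of_hasCompactSupport h1.2.1).const_mul _), integral_const_mul, h2]
    ring)
  have := h0 φ hφ
  rw [he, hT _ _ _ hχ h1] at this
  linear_combination this


lemma rpow_hasDerivAt (r : ℝ) {f : ℝ → ℂ} {f' : ℂ} {x : ℝ} (hx : 0 < x) (hf : HasDerivAt f f' x) :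
    HasDerivAt (fun x : ℝ => ((x ^ r : ℝ) : ℂ) * f x)
      (((r * x ^ (r - 1) : ℝ) : ℂ) * f x + ((x ^ r : ℝ) : ℂ) * f') x :=
  ((Real.hasDerivAt_rpow_const (Or.inl hx.ne')).ofReal_comp).mul hf

lemma op_identity (a : ℝ) {ψ : ℝ → ℂ} (h : PT ψ) {x : ℝ} (hx : 0 < x) :
    -(deriv (deriv (fun x : ℝ => ((x ^ (-a) : ℝ) : ℂ) * ψ x)) x)
      + ((a * (a + 1) / x ^ 2 : ℝ) : ℂ) * (((x ^ (-a) : ℝ) : ℂ) * ψ x)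
    = - (((x ^ a : ℝ) : ℂ) * deriv (fun x : ℝ => ((x ^ (-(2 * a)) : ℝ) : ℂ) * deriv ψ x) x) := by
  have e1 : deriv (fun x : ℝ => ((x ^ (-a) : ℝ) : ℂ) * ψ x) =ᶠ[nhds x]
      fun x => ((x ^ (-a - 1) : ℝ) : ℂ) * ((-a : ℝ) * ψ x) + ((x ^ (-a) : ℝ) : ℂ) * deriv ψ x := by
    filter_upwards [lt_mem_nhds hx] with y hy
    rw [(rpow_hasDerivAt (-a) hy (h.hasDerivAt y)).deriv]
    push_cast; ring
  have e2 := ((rpow_hasDerivAt (-a - 1) hx ((h.hasDerivAt x).const_mul ((-a : ℝ) : ℂ))).add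
    (rpow_hasDerivAt (-a) hx (h.deriv.hasDerivAt x))).deriv
  have e3 := (rpow_hasDerivAt (-(2 * a)) hx (h.deriv.hasDerivAt x)).deriv
  rw [e1.deriv_eq]
  erw [e2]
  rw [e3]
  have r1 : x ^ (-a - 1) = x ^ (-a) / x := by rw [Real.rpow_sub_one hx.ne']
  have r2 : x ^ (-a - 1 - 1) = x ^ (-a) / x / x := by
    rw [Real.rpow_sub_one hx.ne', Real.rpow_sub_one hx.ne']
  have r3 : x ^ (-(2 * a)) = x ^ (-a) * x ^ (-a) := by rw [← Real.rpow_add hx]; congr 1; ring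
  have r4 : x ^ (-(2 * a) - 1) = x ^ (-a) * x ^ (-a) / x := by rw [Real.rpow_sub_one hx.ne', r3]
  have r5 : x ^ a = (x ^ (-a))⁻¹ := by rw [Real.rpow_neg hx.le, inv_inv]
  rw [r1, r2, r3, r4, r5]
  have hp : 0 < x ^ (-a) := Real.rpow_pos_of_pos hx _
  generalize x ^ (-a) = p at hp
  have hp' : (p : ℂ) ≠ 0 := by exact_mod_cast hp.ne'
  have hx' : (x : ℂ) ≠ 0 := by exact_mod_cast hx.ne'
  push_cast
  field_simp
  ring

lemma locInt_F {a : ℝ} (ha' : a < 1 / 2) {h : ℝ → ℂ} (hh : MemLp h 2) :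
    LocallyIntegrable ((Ioi (0:ℝ)).indicator fun x => ((x ^ (-a) : ℝ) : ℂ) * h x) := by
  rw [locallyIntegrable_iff]
  intro K hK
  obtain ⟨R, hR⟩ := hK.isBounded.subset_closedBall 0
  have hR' : ∀ x ∈ K, x ≤ R := fun x hx => by
    have := hR hx
    rw [Metric.mem_closedBall, Real.dist_eq, sub_zero] at this
    exact (le_abs_self x).trans this
  have hsq : Integrable (fun x => ‖h x‖ ^ 2) := by
    simpa using hh.integrable_norm_pow (by simp)
  rw [IntegrableOn, integrable_indicator_iff measurableSet_Ioi, IntegrableOn,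
    Measure.restrict_restrict measurableSet_Ioi]
  have hsub : Ioi 0 ∩ K ⊆ Ioc 0 (max 0 R) := fun x hx => ⟨hx.1, (hR' x hx.2).trans (le_max_right _ _)⟩
  have h1 : IntegrableOn (fun x : ℝ => x ^ (-(2 * a))) (Ioc 0 (max 0 R)) :=
    (intervalIntegrable_iff_integrableOn_Ioc_of_le (le_max_left _ _)).1
      (intervalIntegral.intervalIntegrable_rpow' (by linarith))
  have hm : AEStronglyMeasurable (fun x : ℝ => ((x ^ (-a) : ℝ) : ℂ) * h x) volume :=
    (Complex.measurable_ofReal.comp (measurable_id.pow_const (-a))).aestronglyMeasurable.mul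
      hh.aestronglyMeasurable
  have h2 : IntegrableOn (fun x : ℝ => ((x ^ (-a) : ℝ) : ℂ) * h x) (Ioc 0 (max 0 R)) := by
    refine Integrable.mono' (h1.add hsq.integrableOn) hm.restrict ?_
    refine (ae_restrict_iff' measurableSet_Ioc).2 (Eventually.of_forall fun x hx => ?_)
    have hp : 0 < x ^ (-a) := Real.rpow_pos_of_pos hx.1 _
    have r3 : x ^ (-(2 * a)) = x ^ (-a) * x ^ (-a) := by rw [← Real.rpow_add hx.1]; congr 1; ring
    rw [norm_mul, Complex.norm_real, Real.norm_of_nonneg hp.le]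
    simp only [Pi.add_apply, r3]
    nlinarith [sq_nonneg (x ^ (-a) - ‖h x‖), sq_nonneg (x ^ (-a) + ‖h x‖)]
  exact h2.mono_set hsub

lemma PT.mul_integrable {φ k : ℝ → ℂ} (h : PT φ) (hk : LocallyIntegrable k) :
    Integrable fun x => k x * φ x := by
  simpa using hk.integrable_smul_right_of_hasCompactSupport h.continuous h.2.1

lemma half {a : ℝ} (ha : 0 ≤ a) (ha' : a < 1 / 2) {g h : ℝ → ℂ} (hg : LocallyIntegrable g)
    (hh : MemLp h 2)
    (hw : ∀ φ, PT φ → ∫ x : ℝ, g x * (-(deriv (deriv φ) x) + ((a * (a + 1) / x ^ 2 : ℝ) : ℂ) * φ x)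
      = ∫ x : ℝ, h x * φ x) :
    ∃ (G : ℝ → ℂ) (c e : ℂ), ContinuousOn G (Ioi 0) ∧ (∀ᵐ x : ℝ, x ∈ Ioi (0:ℝ) → g x = G x) ∧
      Tendsto (fun x : ℝ => ((x ^ a : ℝ) : ℂ) * G x) (nhdsWithin 0 (Ioi 0)) (nhds c) ∧
      Tendsto (fun x : ℝ => ((x ^ (-(1 + a)) : ℝ) : ℂ) * (G x - c * ((x ^ (-a) : ℝ) : ℂ)))
        (nhdsWithin 0 (Ioi 0)) (nhds e) := by
  set F : ℝ → ℂ := (Ioi (0:ℝ)).indicator fun x => ((x ^ (-a) : ℝ) : ℂ) * h x with hF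
  have hFl : LocallyIntegrable F := locInt_F ha' hh
  set H : ℝ → ℂ := fun x => ∫ t in (0:ℝ)..x, F t with hH
  have hHc : Continuous H :=
    intervalIntegral.continuous_primitive (fun u v =>
      (hFl.integrableOn_isCompact isCompact_uIcc).intervalIntegrable) 0
  -- first step
  obtain ⟨d, hd⟩ := duBois (fun χ => (∫ x, g x * (((x ^ a : ℝ) : ℂ) *
      deriv (fun x : ℝ => ((x ^ (-(2 * a)) : ℝ) : ℂ) * χ x) x)) - ∫ x, H x * χ x)
    (by
      intro φ ψ c hφ hψ
      have h1 := ((hφ.rpow_mul (-(2 * a))).deriv.rpow_mul a).mul_integrable hg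
      have h2 := ((hψ.rpow_mul (-(2 * a))).deriv.rpow_mul a).mul_integrable hg
      have h3 := hφ.mul_integrable hHc.locallyIntegrable
      have h4 := hψ.mul_integrable hHc.locallyIntegrable
      have e1 : ∀ x, g x * (((x ^ a : ℝ) : ℂ) *
          deriv (fun x : ℝ => ((x ^ (-(2 * a)) : ℝ) : ℂ) * (φ x - c * ψ x)) x)
          = g x * (((x ^ a : ℝ) : ℂ) * deriv (fun x : ℝ => ((x ^ (-(2 * a)) : ℝ) : ℂ) * φ x) x)
          - c * (g x * (((x ^ a : ℝ) : ℂ) *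
            deriv (fun x : ℝ => ((x ^ (-(2 * a)) : ℝ) : ℂ) * ψ x) x)) := by
        intro x
        have : deriv (fun x : ℝ => ((x ^ (-(2 * a)) : ℝ) : ℂ) * (φ x - c * ψ x)) x
            = deriv (fun x : ℝ => ((x ^ (-(2 * a)) : ℝ) : ℂ) * φ x) x
            - c * deriv (fun x : ℝ => ((x ^ (-(2 * a)) : ℝ) : ℂ) * ψ x) x := by
          rw [← (((hφ.rpow_mul (-(2 * a))).hasDerivAt x).sub
            (((hψ.rpow_mul (-(2 * a))).hasDerivAt x).const_mul c)).deriv]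
          congr 1
          ext y
          simp only [Pi.sub_apply]
          ring
        rw [this]; ring
      have e2 : ∀ x, H x * (φ x - c * ψ x) = H x * φ x - c * (H x * ψ x) := fun x => by ring
      simp only [e1, e2]
      rw [integral_sub h1 (h2.const_mul c), integral_sub h3 (h4.const_mul c),
        integral_const_mul, integral_const_mul]
      ring)
    (by
      intro ψ hψ
      have e1 := hw _ (hψ.rpow_mul (-a))
      have e2 := ibp hFl hψ
      have e3 : ∫ x, h x * (((x ^ (-a) : ℝ) : ℂ) * ψ x) = ∫ x, F x * ψ x := by
        congr 1; ext x
        rcases le_or_gt x 0 with hx | hx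
        · simp [hψ.eq_zero hx]
        · simp only [hF, indicator_of_mem (mem_Ioi.2 hx)]; ring
      have e4 : ∀ x, g x * (-(deriv (deriv (fun x : ℝ => ((x ^ (-a) : ℝ) : ℂ) * ψ x)) x)
          + ((a * (a + 1) / x ^ 2 : ℝ) : ℂ) * (((x ^ (-a) : ℝ) : ℂ) * ψ x))
          = - (g x * (((x ^ a : ℝ) : ℂ) *
            deriv (fun x : ℝ => ((x ^ (-(2 * a)) : ℝ) : ℂ) * deriv ψ x) x)) := by
        intro x
        rcases le_or_gt x 0 with hx | hx
        · rw [(hψ.rpow_mul (-a)).deriv.deriv.eq_zero hx, hψ.eq_zero hx,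
            (hψ.deriv.rpow_mul (-(2*a))).deriv.eq_zero hx]
          simp
        · rw [op_identity a hψ hx]; ring
      simp only [e4] at e1
      rw [integral_neg, e3] at e1
      rw [e2, ← e1]
      ring)
  -- second step
  set k : ℝ → ℂ := fun x => ((x ^ (2 * a) : ℝ) : ℂ) * (H x + d) with hk
  have hpc : Continuous fun x : ℝ => ((x ^ (2 * a) : ℝ) : ℂ) :=
    Complex.continuous_ofReal.comp (Real.continuous_rpow_const (by linarith))
  have hkc : Continuous k := hpc.mul (hHc.add continuous_const)
  set K : ℝ → ℂ := fun x => ∫ t in (0:ℝ)..x, k t with hK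
  have hKc : Continuous K :=
    intervalIntegral.continuous_primitive (fun u v => hkc.intervalIntegrable u v) 0
  obtain ⟨c, hc⟩ := duBois (fun χ => (∫ x, g x * (((x ^ a : ℝ) : ℂ) * χ x)) + ∫ x, K x * χ x)
    (by
      intro φ ψ c hφ hψ
      have h1 := (hφ.rpow_mul a).mul_integrable hg
      have h2 := (hψ.rpow_mul a).mul_integrable hg
      have h3 := hφ.mul_integrable hKc.locallyIntegrable
      have h4 := hψ.mul_integrable hKc.locallyIntegrable
      have e1 : ∀ x, g x * (((x ^ a : ℝ) : ℂ) * (φ x - c * ψ x))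
          = g x * (((x ^ a : ℝ) : ℂ) * φ x) - c * (g x * (((x ^ a : ℝ) : ℂ) * ψ x)) :=
        fun x => by ring
      have e2 : ∀ x, K x * (φ x - c * ψ x) = K x * φ x - c * (K x * ψ x) := fun x => by ring
      simp only [e1, e2]
      rw [integral_sub h1 (h2.const_mul c), integral_sub h3 (h4.const_mul c),
        integral_const_mul, integral_const_mul]
      ring)
    (by
      intro θ hθ
      have e1 := hd _ (hθ.rpow_mul (2 * a))
      have e2 := ibp hkc.locallyIntegrable hθ
      have e3 : (fun x : ℝ => ((x ^ (-(2 * a)) : ℝ) : ℂ) * (((x ^ (2 * a) : ℝ) : ℂ) * θ x)) = θ := by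
        ext x
        rcases le_or_gt x 0 with hx | hx
        · simp [hθ.eq_zero hx]
        · rw [← mul_assoc, ← Complex.ofReal_mul, ← Real.rpow_add hx]; simp
      have e4 : ∫ x, k x * θ x = (∫ x, H x * (((x ^ (2 * a) : ℝ) : ℂ) * θ x))
          + d * ∫ x : ℝ, ((x ^ (2 * a) : ℝ) : ℂ) * θ x := by
        rw [← integral_const_mul, ← integral_add
          ((hθ.rpow_mul (2*a)).mul_integrable hHc.locallyIntegrable)
          (((hθ.rpow_mul (2*a)).continuous.integrable_of_hasCompactSupport
            (hθ.rpow_mul (2*a)).2.1).const_mul d)]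
        congr 1; ext x; simp only [hk]; ring
      simp only [e3] at e1
      rw [e2, e4]
      linear_combination e1)
  -- a.e. identity
  have hae : ∀ᵐ x : ℝ, x ∈ Ioi (0:ℝ) → ((x ^ a : ℝ) : ℂ) * g x + K x - c = 0 := by
    have hac : Continuous fun x : ℝ => ((x ^ a : ℝ) : ℂ) :=
      Complex.continuous_ofReal.comp (Real.continuous_rpow_const ha)
    refine isOpen_Ioi.ae_eq_zero_of_integral_contDiff_smul_eq_zero ?_ ?_
    · refine LocallyIntegrable.locallyIntegrableOn ?_ _
      have l1 : LocallyIntegrable (fun x : ℝ => ((x ^ a : ℝ) : ℂ) * g x) volume := by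
        rw [← locallyIntegrableOn_univ] at hg ⊢
        exact hg.continuousOn_mul hac.continuousOn isOpen_univ.isLocallyClosed
      have l2 : LocallyIntegrable K volume := hKc.locallyIntegrable
      have l3 : LocallyIntegrable (fun _ : ℝ => c) volume := continuous_const.locallyIntegrable
      exact (l1.add l2).sub l3
    · intro f hf1 hf2 hf3
      have hP : PT (fun x => (f x : ℂ)) := by
        refine ⟨Complex.ofRealCLM.contDiff.comp hf1, hf2.comp_left (g := fun x : ℝ => (x : ℂ))
          (by simp), (tsupport_comp_subset (g := fun x : ℝ => (x : ℂ)) (by simp) _).trans hf3⟩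
      have e1 := hc _ hP
      have h1 := (hP.rpow_mul a).mul_integrable hg
      have h3 := hP.mul_integrable hKc.locallyIntegrable
      have h4 : Integrable (fun x => c * (f x : ℂ)) volume :=
        (hP.continuous.integrable_of_hasCompactSupport hP.2.1).const_mul c
      have e2 : ∀ x, f x • (((x ^ a : ℝ) : ℂ) * g x + K x - c)
          = g x * (((x ^ a : ℝ) : ℂ) * f x) + K x * f x - c * f x := by
        intro x; rw [Complex.real_smul]; ring
      simp only [e2]
      have h13 : Integrable (fun x => g x * (((x ^ a : ℝ) : ℂ) * f x) + K x * f x) volume :=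
        h1.add h3
      rw [integral_sub h13 h4, integral_add h1 h3, integral_const_mul, e1]
      ring
  have hpow : ∀ x : ℝ, 0 < x → ((x ^ a : ℝ) : ℂ) * ((x ^ (-a) : ℝ) : ℂ) = 1 := by
    intro x hx
    rw [← Complex.ofReal_mul, ← Real.rpow_add hx]; simp
  refine ⟨fun x => ((x ^ (-a) : ℝ) : ℂ) * (c - K x), c, -(d / ((2 * a + 1 : ℝ) : ℂ)), ?_, ?_, ?_, ?_⟩
  · refine ContinuousOn.mul ?_ (continuous_const.sub hKc).continuousOn
    refine Complex.continuous_ofReal.comp_continuousOn ?_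
    exact continuousOn_id.rpow_const fun x hx => Or.inl (ne_of_gt hx)
  · filter_upwards [hae] with x hx hx0
    have h1 := hx hx0
    have h2 := hpow x hx0
    linear_combination ((x ^ (-a) : ℝ) : ℂ) * h1 - g x * h2
  · have : Tendsto (fun x => c - K x) (nhdsWithin 0 (Ioi 0)) (nhds c) := by
      have : Tendsto (fun x => c - K x) (nhds 0) (nhds (c - K 0)) :=
        (hKc.tendsto 0).const_sub c
      rw [show K 0 = 0 by simp [hK], sub_zero] at this
      exact this.mono_left nhdsWithin_le_nhds
    refine this.congr' ?_
    filter_upwards [self_mem_nhdsWithin] with x hx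
    rw [← mul_assoc, hpow x hx, one_mul]
  · -- K x = d x^(2a+1)/(2a+1) + R x, ‖R x‖ ≤ ε x^(2a+1)
    have hK2 : ∀ x, K x = (∫ t in (0:ℝ)..x, ((t ^ (2 * a) : ℝ) : ℂ) * H t)
        + d * ((x ^ (2 * a + 1) / (2 * a + 1) : ℝ) : ℂ) := by
      intro x
      have : ((x ^ (2 * a + 1) / (2 * a + 1) : ℝ) : ℂ) = ∫ t in (0:ℝ)..x, ((t ^ (2 * a) : ℝ) : ℂ) := by
        rw [intervalIntegral.integral_ofReal, integral_rpow (Or.inl (by linarith)),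
          Real.zero_rpow (by linarith), sub_zero]
      have i1 : IntervalIntegrable (fun t : ℝ => ((t ^ (2 * a) : ℝ) : ℂ) * H t) volume 0 x :=
        (hpc.mul hHc).intervalIntegrable _ _
      have i2 : IntervalIntegrable (fun t : ℝ => d * ((t ^ (2 * a) : ℝ) : ℂ)) volume 0 x :=
        (continuous_const.mul hpc).intervalIntegrable _ _
      rw [this, ← intervalIntegral.integral_const_mul, ← intervalIntegral.integral_add i1 i2]
      simp only [hK, hk]
      congr 1; ext t; ring
    have hR : Tendsto (fun x : ℝ => ((x ^ (-(2 * a + 1)) : ℝ) : ℂ) *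
        ∫ t in (0:ℝ)..x, ((t ^ (2 * a) : ℝ) : ℂ) * H t) (nhdsWithin 0 (Ioi 0)) (nhds 0) := by
      rw [Metric.tendsto_nhdsWithin_nhds]
      intro ε hε
      have hH0 := hHc.tendsto 0
      rw [Metric.tendsto_nhds_nhds] at hH0
      obtain ⟨δ, hδ, hb⟩ := hH0 (ε / 2) (by linarith)
      refine ⟨δ, hδ, fun {x} hx hxd => ?_⟩
      have hx : 0 < x := hx
      rw [Real.dist_eq, sub_zero, abs_of_pos hx] at hxd
      have hH00 : H 0 = 0 := by simp [hH]
      have hbd := intervalIntegral.norm_integral_le_of_norm_le_const (a := 0) (b := x)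
        (C := x ^ (2 * a) * (ε / 2)) (f := fun t => ((t ^ (2 * a) : ℝ) : ℂ) * H t) (by
          intro t ht
          rw [uIoc_of_le hx.le] at ht
          have h1 : ‖H t‖ < ε / 2 := by
            have := @hb t (by
              rw [Real.dist_eq, sub_zero, abs_of_pos ht.1]; exact ht.2.trans_lt hxd)
            simpa [hH00] using this
          have h2 : t ^ (2 * a) ≤ x ^ (2 * a) := Real.rpow_le_rpow ht.1.le ht.2 (by linarith)
          rw [norm_mul, Complex.norm_real, Real.norm_of_nonneg (Real.rpow_nonneg ht.1.le _)]
          exact mul_le_mul h2 h1.le (norm_nonneg _) (Real.rpow_nonneg hx.le _))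
      rw [sub_zero, abs_of_pos hx] at hbd
      rw [dist_zero_right, norm_mul, Complex.norm_real,
        Real.norm_of_nonneg (Real.rpow_nonneg hx.le _)]
      have h3 : x ^ (-(2 * a + 1)) * (x ^ (2 * a) * (ε / 2) * x) = ε / 2 := by
        have : x ^ (2 * a) * x = x ^ (2 * a + 1) := by rw [Real.rpow_add_one hx.ne']
        rw [show x ^ (2 * a) * (ε / 2) * x = x ^ (2 * a + 1) * (ε / 2) by rw [← this]; ring,
          ← mul_assoc, ← Real.rpow_add hx]
        simp
      have h4 := mul_le_mul_of_nonneg_left hbd (Real.rpow_nonneg hx.le (-(2 * a + 1)))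
      linarith
    have hfin := (hR.neg).sub (tendsto_const_nhds (x := d / ((2 * a + 1 : ℝ) : ℂ)))
    rw [neg_zero, zero_sub] at hfin
    refine hfin.congr' ?_
    filter_upwards [self_mem_nhdsWithin] with x hx
    have hx : 0 < x := hx
    have r1 : x ^ (-(1 + a)) * x ^ (-a) = x ^ (-(2 * a + 1)) := by
      rw [← Real.rpow_add hx]; congr 1; ring
    have r2 : x ^ (-(2 * a + 1)) * x ^ (2 * a + 1) = 1 := by
      rw [← Real.rpow_add hx]; simp
    have r1' : ((x ^ (-(1 + a)) : ℝ) : ℂ) * ((x ^ (-a) : ℝ) : ℂ)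
      = ((x ^ (-(2 * a + 1)) : ℝ) : ℂ) := by rw [← r1]; push_cast; ring
    have r2' : ((x ^ (-(2 * a + 1)) : ℝ) : ℂ) * ((x ^ (2 * a + 1) : ℝ) : ℂ) = 1 := by
      rw [← Complex.ofReal_mul, r2]; simp
    rw [hK2]
    rw [Complex.ofReal_div]
    generalize (∫ t in (0:ℝ)..x, ((t ^ (2 * a) : ℝ) : ℂ) * H t) = I
    linear_combination (I + d * (((x ^ (2 * a + 1) : ℝ) : ℂ) / ((2 * a + 1 : ℝ) : ℂ))) * r1'
      + (d / ((2 * a + 1 : ℝ) : ℂ)) * r2'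

lemma tendsto_neg_nhdsLT_zero' :
    Tendsto (fun x : ℝ => -x) (nhdsWithin 0 (Iio 0)) (nhdsWithin 0 (Ioi 0)) := by
  simpa using tendsto_neg_nhdsLT (a := (0:ℝ))

/-- Every `g ∈ 𝒟` has a representative continuous away from the origin for which
the four boundary limits `g₀^±`, `g₁^±` exist and are finite. -/
theorem boundary_limits_exist (α : ℝ) (hα : α ∈ Set.Ico (0 : ℝ) 1)
    (g : L2R) (hg : InD α g) :
    ∃ G : ℝ → ℂ, (∀ᵐ x : ℝ, g x = G x) ∧ ContinuousOn G {x : ℝ | x ≠ 0} ∧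
      ∃ g0p g0m g1p g1m : ℂ, HasBoundary α G g0p g0m g1p g1m := by
  obtain ⟨h, hact⟩ := hg
  have ha : 0 ≤ α / 2 := by have := hα.1; linarith
  have ha' : α / 2 < 1 / 2 := by have := hα.2; linarith
  have hC : ∀ x : ℝ, α * (α + 2) / 4 / x ^ 2 = α / 2 * (α / 2 + 1) / x ^ 2 := by
    intro x; congr 1; ring
  have hgl : LocallyIntegrable g := (Lp.memLp g).locallyIntegrable (by norm_num)
  have hneg : MeasurePreserving (fun x : ℝ => -x) := Measure.measurePreserving_neg _
  obtain ⟨G1, c1, e1, hG1, hae1, hc1, he1⟩ := half ha ha' hgl (Lp.memLp h) (by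
    intro φ hφ
    have := hact φ ⟨hφ.1, hφ.2.1, fun x hx => ne_of_gt (hφ.2.2 hx)⟩
    simpa only [hC] using this)
  have hg2 : MemLp (fun x => g (-x)) 2 := (Lp.memLp g).comp_measurePreserving hneg
  have hh2 : MemLp (fun x => h (-x)) 2 := (Lp.memLp h).comp_measurePreserving hneg
  obtain ⟨G2, c2, e2, hG2, hae2, hc2, he2⟩ := half ha ha'
      (hg2.locallyIntegrable (by norm_num)) hh2 (by
    intro φ hφ
    have ht : TestFun (fun x => φ (-x)) := by
      refine ⟨hφ.1.comp contDiff_neg, hφ.2.1.comp_homeomorph (Homeomorph.neg ℝ), ?_⟩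
      intro x hx
      have hx' : x ∈ (fun x : ℝ => -x) ⁻¹' tsupport φ :=
        tsupport_comp_subset_preimage φ continuous_neg hx
      have : 0 < -x := hφ.2.2 hx'
      exact ne_of_lt (by linarith)
    have h1 := hact _ ht
    have hd1 : deriv (fun x => φ (-x)) = fun x => -deriv φ (-x) := by
      ext x; exact deriv_comp_neg φ x
    have hd2 : deriv (deriv (fun x => φ (-x))) = fun x => deriv (deriv φ) (-x) := by
      rw [hd1]; ext x
      rw [deriv.fun_neg, deriv_comp_neg (deriv φ) x, neg_neg]
    rw [hd2, ← integral_neg_eq_self, ← integral_neg_eq_self (fun x => h x * φ (-x))] at h1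
    simpa only [hC, neg_neg, even_two, Even.neg_pow] using h1)
  have hae2' : ∀ᵐ x : ℝ, -x ∈ Ioi (0:ℝ) → g (- -x) = G2 (-x) :=
    hneg.quasiMeasurePreserving.ae hae2
  have h0 : ∀ᵐ x : ℝ, x ≠ 0 := by simp [ae_iff]
  refine ⟨fun x => if 0 < x then G1 x else G2 (-x), ?_, ?_, c1, c2, e1, e2, ?_, ?_, ?_, ?_⟩
  · filter_upwards [hae1, hae2', h0] with x h1 h2 h3
    rcases lt_or_gt_of_ne h3 with hx | hx
    · have := h2 (neg_pos.2 hx)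
      rw [neg_neg] at this
      simp [not_lt.2 hx.le, this]
    · simp [hx, h1 hx]
  · intro x hx
    refine ContinuousAt.continuousWithinAt ?_
    rcases lt_or_gt_of_ne hx with hx | hx
    · have h1 : ContinuousAt (fun x => G2 (-x)) x :=
        ContinuousAt.comp (g := G2) (hG2.continuousAt (Ioi_mem_nhds (neg_pos.2 hx)))
          continuous_neg.continuousAt
      refine h1.congr ?_
      filter_upwards [Iio_mem_nhds hx] with y hy
      have hy : y < 0 := hy
      simp [not_lt.2 hy.le]
    · refine (hG1.continuousAt (Ioi_mem_nhds hx)).congr ?_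
      filter_upwards [Ioi_mem_nhds hx] with y hy
      have hy : 0 < y := hy
      simp [hy]
  · refine hc1.congr' ?_
    filter_upwards [self_mem_nhdsWithin] with x hx
    have hx : 0 < x := hx
    simp [hx, abs_of_pos hx]
  · refine (hc2.comp tendsto_neg_nhdsLT_zero').congr' ?_
    filter_upwards [self_mem_nhdsWithin] with x hx
    have hx : x < 0 := hx
    simp [not_lt.2 hx.le, abs_of_neg hx]
  · refine he1.congr' ?_
    filter_upwards [self_mem_nhdsWithin] with x hx
    have hx : 0 < x := hx
    simp [hx, abs_of_pos hx]
  · refine (he2.comp tendsto_neg_nhdsLT_zero').congr' ?_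
    filter_upwards [self_mem_nhdsWithin] with x hx
    have hx : x < 0 := hx
    simp [not_lt.2 hx.le, abs_of_neg hx]

end
end

section
/- For every α ∈ [0,1), the spectrum of the bridging operator A_α^B is exactly [0,+∞): (i) for every z ∈ ℂ with z ∉ [0,+∞), the map g ↦ A_α^B g − z g is a bijection from 𝒟(A_α^B) onto L²(ℝ); (ii) for every λ ≥ 0 there exists a sequence (g_n) in 𝒟(A_α^B) with ‖g_n‖_{L²} = 1 for all n and ‖A_α^B g_n − λ g_n‖_{L²} → 0 as n → ∞. -/
open MeasureTheory Filter Set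

noncomputable section

/-- Membership in the domain of the bridging operator `A_α^B`:
`g` lies in the maximal domain `𝒟` and its continuous representative satisfies the
bridging boundary conditions `g₀⁺ = g₀⁻` and `g₁⁺ = -g₁⁻` at the origin. -/
def InDomB (α : ℝ) (g : L2R) : Prop :=
  InD α g ∧
  ∃ (G : ℝ → ℂ) (g0 g1 : ℂ), (∀ᵐ x : ℝ, g x = G x) ∧ ContinuousOn G {x : ℝ | x ≠ 0} ∧
    HasBoundary α G g0 g0 g1 (-g1)

/-- The graph of the bridging operator `A_α^B` : `g ∈ 𝒟(A_α^B)` and `u = A_α^B g`. -/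
def GraphB (α : ℝ) (g u : L2R) : Prop := InDomB α g ∧ ActsAs α g u

lemma br_hasDerivAt_abs_rpow (s : ℝ) {x : ℝ} (hx : x ≠ 0) :
    HasDerivAt (fun y : ℝ => |y| ^ s) (s * |x| ^ s / x) x := by
  have h1 := hasDerivAt_abs hx
  have h2 := h1.rpow_const (p := s) (Or.inl (abs_ne_zero.mpr hx))
  convert h2 using 1
  rw [Real.rpow_sub_one (abs_ne_zero.mpr hx)]
  rcases lt_or_gt_of_ne hx with h | h
  · simp [h, abs_of_neg h]; field_simp
  · simp [h, abs_of_pos h]; field_simp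

lemma continuous_abs_rpow {s : ℝ} (hs : 0 ≤ s) : Continuous (fun y : ℝ => |y| ^ s) :=
  continuous_abs.rpow_const (fun _ => Or.inr hs)

lemma contDiffAt_abs_rpow (s : ℝ) {x : ℝ} (hx : x ≠ 0) :
    ContDiffAt ℝ (⊤ : ℕ∞) (fun y : ℝ => |y| ^ s) x :=
  (contDiffAt_abs hx).rpow_const_of_ne (abs_ne_zero.mpr hx)

lemma intervalIntegrable_abs_rpow {r : ℝ} (hr : -1 < r) (a b : ℝ) :
    IntervalIntegrable (fun x : ℝ => |x| ^ r) volume a b := by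
  have hpos : ∀ c : ℝ, 0 ≤ c → IntervalIntegrable (fun x : ℝ => |x| ^ r) volume 0 c := by
    intro c hc
    refine (intervalIntegral.intervalIntegrable_rpow' (a := 0) (b := c) hr).congr ?_
    intro x hx
    rw [uIoc_of_le hc] at hx
    simp [abs_of_pos hx.1]
  have hall : ∀ c : ℝ, IntervalIntegrable (fun x : ℝ => |x| ^ r) volume 0 c := by
    intro c
    rcases le_total 0 c with hc | hc
    · exact hpos c hc
    · rw [IntervalIntegrable.iff_comp_neg]
      simpa using hpos (-c) (by linarith)
  exact (hall a).symm.trans (hall b)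

lemma locallyIntegrable_of_intervalIntegrable {E : Type*} [NormedAddCommGroup E] {f : ℝ → E}
    (h : ∀ a b, IntervalIntegrable f volume a b) : LocallyIntegrable f := by
  intro x
  refine ⟨Ioc (x-1) (x+1), Ioc_mem_nhds (by linarith) (by linarith), ?_⟩
  exact (intervalIntegrable_iff_integrableOn_Ioc_of_le (by linarith)).mp (h _ _)

lemma MeasureTheory.LocallyIntegrable.ii {E : Type*} [NormedAddCommGroup E] {f : ℝ → E}
    (h : LocallyIntegrable f) (a b : ℝ) : IntervalIntegrable f volume a b := by
  rw [intervalIntegrable_iff]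
  exact (h.integrableOn_isCompact isCompact_uIcc).mono_set uIoc_subset_uIcc

lemma measurable_abs_rpow (r : ℝ) : Measurable (fun x : ℝ => |x| ^ r) := by fun_prop

lemma locInt_weight {α : ℝ} (h1 : α < 1) (u : L2R) :
    LocallyIntegrable (fun t : ℝ => ((|t| ^ (-(α/2)) : ℝ) : ℂ) * u t) := by
  have hu : Integrable (fun t => ‖u t‖ ^ 2) :=
    (memLp_two_iff_integrable_sq_norm (Lp.aestronglyMeasurable u)).mp (Lp.memLp u)
  have ha : LocallyIntegrable (fun t : ℝ => |t| ^ (-α)) :=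
    locallyIntegrable_of_intervalIntegrable (intervalIntegrable_abs_rpow (by linarith))
  refine (ha.add hu.locallyIntegrable).mono ?_ ?_
  · exact ((measurable_abs_rpow _).complex_ofReal.aestronglyMeasurable).mul
      (Lp.aestronglyMeasurable u)
  · refine Eventually.of_forall fun t => ?_
    have e : |t| ^ (-α) = (|t| ^ (-(α/2))) ^ 2 ∨ t = 0 := by
      by_cases h : t = 0
      · exact Or.inr h
      · left
        rw [← Real.rpow_natCast, ← Real.rpow_mul (abs_nonneg t)]; congr 1; push_cast; ring
    have hn : 0 ≤ |t| ^ (-(α/2)) := Real.rpow_nonneg (abs_nonneg t) _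
    rw [norm_mul, Complex.norm_real, Real.norm_of_nonneg hn]
    have e2 : |t| ^ (-α) = (|t| ^ (-(α/2))) ^ 2 := by
      rw [← Real.rpow_natCast, ← Real.rpow_mul (abs_nonneg t)]; congr 1; push_cast; ring
    simp only [Pi.add_apply]
    rw [e2, Real.norm_of_nonneg (by positivity)]
    nlinarith [sq_nonneg (|t| ^ (-(α/2)) - ‖u t‖), sq_nonneg (|t| ^ (-(α/2)) + ‖u t‖)]

lemma locInt_weight' {s : ℝ} (hs : 0 ≤ s) (u : L2R) :
    LocallyIntegrable (fun t : ℝ => ((|t| ^ s : ℝ) : ℂ) * u t) := by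
  have := (Lp.memLp u).locallyIntegrable (by norm_num)
  refine locallyIntegrable_of_intervalIntegrable fun a b => ?_
  exact (this.ii a b).continuousOn_mul
    (Complex.continuous_ofReal.comp (continuous_abs_rpow hs)).continuousOn

lemma acC {F : ℝ → ℂ} (hF : LocallyIntegrable F) (a b : ℝ) (hab : (0:ℝ) ∈ uIcc a b) :
    AbsolutelyContinuousOnInterval (fun x => ∫ t in (0:ℝ)..x, F t) a b := by
  have hre : IntervalIntegrable (fun x => (F x).re) volume a b := by
    have := hF.ii a b
    exact ⟨this.1.re, this.2.re⟩
  have him : IntervalIntegrable (fun x => (F x).im) volume a b := by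
    have := hF.ii a b
    exact ⟨this.1.im, this.2.im⟩
  have A := hre.absolutelyContinuousOnInterval_intervalIntegral (c := 0) hab
  have B := him.absolutelyContinuousOnInterval_intervalIntegral (c := 0) hab
  have k : ∀ c : ℂ, AbsolutelyContinuousOnInterval (fun _ : ℝ => c) a b := fun c =>
    (contDiff_const.contDiffOn (s := uIcc a b)).absolutelyContinuousOnInterval
  have := (A.smul (k 1)).add (B.smul (k Complex.I))
  convert! this using 1
  funext x
  simp only [Pi.add_apply, Pi.smul_apply']
  have h := hF.ii 0 x
  apply Complex.ext
  · have := Complex.reCLM.intervalIntegral_comp_comm h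
    simp at this
    simp [this]
  · have := Complex.imCLM.intervalIntegral_comp_comm h
    simp at this
    simp [this]

/-- integration by parts, primitive of locally integrable times C¹. -/
lemma ibp_s5 {F θ θ' : ℝ → ℂ} (c : ℂ) (hF : LocallyIntegrable F) (hθ : ∀ x, HasDerivAt θ (θ' x) x)
    (hθ' : Continuous θ') {a b : ℝ} (hab : (0:ℝ) ∈ uIcc a b) :
    ∫ x in a..b, (F x * θ x + (c + ∫ t in (0:ℝ)..x, F t) * θ' x)
      = (c + ∫ t in (0:ℝ)..b, F t) * θ b - (c + ∫ t in (0:ℝ)..a, F t) * θ a := by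
  set P : ℝ → ℂ := fun x => c + ∫ t in (0:ℝ)..x, F t with hP
  have hθc : Continuous θ := continuous_iff_continuousAt.mpr fun x => (hθ x).continuousAt
  have hPc : Continuous P := continuous_const.add
    (intervalIntegral.continuous_primitive (fun a b => hF.ii a b) 0)
  have hθ1 : ContDiff ℝ 1 θ := by
    rw [contDiff_one_iff_deriv]
    refine ⟨fun x => (hθ x).differentiableAt, ?_⟩
    rwa [show deriv θ = θ' from funext fun x => (hθ x).deriv]
  have k : AbsolutelyContinuousOnInterval (fun _ : ℝ => c) a b := 
    (contDiff_const.contDiffOn (s := uIcc a b)).absolutelyContinuousOnInterval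
  have hPac : AbsolutelyContinuousOnInterval P a b := k.add (acC hF a b hab)
  have hQ : LocallyIntegrable (fun x => F x * θ x + P x * θ' x) := by
    refine LocallyIntegrable.add ?_ (hPc.mul hθ').locallyIntegrable
    refine locallyIntegrable_of_intervalIntegrable fun a b => ?_
    exact (hF.ii a b).mul_continuousOn hθc.continuousOn
  have hac := (hPac.smul (hθ1.contDiffOn.absolutelyContinuousOnInterval)).sub (acC hQ a b hab)
  have hd : ∀ᵐ x, x ∈ uIcc a b → HasDerivAt (P • θ - fun x => ∫ t in (0:ℝ)..x, (F t * θ t + P t * θ' t)) 0 x := by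
    filter_upwards [(hF.ii a b).ae_hasDerivAt_integral, (hQ.ii a b).ae_hasDerivAt_integral] with x h1 h2 hx
    have h1 := ((h1 hx 0 hab).const_add c).mul (hθ x)
    convert! h1.sub (h2 hx 0 hab) using 1
    simp [hP]
  obtain ⟨C, hC⟩ := hac.const_of_ae_hasDerivAt_zero hd
  have e1 := hC a left_mem_uIcc
  have e2 := hC b right_mem_uIcc
  simp only [Pi.sub_apply, smul_eq_mul, Pi.mul_apply, hP] at e1 e2 hQ
  rw [← intervalIntegral.integral_interval_sub_left (hQ.ii 0 b) (hQ.ii 0 a)]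
  linear_combination e1 - e2

lemma exists_Ioc_support {f : ℝ → ℂ} (hf : HasCompactSupport f) :
    ∃ R : ℝ, 0 < R ∧ tsupport f ⊆ Ioo (-R) R := by
  obtain ⟨R, hR⟩ := hf.isCompact.isBounded.subset_ball_lt 0 0
  refine ⟨R, hR.1, hR.2.trans ?_⟩
  rw [Real.ball_eq_Ioo]; simp

lemma ibp0 {F θ θ' : ℝ → ℂ} (c : ℂ) (hF : LocallyIntegrable F) (hθ : ∀ x, HasDerivAt θ (θ' x) x)
    (hθ' : Continuous θ') (hc : HasCompactSupport θ) :
    ∫ x, (F x * θ x) = - ∫ x, (c + ∫ t in (0:ℝ)..x, F t) * θ' x := by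
  obtain ⟨R, hR, hs⟩ := exists_Ioc_support hc
  have hd : deriv θ = θ' := funext fun x => (hθ x).deriv
  have hsd : tsupport θ' ⊆ tsupport θ := hd ▸ tsupport_deriv_subset
  have hc' : HasCompactSupport θ' := hd ▸ hc.deriv
  have hθc : Continuous θ := continuous_iff_continuousAt.mpr fun x => (hθ x).continuousAt
  have hPc : Continuous (fun x => c + ∫ t in (0:ℝ)..x, F t) := continuous_const.add
    (intervalIntegral.continuous_primitive (fun a b => hF.ii a b) 0)
  have h := ibp_s5 c hF hθ hθ' (a := -R) (b := R) (by simp [hR.le])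
  have i1 : Integrable (fun x => F x * θ x) := by
    simpa using hF.integrable_smul_right_of_hasCompactSupport hθc hc
  have i2 : Integrable (fun x => (c + ∫ t in (0:ℝ)..x, F t) * θ' x) :=
    (hPc.mul hθ').integrable_of_hasCompactSupport hc'.mul_left
  have z1 : θ R = 0 := image_eq_zero_of_notMem_tsupport fun hh => by
    have := hs hh; simp at this
  have z2 : θ (-R) = 0 := image_eq_zero_of_notMem_tsupport fun hh => by
    have := hs hh; simp at this
  rw [intervalIntegral.integral_eq_integral_of_support_subset, integral_add i1 i2, z1, z2] at h
  · linear_combination h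
  · intro x hx
    have : x ∈ tsupport θ := by
      by_contra hn
      apply hx
      have hn' : x ∉ tsupport θ' := fun h => hn (hsd h)
      simp [image_eq_zero_of_notMem_tsupport hn, image_eq_zero_of_notMem_tsupport hn']
    exact Ioo_subset_Ioc_self (hs this)

def Pf (α : ℝ) (b : ℂ) (u : L2R) (x : ℝ) : ℂ :=
  b + ∫ t in (0:ℝ)..x, -(((|t| ^ (-(α/2)) : ℝ) : ℂ) * u t)

def Vf (α : ℝ) (a b : ℂ) (u : L2R) (x : ℝ) : ℂ :=
  a + ∫ t in (0:ℝ)..x, ((|t| ^ α : ℝ) : ℂ) * Pf α b u t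

lemma continuous_Pf {α : ℝ} (h1 : α < 1) (b : ℂ) (u : L2R) : Continuous (Pf α b u) :=
  continuous_const.add
    (intervalIntegral.continuous_primitive (fun a b => (locInt_weight h1 u).neg.ii a b) 0)

lemma continuous_wPf {α : ℝ} (h0 : 0 ≤ α) (h1 : α < 1) (b : ℂ) (u : L2R) :
    Continuous (fun t : ℝ => ((|t| ^ α : ℝ) : ℂ) * Pf α b u t) :=
  (Complex.continuous_ofReal.comp (continuous_abs_rpow h0)).mul (continuous_Pf h1 b u)

lemma hasDerivAt_Vf {α : ℝ} (h0 : 0 ≤ α) (h1 : α < 1) (a b : ℂ) (u : L2R) (x : ℝ) :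
    HasDerivAt (Vf α a b u) (((|x| ^ α : ℝ) : ℂ) * Pf α b u x) x :=
  ((continuous_wPf h0 h1 b u).integral_hasStrictDerivAt 0 x).hasDerivAt.const_add a

lemma continuous_Vf {α : ℝ} (h0 : 0 ≤ α) (h1 : α < 1) (a b : ℂ) (u : L2R) :
    Continuous (Vf α a b u) :=
  continuous_iff_continuousAt.mpr fun x => (hasDerivAt_Vf h0 h1 a b u x).continuousAt

structure CoreC (α : ℝ) (η ψ : ℝ → ℂ) : Prop where
  sm : ContDiff ℝ 1 η
  ce : HasCompactSupport η
  cp : HasCompactSupport ψ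
  hd : ∀ x, HasDerivAt ψ (((|x| ^ α : ℝ) : ℂ) * η x) x

lemma CoreC.cont {α : ℝ} {η ψ : ℝ → ℂ} (h : CoreC α η ψ) : Continuous ψ :=
  continuous_iff_continuousAt.mpr fun x => (h.hd x).continuousAt

lemma CoreC.hde {α : ℝ} {η ψ : ℝ → ℂ} (h : CoreC α η ψ) (x : ℝ) : HasDerivAt η (deriv η x) x :=
  (h.sm.differentiable (by norm_num) x).hasDerivAt

lemma CoreC.cde {α : ℝ} {η ψ : ℝ → ℂ} (h : CoreC α η ψ) : Continuous (deriv η) :=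
  h.sm.continuous_deriv (by norm_num)

lemma weakIBP {α : ℝ} (h0 : 0 ≤ α) (h1 : α < 1) (a b : ℂ) (u : L2R) {η ψ : ℝ → ℂ}
    (h : CoreC α η ψ) :
    ∫ x, Vf α a b u x * -(deriv η x) = ∫ x, u x * (((|x| ^ (-(α/2)) : ℝ) : ℂ) * ψ x) := by
  have A := ibp0 a (continuous_wPf h0 h1 b u).locallyIntegrable h.hde h.cde h.ce
  have B := ibp0 b (locInt_weight h1 u).neg h.hd
    ((Complex.continuous_ofReal.comp (continuous_abs_rpow h0)).mul h.sm.continuous) h.cp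
  change _ = - ∫ x, Vf α a b u x * deriv η x at A
  change _ = - ∫ x, Pf α b u x * (((|x| ^ α : ℝ) : ℂ) * η x) at B
  have e1 : ∫ x, Vf α a b u x * -(deriv η x) = - ∫ x, Vf α a b u x * deriv η x := by
    rw [← integral_neg]; congr 1; funext x; ring
  have e2 : ∫ x, u x * (((|x| ^ (-(α/2)) : ℝ) : ℂ) * ψ x) = -∫ x, (-fun t : ℝ => ((|t| ^ (-(α/2)) : ℝ) : ℂ) * u t) x * ψ x := by
    rw [← integral_neg]; congr 1; funext x; simp; ring
  rw [e1, ← A, e2, B, neg_neg]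
  congr 1; funext x; ring

/-- compactly supported primitive -/
lemma exists_prim {s : Set ℝ} (hne : s.Nonempty) (hoc : s.OrdConnected) {k : ℝ → ℝ}
    (hk : Continuous k) (hc : HasCompactSupport k) (hs : tsupport k ⊆ s) (hi : ∫ x, k x = 0) :
    ∃ ψ : ℝ → ℝ, (∀ x, HasDerivAt ψ (k x) x) ∧ HasCompactSupport ψ ∧ tsupport ψ ⊆ s := by
  obtain ⟨a, b, hab, hIs, hks⟩ : ∃ a b : ℝ, a ≤ b ∧ Icc a b ⊆ s ∧ tsupport k ⊆ Icc a b := by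
    rcases (tsupport k).eq_empty_or_nonempty with he | hn
    · obtain ⟨y, hy⟩ := hne
      exact ⟨y, y, le_rfl, by simpa using hy, by simp [he]⟩
    · have hC : IsCompact (tsupport k) := hc
      refine ⟨sInf (tsupport k), sSup (tsupport k), ?_, ?_, ?_⟩
      · exact Real.sInf_le_sSup _ hC.bddBelow hC.bddAbove
      · exact hoc.out (hs (hC.sInf_mem hn)) (hs (hC.sSup_mem hn))
      · exact subset_Icc_csInf_csSup hC.bddBelow hC.bddAbove
  have hz : ∀ x, x ∉ Icc a b → k x = 0 := fun x hx =>
    image_eq_zero_of_notMem_tsupport fun h => hx (hks h)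
  have hsup : Function.support (fun x => ∫ t in a..x, k t) ⊆ Icc a b := by
    intro x hx
    by_contra hn
    apply hx
    rcases lt_or_ge x a with h | h
    · show ∫ t in a..x, k t = 0
      rw [intervalIntegral.integral_symm, intervalIntegral.integral_of_le h.le,
        integral_Ioc_eq_integral_Ioo, setIntegral_eq_zero_of_forall_eq_zero, neg_zero]
      intro t ht
      exact hz t fun h' => by linarith [ht.2, h'.1]
    · have hb : b < x := by
        by_contra hb
        exact hn ⟨h, not_lt.mp hb⟩
      show ∫ t in a..x, k t = 0
      rw [intervalIntegral.integral_of_le h, ← integral_Icc_eq_integral_Ioc,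
        setIntegral_eq_integral_of_forall_compl_eq_zero, hi]
      intro t ht
      exact hz t fun h' => ht ⟨h'.1, h'.2.trans hb.le⟩
  have hts : tsupport (fun x => ∫ t in a..x, k t) ⊆ Icc a b := closure_minimal hsup isClosed_Icc
  refine ⟨fun x => ∫ t in a..x, k t, fun x => (hk.integral_hasStrictDerivAt a x).hasDerivAt,
    ?_, hts.trans hIs⟩
  exact HasCompactSupport.of_support_subset_isCompact isCompact_Icc hsup

lemma exists_bump {s : Set ℝ} (hne : s.Nonempty) (hs : IsOpen s) :
    ∃ η : ℝ → ℝ, ContDiff ℝ (⊤ : ℕ∞) η ∧ HasCompactSupport η ∧ tsupport η ⊆ s ∧ (∀ x, 0 ≤ η x) ∧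
      ∃ y, y ≠ 0 ∧ η y ≠ 0 := by
  obtain ⟨y, hy⟩ := hne
  obtain ⟨y, hy, hy0⟩ : ∃ y ∈ s, y ≠ 0 := by
    obtain ⟨w, hw⟩ := (dense_compl_singleton (0:ℝ)).inter_open_nonempty s hs ⟨y, hy⟩
    exact ⟨w, hw.1, hw.2⟩
  obtain ⟨f, hf⟩ := exists_contDiff_tsupport_subset (n := ⊤) (hs.mem_nhds hy)
  exact ⟨f, hf.2.2.1, hf.2.1, hf.1, fun x => (hf.2.2.2.1 (mem_range_self x)).1, y, hy0, by simp [hf.2.2.2.2]⟩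

structure CoreR (α : ℝ) (s : Set ℝ) (η ψ : ℝ → ℝ) : Prop where
  sm : ContDiff ℝ (⊤ : ℕ∞) η
  ce : HasCompactSupport η
  se : tsupport η ⊆ s
  cp : HasCompactSupport ψ
  sp : tsupport ψ ⊆ s
  hd : ∀ x, HasDerivAt ψ (|x| ^ α * η x) x

lemma deriv_ofReal' {η : ℝ → ℝ} (h : ContDiff ℝ (⊤ : ℕ∞) η) (x : ℝ) :
    HasDerivAt (fun x => (η x : ℂ)) ((deriv η x : ℝ) : ℂ) x :=
  ((h.differentiable (by norm_num)) x).hasDerivAt.ofReal_comp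

lemma CoreR.toC {α : ℝ} {s : Set ℝ} {η ψ : ℝ → ℝ} (h : CoreR α s η ψ) :
    CoreC α (fun x => (η x : ℂ)) (fun x => (ψ x : ℂ)) where
  sm := Complex.ofRealCLM.contDiff.comp (h.sm.of_le (by exact_mod_cast le_top))
  ce := h.ce.comp_left (g := fun x : ℝ => (x : ℂ)) (by simp)
  cp := h.cp.comp_left (g := fun x : ℝ => (x : ℂ)) (by simp)
  hd := fun x => by simpa using (h.hd x).ofReal_comp

lemma tsupport_lin {s : Set ℝ} {f g : ℝ → ℝ} (hf : tsupport f ⊆ s) (hg : tsupport g ⊆ s) (c : ℝ) :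
    tsupport (fun x => f x - c * g x) ⊆ s := by
  refine (tsupport_sub (f := f) (g := fun x => c * g x)).trans (union_subset hf ?_)
  exact (tsupport_mul_subset_right).trans hg

lemma compact_lin {f g : ℝ → ℝ} (hf : HasCompactSupport f) (hg : HasCompactSupport g) (c : ℝ) :
    HasCompactSupport (fun x => f x - c * g x) := 
  hf.sub (hg.mul_left (f := fun _ => c))

lemma int_mul_cs {w : ℝ → ℂ} (hw : LocallyIntegrable w) {k : ℝ → ℝ} (hk : Continuous k)
    (hc : HasCompactSupport k) : Integrable (fun x => w x * (k x : ℂ)) := by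
  have := hw.integrable_smul_right_of_hasCompactSupport (g := fun x => (k x : ℂ))
    (Complex.continuous_ofReal.comp hk) (hc.comp_left (g := fun x : ℝ => (x : ℂ)) (by simp))
  simpa using this

lemma dbr1 {s : Set ℝ} (hne : s.Nonempty) (hs : IsOpen s) (hoc : s.OrdConnected) {w : ℝ → ℂ}
    (hw : LocallyIntegrable w)
    (h : ∀ η : ℝ → ℝ, ContDiff ℝ (⊤ : ℕ∞) η → HasCompactSupport η → tsupport η ⊆ s →
      ∫ x, w x * ((deriv η x : ℝ) : ℂ) = 0) :
    ∃ A : ℂ, ∀ᵐ x, x ∈ s → w x = A := by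
  obtain ⟨η₁, sm, cs, ss, nn, y, -, hy⟩ := exists_bump hne hs
  set m := ∫ x, η₁ x with hm
  have hm0 : 0 < m := sm.continuous.integral_pos_of_hasCompactSupport_nonneg_nonzero cs nn hy
  set A : ℂ := (∫ x, w x * (η₁ x : ℂ)) / m with hA
  refine ⟨A, ?_⟩
  have := hs.ae_eq_zero_of_integral_contDiff_smul_eq_zero (μ := volume) (f := fun x => w x - A)
    ((hw.sub (locallyIntegrable_const A)).locallyIntegrableOn s) ?_
  · filter_upwards [this] with x hx hxs
    exact sub_eq_zero.mp (hx hxs)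
  intro θ hθ cθ sθ
  set c := (∫ x, θ x) / m with hc
  have i1 := hθ.continuous.integrable_of_hasCompactSupport (μ := volume) cθ
  have i2 := sm.continuous.integrable_of_hasCompactSupport (μ := volume) cs
  have i1' : Integrable (fun x => (θ x : ℂ)) := i1.ofReal
  have ksm : ContDiff ℝ (⊤ : ℕ∞) (fun x => θ x - c * η₁ x) := hθ.sub (contDiff_const.mul sm)
  obtain ⟨η, hη, cη, sη⟩ := exists_prim hne hoc (k := fun x => θ x - c * η₁ x) ksm.continuous
    (compact_lin cθ cs c) (tsupport_lin sθ ss c) (by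
      rw [integral_sub i1 (i2.const_mul c), integral_const_mul, ← hm, hc]; field_simp; simp)
  have hdη : deriv η = fun x => θ x - c * η₁ x := funext fun x => (hη x).deriv
  have hsmη : ContDiff ℝ (⊤ : ℕ∞) η := by
    refine contDiff_infty_iff_deriv.mpr ⟨fun x => (hη x).differentiableAt, ?_⟩
    rw [hdη]; exact ksm
  have key := h η hsmη cη sη
  have j1 := int_mul_cs hw hθ.continuous cθ
  have j2 := int_mul_cs hw sm.continuous cs
  have e1 : ∫ x, w x * ((deriv η x : ℝ) : ℂ) = (∫ x, w x * (θ x : ℂ)) - c * ∫ x, w x * (η₁ x : ℂ) := by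
    rw [← integral_const_mul, ← integral_sub j1 (j2.const_mul _)]
    congr 1; funext x; rw [hdη]; push_cast; ring
  have e2 : ∫ x, θ x • (w x - A) = (∫ x, w x * (θ x : ℂ)) - A * ((∫ x, θ x : ℝ) : ℂ) := by
    rw [← integral_complex_ofReal, ← integral_const_mul, ← integral_sub j1 (i1'.const_mul _)]
    congr 1; funext x; simp; ring
  rw [e2]
  rw [e1] at key
  have hmc : (m : ℂ) ≠ 0 := by exact_mod_cast hm0.ne'
  rw [← key, hA, hc]
  push_cast
  field_simp

lemma dbr2 {α : ℝ} (h0 : 0 ≤ α) {s : Set ℝ} (hne : s.Nonempty) (hs : IsOpen s)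
    (hoc : s.OrdConnected) {w : ℝ → ℂ} (hw : LocallyIntegrable w)
    (h : ∀ η ψ : ℝ → ℝ, CoreR α s η ψ → ∫ x, w x * ((deriv η x : ℝ) : ℂ) = 0) :
    ∃ A B : ℂ, ∀ᵐ x, x ∈ s → w x = A + B * ∫ t in (0:ℝ)..x, ((|t| ^ α : ℝ) : ℂ) := by
  obtain ⟨η₁, sm, cs, ss, nn, y, hy0, hy⟩ := exists_bump hne hs
  have hcw := continuous_abs_rpow h0
  have hcwC : Continuous (fun t : ℝ => ((|t| ^ α : ℝ) : ℂ)) := Complex.continuous_ofReal.comp hcw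
  set m := ∫ x, |x| ^ α * η₁ x with hm
  have hm0 : 0 < m := (hcw.mul sm.continuous).integral_pos_of_hasCompactSupport_nonneg_nonzero
    cs.mul_left (fun x => mul_nonneg (Real.rpow_nonneg (abs_nonneg x) _) (nn x))
    (x := y) (mul_ne_zero (Real.rpow_pos_of_pos (abs_pos.mpr hy0) _).ne' hy)
  set B : ℂ := (∫ x, w x * ((deriv η₁ x : ℝ) : ℂ)) / m with hB
  have hYc : Continuous (fun x => ∫ t in (0:ℝ)..x, ((|t| ^ α : ℝ) : ℂ)) :=
    intervalIntegral.continuous_primitive (fun a b => hcwC.intervalIntegrable a b) 0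
  have hBY : Continuous (fun x => B * ∫ t in (0:ℝ)..x, ((|t| ^ α : ℝ) : ℂ)) :=
    continuous_const.mul hYc
  have hw2 : LocallyIntegrable (fun x => w x + B * ∫ t in (0:ℝ)..x, ((|t| ^ α : ℝ) : ℂ)) :=
    hw.add hBY.locallyIntegrable
  obtain ⟨A, hA⟩ := dbr1 hne hs hoc hw2 (fun η hη cη sη => by
    set c := (∫ x, |x| ^ α * η x) / m with hc
    have i1 : Integrable (fun x => |x| ^ α * η x) := (hcw.mul hη.continuous).integrable_of_hasCompactSupport (μ := volume) cη.mul_left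
    have i2 : Integrable (fun x => |x| ^ α * η₁ x) := (hcw.mul sm.continuous).integrable_of_hasCompactSupport (μ := volume) cs.mul_left
    have ksm : ContDiff ℝ (⊤ : ℕ∞) (fun x => η x - c * η₁ x) := hη.sub (contDiff_const.mul sm)
    have kc := compact_lin cη cs c
    have ks := tsupport_lin sη ss c
    obtain ⟨ψ, hψ, cψ, sψ⟩ := exists_prim hne hoc (k := fun x => |x| ^ α * (η x - c * η₁ x))
      (hcw.mul ksm.continuous) kc.mul_left (tsupport_mul_subset_right.trans ks) (by
      have : ∀ x : ℝ, |x| ^ α * (η x - c * η₁ x) = |x| ^ α * η x - c * (|x| ^ α * η₁ x) := by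
        intro x; ring
      simp_rw [this]
      rw [integral_sub i1 (i2.const_mul c), integral_const_mul, ← hm, hc]; field_simp; simp)
    have key := h _ ψ ⟨ksm, kc, ks, cψ, sψ, hψ⟩
    have d1 := hη.continuous_deriv (by norm_num)
    have d2 := sm.continuous_deriv (by norm_num)
    have j1 := int_mul_cs hw d1 cη.deriv
    have j2 := int_mul_cs hw d2 cs.deriv
    have j3 := int_mul_cs hBY.locallyIntegrable d1 cη.deriv
    have e1 : ∫ x, w x * ((deriv (fun x => η x - c * η₁ x) x : ℝ) : ℂ)
        = (∫ x, w x * ((deriv η x : ℝ) : ℂ)) - c * ∫ x, w x * ((deriv η₁ x : ℝ) : ℂ) := by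
      rw [← integral_const_mul, ← integral_sub j1 (j2.const_mul _)]
      congr 1; funext x
      have := ((hη.differentiable (by norm_num) x).hasDerivAt.sub
        ((sm.differentiable (by norm_num) x).hasDerivAt.const_mul c)).deriv
      have h3 : deriv (fun x => η x - c * η₁ x) x = deriv η x - c * deriv η₁ x := this
      rw [h3]; push_cast; ring
    have e2 := ibp0 0 hcwC.locallyIntegrable (deriv_ofReal' hη)
      (Complex.continuous_ofReal.comp d1) (cη.comp_left (g := fun x : ℝ => (x : ℂ)) (by simp))
    simp only [zero_add] at e2
    have e3 : ∫ x, ((|x| ^ α : ℝ) : ℂ) * (η x : ℂ) = ((∫ x, |x| ^ α * η x : ℝ) : ℂ) := by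
      rw [← integral_complex_ofReal]; congr 1; funext x; push_cast; ring
    have e4 : ∫ x, (w x + B * ∫ t in (0:ℝ)..x, ((|t| ^ α : ℝ) : ℂ)) * ((deriv η x : ℝ) : ℂ)
        = (∫ x, w x * ((deriv η x : ℝ) : ℂ)) + B * ∫ x, (∫ t in (0:ℝ)..x, ((|t| ^ α : ℝ) : ℂ)) * ((deriv η x : ℝ) : ℂ) := by
      rw [← integral_const_mul, ← integral_add j1]
      · congr 1; funext x; ring
      · refine j3.congr (Eventually.of_forall fun x => ?_)
        simp only; ring
    rw [e1] at key
    rw [e3] at e2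
    have hmc : (m : ℂ) ≠ 0 := by exact_mod_cast hm0.ne'
    have hcc : (c : ℂ) * m = ((∫ x, |x| ^ α * η x : ℝ) : ℂ) := by
      rw [hc]; push_cast; field_simp
    have hBB : B * m = ∫ x, w x * ((deriv η₁ x : ℝ) : ℂ) := by rw [hB]; field_simp
    rw [e4]
    linear_combination key - (c:ℂ) * hBB + B * hcc + B * e2)
  refine ⟨A, -B, ?_⟩
  filter_upwards [hA] with x hx hxs
  linear_combination hx hxs

lemma rpow_neg_mul {s : ℝ} {x : ℝ} (hx : x ≠ 0) :
    ((|x| ^ (-s) : ℝ) : ℂ) * ((|x| ^ s : ℝ) : ℂ) = 1 := by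
  rw [← Complex.ofReal_mul, ← Real.rpow_add (abs_pos.mpr hx)]; simp

lemma ae_ne_zero : ∀ᵐ x : ℝ, x ≠ 0 := by
  simp [ae_iff, measure_singleton]

lemma Vf_lin {α : ℝ} (h0 : 0 ≤ α) (h1 : α < 1) (a b : ℂ) (u : L2R) (x : ℝ) :
    Vf α a b u x = a + b * (∫ t in (0:ℝ)..x, ((|t| ^ α : ℝ) : ℂ)) + Vf α 0 0 u x := by
  have hcw : Continuous (fun t : ℝ => ((|t| ^ α : ℝ) : ℂ)) :=
    Complex.continuous_ofReal.comp (continuous_abs_rpow h0)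
  have e : ∀ t, ((|t| ^ α : ℝ) : ℂ) * Pf α b u t = b * ((|t| ^ α : ℝ) : ℂ) + ((|t| ^ α : ℝ) : ℂ) * Pf α 0 u t := by
    intro t; unfold Pf; ring
  unfold Vf
  simp_rw [e]
  rw [intervalIntegral.integral_add, intervalIntegral.integral_const_mul]
  · ring
  · exact (continuous_const.mul hcw).intervalIntegrable _ _
  · exact (continuous_wPf h0 h1 0 u).intervalIntegrable _ _

/-- Regularity. -/
lemma regularity {α : ℝ} (h0 : 0 ≤ α) (h1 : α < 1) {s : Set ℝ} (hne : s.Nonempty) (hs : IsOpen s)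
    (hoc : s.OrdConnected) (g u : L2R)
    (h : ∀ η ψ : ℝ → ℝ, CoreR α s η ψ →
      ∫ x, g x * ((-(|x| ^ (α/2) * deriv η x) : ℝ) : ℂ)
        = ∫ x, u x * ((|x| ^ (-(α/2)) * ψ x : ℝ) : ℂ)) :
    ∃ a b : ℂ, ∀ᵐ x, x ∈ s → g x = ((|x| ^ (-(α/2)) : ℝ) : ℂ) * Vf α a b u x := by
  have hV := continuous_Vf h0 h1 0 0 u
  have hgw := locInt_weight' (s := α/2) (by linarith) g
  obtain ⟨A, B, hAB⟩ := dbr2 h0 hne hs hoc (hgw.sub hV.locallyIntegrable) (fun η ψ hc => by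
    have d1 := hc.sm.continuous_deriv (by norm_num)
    have j1 := int_mul_cs hgw d1 hc.ce.deriv
    have j2 := int_mul_cs hV.locallyIntegrable d1 hc.ce.deriv
    have k1 := h η ψ hc
    have k2 := weakIBP h0 h1 0 0 u hc.toC
    have e0 : ∀ x, deriv (fun x => (η x : ℂ)) x = ((deriv η x : ℝ) : ℂ) := fun x =>
      (deriv_ofReal' hc.sm x).deriv
    simp only [e0] at k2
    have e : ∀ x, ((fun t : ℝ => ((|t| ^ (α/2) : ℝ) : ℂ) * g t) - Vf α 0 0 u) x * ((deriv η x : ℝ) : ℂ)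
      = ((|x| ^ (α/2) : ℝ) : ℂ) * g x * ((deriv η x : ℝ) : ℂ) - Vf α 0 0 u x * ((deriv η x : ℝ) : ℂ) := by
      intro x; simp only [Pi.sub_apply]; ring
    simp_rw [e]
    rw [integral_sub j1 j2]
    have f1 : ∫ x, g x * ((-(|x| ^ (α/2) * deriv η x) : ℝ) : ℂ) = -∫ x, ((|x| ^ (α/2) : ℝ) : ℂ) * g x * ((deriv η x : ℝ) : ℂ) := by
      rw [← integral_neg]; congr 1; funext x; push_cast; ring
    have f2 : ∫ x, Vf α 0 0 u x * -((deriv η x : ℝ) : ℂ) = - ∫ x, Vf α 0 0 u x * ((deriv η x : ℝ) : ℂ) := by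
      rw [← integral_neg]; congr 1; funext x; ring
    have f3 : ∫ x, u x * ((|x| ^ (-(α/2)) * ψ x : ℝ) : ℂ) = ∫ x, u x * (((|x| ^ (-(α/2)) : ℝ):ℂ) * (ψ x : ℂ)) := by
      congr 1; funext x; push_cast; ring
    rw [f1, f3, ← k2, f2] at k1
    linear_combination -k1)
  refine ⟨A, B, ?_⟩
  filter_upwards [hAB, ae_ne_zero] with x hx hx0 hxs
  have := hx hxs
  simp only [Pi.sub_apply] at this
  have hr := rpow_neg_mul (s := α/2) hx0
  rw [Vf_lin h0 h1]
  linear_combination ((|x| ^ (-(α/2)) : ℝ) : ℂ) * this - g x * hr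

lemma smooth_smul {E : Type*} [NormedAddCommGroup E] [NormedSpace ℝ E] (s : ℝ) {φ : ℝ → E}
    (h : ContDiff ℝ (⊤ : ℕ∞) φ) (h0 : (0:ℝ) ∉ tsupport φ) :
    ContDiff ℝ (⊤ : ℕ∞) (fun x => |x| ^ s • φ x) := by
  rw [contDiff_iff_contDiffAt]
  intro x
  by_cases hx : x = 0
  · subst hx
    have : (fun x => |x| ^ s • φ x) =ᶠ[nhds 0] fun _ => (0 : E) := by
      filter_upwards [notMem_tsupport_iff_eventuallyEq.mp h0] with y hy
      simp [hy]
    exact contDiffAt_const.congr_of_eventuallyEq this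
  · exact (contDiffAt_abs_rpow s hx).smul h.contDiffAt

lemma tsupport_wsmul {E : Type*} [NormedAddCommGroup E] [NormedSpace ℝ E] (s : ℝ) (φ : ℝ → E) :
    tsupport (fun x => |x| ^ s • φ x) ⊆ tsupport φ := 
  closure_mono fun x hx hn => hx (by simp only [hn, smul_zero])

lemma Lcalc {α : ℝ} {φ ψ η η' : ℝ → ℂ}
    (hφ : ∀ y, y ≠ 0 → φ y = ((|y| ^ (-(α/2)) : ℝ) : ℂ) * ψ y)
    (hψ : ∀ y, HasDerivAt ψ (((|y| ^ α : ℝ) : ℂ) * η y) y)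
    (hη : ∀ y, HasDerivAt η (η' y) y) {x : ℝ} (hx : x ≠ 0) :
    -(deriv (deriv φ) x) + ((α * (α + 2) / 4 / x ^ 2 : ℝ) : ℂ) * φ x
      = -(((|x| ^ (α/2) : ℝ) : ℂ) * η' x) := by
  have hw : ∀ s y : ℝ, y ≠ 0 → HasDerivAt (fun y : ℝ => ((|y| ^ s : ℝ) : ℂ))
      ((s : ℂ) * ((|y| ^ s : ℝ) : ℂ) / (y : ℂ)) y := by
    intro s y hy
    have := (br_hasDerivAt_abs_rpow s hy).ofReal_comp
    push_cast at this
    exact_mod_cast this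
  have hq : ∀ y : ℝ, y ≠ 0 → ((|y| ^ (-(α/2)) : ℝ) : ℂ) * ((|y| ^ α : ℝ) : ℂ) = ((|y| ^ (α/2) : ℝ) : ℂ) := by
    intro y hy
    rw [← Complex.ofReal_mul, ← Real.rpow_add (abs_pos.mpr hy)]; congr 2; ring
  have hxx : ∀ᶠ y in nhds x, y ≠ 0 := eventually_ne_nhds hx
  have h1 : ∀ y, y ≠ 0 → HasDerivAt φ (-(α/2 : ℂ) * ((|y| ^ (-(α/2)) : ℝ) : ℂ) * ψ y / y
      + ((|y| ^ (α/2) : ℝ) : ℂ) * η y) y := by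
    intro y hy
    have := (hw (-(α/2)) y hy).mul (hψ y)
    have h2 := this.congr_of_eventuallyEq (f₁ := φ) (by
      filter_upwards [eventually_ne_nhds hy] with t ht
      rw [hφ t ht]; rfl)
    convert! h2 using 1
    rw [← hq y hy]; push_cast; ring
  have hd : deriv φ =ᶠ[nhds x] fun y => -(α/2 : ℂ) * ((|y| ^ (-(α/2)) : ℝ) : ℂ) * ψ y / y
      + ((|y| ^ (α/2) : ℝ) : ℂ) * η y := by
    filter_upwards [hxx] with y hy using (h1 y hy).deriv
  have hx' : (x : ℂ) ≠ 0 := by exact_mod_cast hx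
  have hid : HasDerivAt (fun y : ℝ => (y : ℂ)) 1 x := by
    simpa using (hasDerivAt_id x).ofReal_comp
  have h2 := ((((hw (-(α/2)) x hx).const_mul (-(α/2 : ℂ))).mul (hψ x)).div hid hx').add
    ((hw (α/2) x hx).mul (hη x))
  rw [hd.deriv_eq]
  have h3 := h2.deriv
  refine Eq.trans (congrArg (fun t => -t + _) h3) ?_
  rw [hφ x hx]
  simp only [Pi.mul_apply]
  rw [← hq x hx]
  push_cast
  field_simp
  ring

def InG (α : ℝ) (g u : L2R) : Prop :=
  ∃ a b : ℂ, ∀ᵐ x : ℝ, g x = ((|x| ^ (-(α/2)) : ℝ) : ℂ) * Vf α a b u x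

lemma InG.actsAs {α : ℝ} (h0 : 0 ≤ α) (h1 : α < 1) {g u : L2R} (h : InG α g u) :
    ActsAs α g u := by
  obtain ⟨a, b, hab⟩ := h
  intro φ hφ
  obtain ⟨sm, cs, ss⟩ := hφ
  have n0 : (0:ℝ) ∉ tsupport φ := fun h => ss h rfl
  set ψ : ℝ → ℂ := fun x => |x| ^ (α/2) • φ x with hψ
  have smψ : ContDiff ℝ (⊤ : ℕ∞) ψ := smooth_smul (α/2) sm n0
  have tψ : tsupport ψ ⊆ tsupport φ := tsupport_wsmul (α/2) φ
  have tdψ : tsupport (deriv ψ) ⊆ tsupport φ := tsupport_deriv_subset.trans tψ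
  have smdψ : ContDiff ℝ (⊤ : ℕ∞) (deriv ψ) := (contDiff_infty_iff_deriv.mp smψ).2
  have n1 : (0:ℝ) ∉ tsupport (deriv ψ) := fun h => n0 (tdψ h)
  set η : ℝ → ℂ := fun x => |x| ^ (-α) • deriv ψ x with hη
  have smη : ContDiff ℝ (⊤ : ℕ∞) η := smooth_smul (-α) smdψ n1
  have tη : tsupport η ⊆ tsupport φ := (tsupport_wsmul (-α) (deriv ψ)).trans tdψ
  have hdψ : ∀ y, HasDerivAt ψ (((|y| ^ α : ℝ) : ℂ) * η y) y := by
    intro y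
    have hD : HasDerivAt ψ (deriv ψ y) y := (smψ.differentiable (by norm_num) y).hasDerivAt
    have e : ((|y| ^ α : ℝ) : ℂ) * η y = deriv ψ y := by
      show ((|y| ^ α : ℝ) : ℂ) * (|y| ^ (-α) • deriv ψ y) = _
      rw [Complex.real_smul]
      by_cases hy : y = 0
      · subst hy
        have : deriv ψ 0 = 0 := image_eq_zero_of_notMem_tsupport n1
        rw [this, mul_zero, mul_zero]
      · have := rpow_neg_mul (s := α) hy
        linear_combination deriv ψ y * this
    rw [e]; exact hD
  have hφψ : ∀ y, y ≠ 0 → φ y = ((|y| ^ (-(α/2)) : ℝ) : ℂ) * ψ y := by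
    intro y hy
    simp only [hψ, Complex.real_smul]
    linear_combination -φ y * rpow_neg_mul (s := α/2) hy
  have core : CoreC α η ψ := ⟨smη.of_le (by exact_mod_cast le_top),
    cs.of_isClosed_subset (isClosed_tsupport _) tη, cs.of_isClosed_subset (isClosed_tsupport _) tψ, hdψ⟩
  have key := weakIBP h0 h1 a b u core
  calc _ = ∫ x, Vf α a b u x * -(deriv η x) := by
        refine integral_congr_ae ?_
        filter_upwards [hab, ae_ne_zero] with x hx hx0
        rw [Lcalc hφψ hdψ core.hde hx0, hx]
        linear_combination (-(Vf α a b u x * deriv η x)) * rpow_neg_mul (s := α/2) hx0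
    _ = _ := key
    _ = _ := by
        refine integral_congr_ae ?_
        filter_upwards [ae_ne_zero] with x hx0
        rw [hφψ x hx0]

lemma actsAs_regularity {α : ℝ} (h0 : 0 ≤ α) (h1 : α < 1) {g u : L2R} (h : ActsAs α g u)
    {s : Set ℝ} (hne : s.Nonempty) (hs : IsOpen s) (hoc : s.OrdConnected) (hs0 : (0:ℝ) ∉ s) :
    ∃ a b : ℂ, ∀ᵐ x, x ∈ s → g x = ((|x| ^ (-(α/2)) : ℝ) : ℂ) * Vf α a b u x := by
  refine regularity h0 h1 hne hs hoc g u fun η ψ hc => ?_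
  have n0 : (0:ℝ) ∉ tsupport η := fun h => hs0 (hc.se h)
  have n1 : (0:ℝ) ∉ tsupport ψ := fun h => hs0 (hc.sp h)
  have smψ : ContDiff ℝ (⊤ : ℕ∞) ψ := by
    refine contDiff_infty_iff_deriv.mpr ⟨fun x => (hc.hd x).differentiableAt, ?_⟩
    rw [show deriv ψ = fun x => |x| ^ α • η x from funext fun x => (hc.hd x).deriv]
    exact smooth_smul α hc.sm n0
  have smφ := smooth_smul (-(α/2)) smψ n1
  have tφ := tsupport_wsmul (-(α/2)) ψ
  have smφC : ContDiff ℝ (⊤ : ℕ∞) (fun x => ((|x| ^ (-(α/2)) * ψ x : ℝ) : ℂ)) :=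
    Complex.ofRealCLM.contDiff.comp smφ
  have tφC : tsupport (fun x => ((|x| ^ (-(α/2)) * ψ x : ℝ) : ℂ)) ⊆ tsupport ψ := 
    closure_mono fun x hx hn => hx (by simp only [hn, mul_zero]; simp)
  have tf : TestFun (fun x => ((|x| ^ (-(α/2)) * ψ x : ℝ) : ℂ)) :=
    ⟨smφC, hc.cp.of_isClosed_subset (isClosed_tsupport _) tφC, fun x hx => by
      rintro rfl; exact n1 (tφC hx)⟩
  have key := h _ tf
  rw [← key]
  refine integral_congr_ae ?_
  filter_upwards [ae_ne_zero] with x hx0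
  rw [Lcalc (α := α) (ψ := fun x => (ψ x : ℂ)) (η := fun x => (η x : ℂ)) (η' := fun x => ((deriv η x : ℝ):ℂ))
    (fun y hy => by push_cast; ring) hc.toC.hd (deriv_ofReal' hc.sm) hx0]
  push_cast; ring

lemma Y_eq {α : ℝ} (h0 : 0 ≤ α) (x : ℝ) :
    ∫ t in (0:ℝ)..x, ((|t| ^ α : ℝ) : ℂ) = ((x * |x| ^ α / (1 + α) : ℝ) : ℂ) := by
  rw [intervalIntegral.integral_ofReal]
  congr 1
  have hc : Continuous (fun x : ℝ => x * |x| ^ α / (1 + α)) :=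
    (continuous_id.mul (continuous_abs_rpow h0)).div_const _
  have := integral_eq_of_hasDerivAt_off_countable (f := fun x : ℝ => x * |x| ^ α / (1 + α))
    (f' := fun x => |x| ^ α) (a := 0) (b := x) (s := {0}) (countable_singleton 0) hc.continuousOn
    (fun y hy => by
      have hy0 : y ≠ 0 := hy.2
      have := ((hasDerivAt_id y).mul (br_hasDerivAt_abs_rpow α hy0)).div_const (1 + α)
      convert! this using 1
      simp
      field_simp) ((continuous_abs_rpow h0).intervalIntegrable _ _)
  rw [this]; simp

lemma Vf_zero (α : ℝ) (a b : ℂ) (u : L2R) : Vf α a b u 0 = a := by simp [Vf]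

lemma bd_main {α : ℝ} (h0 : 0 ≤ α) (h1 : α < 1) (a b : ℂ) (u : L2R) :
    Tendsto (fun x : ℝ => ((|x| ^ (-(1 + α)) : ℝ) : ℂ) *
      (Vf α a b u x - a - b * ((x * |x| ^ α / (1 + α) : ℝ) : ℂ))) (nhdsWithin 0 {0}ᶜ) (nhds 0) := by
  rw [Metric.tendsto_nhds]
  intro ε hε
  have hP : Tendsto (Pf α b u) (nhds 0) (nhds b) := by
    have := (continuous_Pf h1 b u).tendsto 0
    simpa [Pf] using this
  obtain ⟨δ, hδ, hb⟩ := Metric.eventually_nhds_iff.mp ((Metric.tendsto_nhds.mp hP) (ε/2) (by linarith))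
  have hnear : ∀ᶠ x in nhdsWithin (0:ℝ) {0}ᶜ, dist x 0 < δ :=
    mem_nhdsWithin_of_mem_nhds (Metric.ball_mem_nhds 0 hδ)
  filter_upwards [hnear, self_mem_nhdsWithin] with x hx hx0
  have hx0 : x ≠ 0 := hx0
  have hcw : Continuous (fun t : ℝ => ((|t| ^ α : ℝ) : ℂ)) :=
    Complex.continuous_ofReal.comp (continuous_abs_rpow h0)
  have e : Vf α a b u x - a - b * ((x * |x| ^ α / (1 + α) : ℝ) : ℂ)
      = ∫ t in (0:ℝ)..x, ((|t| ^ α : ℝ) : ℂ) * (Pf α b u t - b) := by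
    rw [← Y_eq h0, ← intervalIntegral.integral_const_mul]
    unfold Vf
    have i2 : IntervalIntegrable (fun t : ℝ => b * ((|t| ^ α : ℝ) : ℂ)) volume 0 x :=
      (continuous_const.mul hcw).intervalIntegrable _ _
    rw [add_sub_cancel_left, ← intervalIntegral.integral_sub
      ((continuous_wPf h0 h1 b u).intervalIntegrable _ _) i2]
    congr 1; funext t; ring
  have hbound : ‖∫ t in (0:ℝ)..x, ((|t| ^ α : ℝ) : ℂ) * (Pf α b u t - b)‖ ≤ (|x| ^ α * (ε/2)) * |x - 0| := by
    refine intervalIntegral.norm_integral_le_of_norm_le_const fun t ht => ?_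
    have htx : |t| ≤ |x| := by
      rcases le_total 0 x with h | h
      · rw [uIoc_of_le h] at ht
        rw [abs_of_pos ht.1, abs_of_nonneg h]; exact ht.2
      · rw [uIoc_of_ge h] at ht
        rw [abs_of_nonpos ht.2, abs_of_nonpos h]; linarith [ht.1]
    rw [norm_mul, Complex.norm_real, Real.norm_of_nonneg (Real.rpow_nonneg (abs_nonneg t) _)]
    have : dist (Pf α b u t) b < ε/2 := hb (by
      rw [Real.dist_eq, sub_zero] at hx ⊢; linarith)
    rw [dist_eq_norm] at this
    have h3 := Real.rpow_le_rpow (abs_nonneg t) htx h0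
    exact mul_le_mul h3 this.le (norm_nonneg _) (Real.rpow_nonneg (abs_nonneg x) _)
  rw [dist_zero_right, e, norm_mul, Complex.norm_real, Real.norm_of_nonneg (Real.rpow_nonneg (abs_nonneg x) _)]
  have hxp := abs_pos.mpr hx0
  calc _ ≤ |x| ^ (-(1+α)) * ((|x| ^ α * (ε/2)) * |x - 0|) :=
        mul_le_mul_of_nonneg_left hbound (Real.rpow_nonneg (abs_nonneg x) _)
    _ = ε/2 := by
        have : |x| ^ (-(1+α)) * |x| ^ (1 + α) = 1 := by
          rw [← Real.rpow_add hxp]; simp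
        rw [Real.rpow_add hxp, Real.rpow_one] at this
        rw [sub_zero]
        linear_combination (ε/2) * this
    _ < ε := by linarith

lemma bd0 {α : ℝ} (h0 : 0 ≤ α) (h1 : α < 1) (a b : ℂ) (u : L2R) :
    Tendsto (fun x : ℝ => ((|x| ^ (α/2) : ℝ) : ℂ) * (((|x| ^ (-(α/2)) : ℝ) : ℂ) * Vf α a b u x))
      (nhdsWithin 0 {0}ᶜ) (nhds a) := by
  have : Tendsto (Vf α a b u) (nhdsWithin 0 {0}ᶜ) (nhds a) := by
    have := (continuous_Vf h0 h1 a b u).tendsto 0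
    rw [Vf_zero] at this
    exact this.mono_left nhdsWithin_le_nhds
  refine this.congr' ?_
  filter_upwards [self_mem_nhdsWithin] with x hx0
  have hx0 : x ≠ 0 := hx0
  linear_combination -(Vf α a b u x) * rpow_neg_mul (s := α/2) hx0

lemma bd1 {α : ℝ} (h0 : 0 ≤ α) (h1 : α < 1) (a b : ℂ) (u : L2R) (σ : ℝ) (s : Set ℝ)
    (hs : ∀ x ∈ s, x ≠ 0 ∧ x = σ * |x|) :
    Tendsto (fun x : ℝ => ((|x| ^ (-(1 + α/2)) : ℝ) : ℂ) * ((((|x| ^ (-(α/2)) : ℝ) : ℂ) * Vf α a b u x)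
      - a * ((|x| ^ (-(α/2)) : ℝ) : ℂ)))
      (nhdsWithin 0 s) (nhds (σ * (b / (1 + α)))) := by
  have := ((bd_main h0 h1 a b u).mono_left (nhdsWithin_mono 0 (fun x hx => (hs x hx).1 : s ⊆ {0}ᶜ))).add_const ((σ:ℂ) * (b / (1 + α)))
  rw [zero_add] at this
  refine this.congr' ?_
  filter_upwards [self_mem_nhdsWithin] with x hx
  obtain ⟨hx0, hσ⟩ := hs x hx
  have hxp := abs_pos.mpr hx0
  have e1 : ((|x| ^ (-(1 + α/2)) : ℝ) : ℂ) * ((|x| ^ (-(α/2)) : ℝ) : ℂ) = ((|x| ^ (-(1+α)) : ℝ) : ℂ) := by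
    rw [← Complex.ofReal_mul, ← Real.rpow_add hxp]; congr 2; ring
  have e2 : ((|x| ^ (-(1+α)) : ℝ) : ℂ) * ((x * |x| ^ α / (1 + α) : ℝ) : ℂ) = (σ:ℂ) / (1 + α) := by
    have : |x| ^ (-(1+α)) * |x| ^ (1 + α) = 1 := by
      rw [← Real.rpow_add hxp]; simp
    rw [Real.rpow_add hxp, Real.rpow_one] at this
    have e3 : |x| ^ (-(1+α)) * (x * |x| ^ α / (1 + α)) = σ / (1 + α) := by
      have : |x| ^ (-(1+α)) * (x * |x| ^ α) = σ := by
        rw [show x * |x| ^ α = σ * |x| * |x| ^ α by rw [← hσ]]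
        linear_combination σ * this
      rw [← mul_div_assoc, this]
    exact_mod_cast e3
  linear_combination (- b) * e2 - (Vf α a b u x - a) * e1

lemma hσp : ∀ x ∈ Ioi (0:ℝ), x ≠ 0 ∧ x = 1 * |x| := fun x hx => by
  have : 0 < x := hx
  exact ⟨this.ne', by rw [abs_of_pos this, one_mul]⟩
lemma hσm : ∀ x ∈ Iio (0:ℝ), x ≠ 0 ∧ x = (-1) * |x| := fun x hx => by
  have : x < 0 := hx
  exact ⟨this.ne, by rw [abs_of_neg this]; ring⟩

lemma InG.inDomB {α : ℝ} (h0 : 0 ≤ α) (h1 : α < 1) {g u : L2R} (h : InG α g u) :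
    InDomB α g := by
  refine ⟨⟨u, h.actsAs h0 h1⟩, ?_⟩
  obtain ⟨a, b, hab⟩ := h
  refine ⟨_, a, b / (1 + α), hab, ?_, ?_, ?_, ?_, ?_⟩
  · intro x hx
    refine ContinuousAt.continuousWithinAt ?_
    refine ContinuousAt.mul ?_ (continuous_Vf h0 h1 a b u).continuousAt
    exact Complex.continuous_ofReal.continuousAt.comp (contDiffAt_abs_rpow _ hx).continuousAt
  · exact (bd0 h0 h1 a b u).mono_left (nhdsWithin_mono 0 fun x hx => (hσp x hx).1)
  · exact (bd0 h0 h1 a b u).mono_left (nhdsWithin_mono 0 fun x hx => (hσm x hx).1)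
  · simpa using bd1 h0 h1 a b u 1 _ hσp
  · simpa using bd1 h0 h1 a b u (-1) _ hσm

lemma side {α : ℝ} (h0 : 0 ≤ α) (h1 : α < 1) {g u : L2R} {G : ℝ → ℂ}
    (hG : ∀ᵐ x : ℝ, g x = G x) (hGc : ContinuousOn G {x : ℝ | x ≠ 0}) (h : ActsAs α g u)
    {s : Set ℝ} (hne : s.Nonempty) (hs : IsOpen s) (hoc : s.OrdConnected)
    {σ : ℝ} (hσ : ∀ x ∈ s, x ≠ 0 ∧ x = σ * |x|) (hnb : (nhdsWithin 0 s).NeBot) {g0 g1 : ℂ}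
    (l0 : Tendsto (fun x : ℝ => ((|x| ^ (α / 2) : ℝ) : ℂ) * G x) (nhdsWithin 0 s) (nhds g0))
    (l1 : Tendsto (fun x : ℝ => ((|x| ^ (-(1 + α / 2)) : ℝ) : ℂ) *
      (G x - g0 * ((|x| ^ (-(α / 2)) : ℝ) : ℂ))) (nhdsWithin 0 s) (nhds g1)) :
    ∃ b : ℂ, σ * (b / (1 + α)) = g1 ∧ 
      ∀ᵐ x, x ∈ s → g x = ((|x| ^ (-(α/2)) : ℝ) : ℂ) * Vf α g0 b u x := by
  obtain ⟨a, b, hab⟩ := actsAs_regularity h0 h1 h hne hs hoc (fun h => (hσ 0 h).1 rfl)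
  have hcr : ContinuousOn (fun x => ((|x| ^ (-(α/2)) : ℝ) : ℂ) * Vf α a b u x) s := by
    intro x hx
    refine ContinuousAt.continuousWithinAt ?_
    refine ContinuousAt.mul ?_ (continuous_Vf h0 h1 a b u).continuousAt
    exact Complex.continuous_ofReal.continuousAt.comp (contDiffAt_abs_rpow _ (hσ x hx).1).continuousAt
  have heq : EqOn G (fun x => ((|x| ^ (-(α/2)) : ℝ) : ℂ) * Vf α a b u x) s := by
    refine Measure.eqOn_open_of_ae_eq (μ := volume) ?_ hs (hGc.mono fun x hx => (hσ x hx).1) hcr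
    rw [EventuallyEq, ae_restrict_iff' hs.measurableSet]
    filter_upwards [hG, hab] with x hx hx2 hxs
    rw [← hx, hx2 hxs]
  have hev : ∀ᶠ x in nhdsWithin 0 s, G x = ((|x| ^ (-(α/2)) : ℝ) : ℂ) * Vf α a b u x := by
    filter_upwards [self_mem_nhdsWithin] with x hx using heq hx
  have ha : g0 = a := by
    refine tendsto_nhds_unique l0 ?_
    refine Tendsto.congr' ?_ ((bd0 h0 h1 a b u).mono_left (nhdsWithin_mono 0 fun x hx => (hσ x hx).1))
    filter_upwards [hev] with x hx
    rw [hx]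
  subst ha
  refine ⟨b, ?_, hab⟩
  refine tendsto_nhds_unique ?_ l1
  refine Tendsto.congr' ?_ (bd1 h0 h1 g0 b u σ s hσ)
  filter_upwards [hev] with x hx
  rw [hx]

lemma inG_of {α : ℝ} (h0 : 0 ≤ α) (h1 : α < 1) {g u : L2R} (h : InDomB α g) (hu : ActsAs α g u) :
    InG α g u := by
  obtain ⟨-, G, g0, g1, hG, hGc, l1, l2, l3, l4⟩ := h
  obtain ⟨b, hb, hp⟩ := side h0 h1 hG hGc hu (s := Ioi 0) ⟨1, by simp⟩ isOpen_Ioi ordConnected_Ioi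
    hσp inferInstance l1 l3
  obtain ⟨b', hb', hm⟩ := side h0 h1 hG hGc hu (s := Iio 0) ⟨-1, by simp⟩ isOpen_Iio ordConnected_Iio
    hσm inferInstance l2 l4
  have hne : (1 + (α:ℂ)) ≠ 0 := by
    have : (1 + α) ≠ 0 := by linarith
    exact_mod_cast this
  have : b' = b := by
    have : b' / (1 + α) = b / (1 + α) := by
      push_cast at hb hb'
      linear_combination -hb' - hb
    field_simp at this
    exact this
  subst this
  refine ⟨g0, b', ?_⟩
  filter_upwards [hp, hm, ae_ne_zero] with x h1 h2 h3
  rcases lt_or_gt_of_ne h3 with h | h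
  · exact h2 h
  · exact h1 h

lemma l2_norm_sq (g : L2R) : ‖g‖ ^ 2 = ∫ x, ‖g x‖ ^ 2 := by
  have h := inner_self_eq_norm_sq (𝕜 := ℂ) g
  rw [L2.inner_def] at h
  rw [← h]
  have : ∀ x, inner ℂ (g x) (g x) = ((‖g x‖ ^ 2 : ℝ) : ℂ) := fun x => by
    rw [inner_self_eq_norm_sq_to_K]; norm_cast
  simp_rw [this]
  rw [integral_complex_ofReal]
  rfl

lemma l2_sq_int (g : L2R) : Integrable (fun x => ‖g x‖ ^ 2) := 
  (memLp_two_iff_integrable_sq_norm (Lp.memLp g).1).1 (Lp.memLp g)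

lemma ptw (w z G τ f : ℂ) (X Y c : ℝ) (hc : 0 < c) (h1 : c ≤ w.re) (h2 : c ≤ (-(w * z)).re) :
    c / 2 * X ^ 2 * ‖G‖ ^ 2 - ‖w‖ ^ 2 / c * (X ^ 2 * ‖f‖ ^ 2 + Y ^ 2 * ‖G‖ ^ 2) ≤
      (w * (-((X:ℂ) ^ 2 * star G * (f + z * G)) + (X:ℂ) ^ 2 * (τ * star τ)
        + 2 * X * Y * (τ * star G))).re := by
  have e : w * (-((X:ℂ) ^ 2 * star G * (f + z * G)) + (X:ℂ) ^ 2 * (τ * star τ)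
        + 2 * X * Y * (τ * star G)) = ((X ^ 2 * ‖τ‖ ^ 2 : ℝ) : ℂ) * w + ((X ^ 2 * ‖G‖ ^ 2 : ℝ) : ℂ) * (-(w * z))
        - ((X ^ 2 : ℝ) : ℂ) * (w * star G * f) + ((2 * X * Y : ℝ) : ℂ) * (w * τ * star G) := by
    have a1 : τ * star τ = ((‖τ‖ ^ 2 : ℝ) : ℂ) := by
      have := Complex.mul_conj τ
      rw [Complex.normSq_eq_norm_sq] at this; exact this
    have a2 : G * star G = ((‖G‖ ^ 2 : ℝ) : ℂ) := by
      have := Complex.mul_conj G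
      rw [Complex.normSq_eq_norm_sq] at this; exact this
    push_cast at a1 a2 ⊢
    linear_combination (w * (X:ℂ)^2) * a1 - (w * (X:ℂ)^2 * z) * a2
  rw [e]
  simp only [Complex.add_re, Complex.sub_re, Complex.re_ofReal_mul]
  have b1 : (w * star G * f).re ≤ ‖w‖ * ‖G‖ * ‖f‖ := by
    refine (Complex.re_le_norm _).trans (by simp)
  have b2 : |(w * τ * star G).re| ≤ ‖w‖ * ‖τ‖ * ‖G‖ := by
    refine (Complex.abs_re_le_norm _).trans (by simp)
  have b3 : -(2 * (|X| * |Y|) * (‖w‖ * ‖τ‖ * ‖G‖)) ≤ 2 * X * Y * (w * τ * star G).re := by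
    have := neg_abs_le (2 * X * Y * (w * τ * star G).re)
    rw [abs_mul, abs_mul, abs_mul, abs_two] at this
    refine le_trans ?_ this
    have : 0 ≤ 2 * (|X| * |Y|) := by positivity
    nlinarith
  have b4 := mul_le_mul_of_nonneg_left b1 (sq_nonneg X)
  have b5 := mul_le_mul_of_nonneg_left h1 (show 0 ≤ X ^ 2 * ‖τ‖ ^ 2 by positivity)
  have b6 := mul_le_mul_of_nonneg_left h2 (show 0 ≤ X ^ 2 * ‖G‖ ^ 2 by positivity)
  have q1 : ‖w‖ * ‖G‖ * ‖f‖ ≤ c / 2 * ‖G‖ ^ 2 + ‖w‖ ^ 2 / c * ‖f‖ ^ 2 := by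
    rw [← sub_nonneg]
    have : c / 2 * ‖G‖ ^ 2 + ‖w‖ ^ 2 / c * ‖f‖ ^ 2 - ‖w‖ * ‖G‖ * ‖f‖
      = ((c * ‖G‖ - ‖w‖ * ‖f‖) ^ 2 + (‖w‖ * ‖f‖) ^ 2) / (2 * c) := by field_simp; ring
    rw [this]; positivity
  have q2 : 2 * (|X| * |Y|) * (‖w‖ * ‖τ‖ * ‖G‖) ≤ c * X ^ 2 * ‖τ‖ ^ 2 + ‖w‖ ^ 2 / c * (Y ^ 2 * ‖G‖ ^ 2) := by
    rw [← sub_nonneg, ← sq_abs X, ← sq_abs Y]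
    have : c * |X| ^ 2 * ‖τ‖ ^ 2 + ‖w‖ ^ 2 / c * (|Y| ^ 2 * ‖G‖ ^ 2) - 2 * (|X| * |Y|) * (‖w‖ * ‖τ‖ * ‖G‖)
      = ((c * |X| * ‖τ‖ - ‖w‖ * |Y| * ‖G‖) ^ 2) / c := by field_simp; ring
    rw [this]; positivity
  have q3 := mul_le_mul_of_nonneg_left q1 (sq_nonneg X)
  linarith

lemma exists_w {z : ℂ} (hz : ∀ t : ℝ, 0 ≤ t → z ≠ (t : ℂ)) :
    ∃ (w : ℂ) (c : ℝ), 0 < c ∧ c ≤ w.re ∧ c ≤ (-(w * z)).re := by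
  by_cases him : z.im = 0
  · have hre : z.re < 0 := by
      by_contra h
      exact hz z.re (not_lt.mp h) (Complex.ext (by simp) (by simp [him]))
    refine ⟨1, min 1 (-z.re), lt_min one_pos (by linarith), by simp, by simp⟩
  · refine ⟨⟨1, (z.re + 1) / z.im⟩, 1, one_pos, by simp, ?_⟩
    simp only [Complex.neg_re, Complex.mul_re]
    rw [div_mul_cancel₀ _ him]; linarith

lemma est_R {α : ℝ} (h0 : 0 ≤ α) (h1 : α < 1) {z w : ℂ} {c : ℝ} (hc : 0 < c) (hw1 : c ≤ w.re)
    (hw2 : c ≤ (-(w * z)).re) {g u : L2R} (h : InG α g u) {R : ℝ} (hR : 0 < R) :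
    c / 4 * ∫ x in (-(R/2))..(R/2), ‖g x‖ ^ 2 ≤
      ‖w‖ ^ 2 / c * (‖u - z • g‖ ^ 2 + 4 / R ^ 2 * ‖g‖ ^ 2) := by
  obtain ⟨a, b, hab⟩ := h
  set f : L2R := u - z • g with hf
  set F : ℝ → ℂ := fun t => -(((|t| ^ (-(α/2)) : ℝ) : ℂ) * u t) with hF
  have hFl : LocallyIntegrable F := (locInt_weight h1 u).neg
  set X : ℝ → ℝ := fun x => 1 - x ^ 2 / R ^ 2 with hX
  set Y : ℝ → ℝ := fun x => - (2 * x / R ^ 2) with hY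
  have hXY : ∀ x, HasDerivAt X (Y x) x := by
    intro x
    have := ((hasDerivAt_pow 2 x).div_const (R^2)).const_sub 1
    simpa [hX, hY] using this
  have hXc : Continuous X := by fun_prop
  have hYc : Continuous Y := by fun_prop
  set V := Vf α a b u with hV
  set P := Pf α b u with hP
  have hPc : Continuous P := continuous_Pf h1 b u
  have hVc : Continuous V := continuous_Vf h0 h1 a b u
  have hac : Continuous (fun x : ℝ => ((|x| ^ α : ℝ) : ℂ)) :=
    Complex.continuous_ofReal.comp (continuous_abs_rpow h0)
  set θ : ℝ → ℂ := fun x => (X x : ℂ) ^ 2 * star (V x) with hθ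
  set θ' : ℝ → ℂ := fun x => 2 * X x * Y x * star (V x) + (X x : ℂ) ^ 2 * (((|x| ^ α : ℝ) : ℂ) * star (P x)) with hθ'
  have hθd : ∀ x, HasDerivAt θ (θ' x) x := by
    intro x
    have d1 := (hXY x).ofReal_comp
    have d2 := (hasDerivAt_Vf h0 h1 a b u x).star
    have := (d1.pow 2).mul d2
    convert! this using 1
    simp [hθ', hV, hP]
  have hθc' : Continuous θ' := by
    have : Continuous (fun x => star (V x)) := continuous_star.comp hVc
    have : Continuous (fun x => star (P x)) := continuous_star.comp hPc
    fun_prop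
  have hθc : Continuous θ := continuous_iff_continuousAt.mpr fun x => (hθd x).continuousAt
  have hRR : -R ≤ R := by linarith
  have key := ibp_s5 b hFl hθd hθc' (a := -R) (b := R) (by rw [uIcc_of_le hRR]; constructor <;> linarith)
  have t1 : θ R = 0 := by simp [hθ, hX, hR.ne']
  have t2 : θ (-R) = 0 := by simp [hθ, hX, hR.ne']
  rw [t1, t2, mul_zero, mul_zero, sub_zero] at key
  have hEi : IntervalIntegrable (fun x => F x * θ x + P x * θ' x) volume (-R) R :=
    ((hFl.ii _ _).mul_continuousOn hθc.continuousOn).add ((hPc.mul hθc').intervalIntegrable _ _)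
  have hEi' : IntervalIntegrable (fun x => w * (F x * θ x + P x * θ' x)) volume (-R) R := hEi.const_mul w
  have key2 : ∫ x in (-R)..R, (w * (F x * θ x + P x * θ' x)).re = 0 := by
    have h3 := Complex.reCLM.intervalIntegral_comp_comm hEi'
    refine h3.trans ?_
    rw [intervalIntegral.integral_const_mul]
    have : ∫ x in (-R)..R, (F x * θ x + P x * θ' x) = 0 := key
    rw [this]; simp
  have gi := l2_sq_int g
  have fi := l2_sq_int f
  have iL : IntervalIntegrable (fun x => c / 2 * (X x ^ 2 * ‖g x‖ ^ 2)) volume (-R) R :=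
    (gi.intervalIntegrable.continuousOn_mul (by fun_prop)).const_mul _
  have iR : IntervalIntegrable (fun x => ‖w‖ ^ 2 / c * (‖f x‖ ^ 2 + 4 / R ^ 2 * ‖g x‖ ^ 2)) volume (-R) R :=
    (fi.intervalIntegrable.add (gi.intervalIntegrable.const_mul _)).const_mul _
  have m1 : ∫ x in (-R)..R, (c / 2 * (X x ^ 2 * ‖g x‖ ^ 2) - ‖w‖ ^ 2 / c * (‖f x‖ ^ 2 + 4 / R ^ 2 * ‖g x‖ ^ 2))
      ≤ ∫ x in (-R)..R, (w * (F x * θ x + P x * θ' x)).re := by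
    have iE : IntervalIntegrable (fun x => (w * (F x * θ x + P x * θ' x)).re) volume (-R) R :=
      ⟨hEi'.1.re, hEi'.2.re⟩
    refine intervalIntegral.integral_mono_ae_restrict hRR (iL.sub iR) iE ?_
    rw [EventuallyLE, ae_restrict_iff' measurableSet_Icc]
    have hfx : ∀ᵐ x : ℝ, u x = f x + z * g x := by
      filter_upwards [Lp.coeFn_sub u (z • g), Lp.coeFn_smul z g] with x e1 e2
      rw [hf, e1, Pi.sub_apply, e2]; simp
    filter_upwards [hab, hfx, ae_ne_zero] with x e1 e2 hx0 hxR
    have hp := ptw w z (g x) (((|x| ^ (α/2) : ℝ) : ℂ) * P x) (f x) (X x) (Y x) c hc hw1 hw2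
    have hE : F x * θ x + P x * θ' x = (-((X x:ℂ) ^ 2 * star (g x) * (f x + z * g x))
        + (X x:ℂ) ^ 2 * ((((|x| ^ (α/2) : ℝ) : ℂ) * P x) * star (((|x| ^ (α/2) : ℝ) : ℂ) * P x))
        + 2 * X x * Y x * ((((|x| ^ (α/2) : ℝ) : ℂ) * P x) * star (g x))) := by
      have r1 := rpow_neg_mul (s := α/2) hx0
      have r2 : ((|x| ^ (α/2) : ℝ) : ℂ) * ((|x| ^ (α/2) : ℝ) : ℂ) = ((|x| ^ α : ℝ) : ℂ) := by
        rw [← Complex.ofReal_mul, ← Real.rpow_add (abs_pos.mpr hx0)]; congr 2; ring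
      rw [← e2, e1]
      simp only [hF, hθ, hθ', ← r2, star_mul', Complex.star_def, Complex.conj_ofReal]
      linear_combination (-(2 * X x * Y x * P x * (starRingEnd ℂ) (V x))) * r1
    rw [hE]
    refine le_trans ?_ hp
    have hw0 : 0 ≤ ‖w‖ ^ 2 / c := by positivity
    have hx2 : x ^ 2 ≤ R ^ 2 := sq_le_sq' hxR.1 hxR.2
    have hX1 : X x ^ 2 ≤ 1 := by
      have : x ^ 2 / R ^ 2 ≤ 1 := (div_le_one (by positivity)).mpr hx2
      have : 0 ≤ x ^ 2 / R ^ 2 := by positivity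
      simp only [hX]; nlinarith
    have hY1 : Y x ^ 2 ≤ 4 / R ^ 2 := by
      simp only [hY]
      rw [neg_sq, div_pow, div_le_div_iff₀ (by positivity) (by positivity)]
      nlinarith [sq_nonneg R]
    have k1 := mul_le_mul_of_nonneg_right hX1 (sq_nonneg ‖f x‖)
    have k2 := mul_le_mul_of_nonneg_right hY1 (sq_nonneg ‖g x‖)
    have k3 := mul_le_mul_of_nonneg_left (add_le_add k1 k2) hw0
    rw [one_mul] at k3
    have e : c / 2 * (X x ^ 2 * ‖g x‖ ^ 2) = c / 2 * X x ^ 2 * ‖g x‖ ^ 2 := by ring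
    rw [e]; linarith
  rw [key2, intervalIntegral.integral_sub iL iR] at m1
  have m2 : ∫ x in (-R)..R, ‖w‖ ^ 2 / c * (‖f x‖ ^ 2 + 4 / R ^ 2 * ‖g x‖ ^ 2)
      ≤ ‖w‖ ^ 2 / c * (‖f‖ ^ 2 + 4 / R ^ 2 * ‖g‖ ^ 2) := by
    have hi : Integrable (fun x => ‖f x‖ ^ 2 + 4 / R ^ 2 * ‖g x‖ ^ 2) := fi.add (gi.const_mul _)
    rw [intervalIntegral.integral_const_mul]
    refine mul_le_mul_of_nonneg_left ?_ (by positivity)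
    rw [intervalIntegral.integral_of_le hRR]
    refine (setIntegral_le_integral hi (ae_of_all _ fun x => by positivity)).trans ?_
    rw [integral_add fi (gi.const_mul _), integral_const_mul, l2_norm_sq f, l2_norm_sq g]
  have m3 : c / 4 * ∫ x in (-(R/2))..(R/2), ‖g x‖ ^ 2 ≤ ∫ x in (-R)..R, c / 2 * (X x ^ 2 * ‖g x‖ ^ 2) := by
    rw [← intervalIntegral.integral_const_mul]
    have s1 : ∫ x in (-(R/2))..(R/2), c / 4 * ‖g x‖ ^ 2 ≤ ∫ x in (-(R/2))..(R/2), c / 2 * (X x ^ 2 * ‖g x‖ ^ 2) := by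
      refine intervalIntegral.integral_mono_on (by linarith) (gi.intervalIntegrable.const_mul _)
        ((gi.intervalIntegrable.continuousOn_mul (by fun_prop)).const_mul _) fun x hx => ?_
      have hx2 : x ^ 2 ≤ (R/2) ^ 2 := sq_le_sq' hx.1 hx.2
      have : x ^ 2 / R ^ 2 ≤ 1 / 4 := by
        rw [div_le_div_iff₀ (by positivity) (by norm_num)]; nlinarith
      have hX2 : 1 / 2 ≤ X x ^ 2 := by simp only [hX]; nlinarith
      have := mul_le_mul_of_nonneg_right hX2 (sq_nonneg ‖g x‖)
      nlinarith
    refine s1.trans ?_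
    rw [intervalIntegral.integral_of_le (by linarith), intervalIntegral.integral_of_le hRR]
    refine setIntegral_mono_set iL.1 (ae_of_all _ fun x => by positivity) ?_
    exact (Ioc_subset_Ioc (by linarith) (by linarith)).eventuallyLE
  linarith

lemma estimate {α : ℝ} (h0 : 0 ≤ α) (h1 : α < 1) {z : ℂ} (hz : ∀ t : ℝ, 0 ≤ t → z ≠ (t : ℂ)) :
    ∃ C : ℝ, 0 ≤ C ∧ ∀ g u : L2R, InG α g u → ‖g‖ ≤ C * ‖u - z • g‖ := by
  obtain ⟨w, c, hc, hw1, hw2⟩ := exists_w hz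
  refine ⟨2 * ‖w‖ / c, by positivity, fun g u h => ?_⟩
  have hcube : Tendsto (fun R : ℝ => R / 2) atTop atTop := tendsto_id.atTop_div_const (by norm_num)
  have l1 := (intervalIntegral_tendsto_integral (l2_sq_int g) (tendsto_neg_atTop_atBot.comp hcube) hcube).const_mul (c/4)
  have l2 : Tendsto (fun R : ℝ => ‖w‖ ^ 2 / c * (‖u - z • g‖ ^ 2 + 4 / R ^ 2 * ‖g‖ ^ 2)) atTop
      (nhds (‖w‖ ^ 2 / c * (‖u - z • g‖ ^ 2 + 0 * ‖g‖ ^ 2))) := by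
    have : Tendsto (fun R : ℝ => 4 / R ^ 2) atTop (nhds 0) :=
      tendsto_const_nhds.div_atTop (tendsto_pow_atTop (by norm_num))
    exact ((this.mul_const _).const_add _).const_mul _
  have := le_of_tendsto_of_tendsto l1 l2 (by
    filter_upwards [eventually_gt_atTop 0] with R hR using est_R h0 h1 hc hw1 hw2 h hR)
  rw [← l2_norm_sq, zero_mul, add_zero] at this
  refine (pow_le_pow_iff_left₀ (norm_nonneg _) (by positivity) two_ne_zero).1 ?_
  rw [mul_pow, div_pow, mul_pow]
  have e : 2 ^ 2 * ‖w‖ ^ 2 / c ^ 2 * ‖u - z • g‖ ^ 2 = (4 / c) * (‖w‖ ^ 2 / c * ‖u - z • g‖ ^ 2) := by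
    field_simp; ring
  rw [e]
  have := mul_le_mul_of_nonneg_left this (show 0 ≤ 4 / c by positivity)
  calc _ = 4 / c * (c / 4 * ‖g‖ ^ 2) := by field_simp
    _ ≤ _ := this

lemma memB {α : ℝ} (h0 : 0 ≤ α) {s : Set ℝ} {η ψ : ℝ → ℝ} (h : CoreR α s η ψ) :
    MemLp (fun x => ((-(|x| ^ (α/2) * deriv η x) : ℝ) : ℂ)) 2 (volume : Measure ℝ) := by
  have c1 : Continuous (deriv η) := h.sm.continuous_deriv (by norm_num)
  have c2 := continuous_abs_rpow (s := α/2) (by linarith)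
  refine Continuous.memLp_of_hasCompactSupport (by fun_prop) ?_
  refine h.ce.deriv.mono' fun x hx => subset_tsupport _ fun hn => hx (by simp [hn])

lemma memA {α : ℝ} (h1 : α < 1) {s : Set ℝ} {η ψ : ℝ → ℝ} (h : CoreR α s η ψ) :
    MemLp (fun x => ((|x| ^ (-(α/2)) * ψ x : ℝ) : ℂ)) 2 (volume : Measure ℝ) := by
  have cψ : Continuous ψ := continuous_iff_continuousAt.mpr fun x => (h.hd x).continuousAt
  rw [memLp_two_iff_integrable_sq_norm]
  · have hl : LocallyIntegrable (fun x : ℝ => |x| ^ (-α)) :=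
      locallyIntegrable_of_intervalIntegrable fun a b => intervalIntegrable_abs_rpow (by linarith) a b
    have hcs : HasCompactSupport (fun x => ψ x ^ 2) := h.cp.comp_left (g := fun x : ℝ => x ^ 2) (by simp)
    have hi := hl.integrable_smul_right_of_hasCompactSupport (g := fun x => ψ x ^ 2) (cψ.pow 2) hcs
    refine hi.congr ?_
    filter_upwards [ae_ne_zero] with x hx
    rw [Complex.norm_real, norm_mul, mul_pow, Real.norm_of_nonneg (Real.rpow_nonneg (abs_nonneg x) _),
      Real.norm_eq_abs, sq_abs, sq (|x| ^ (-(α/2))), ← Real.rpow_add (abs_pos.mpr hx)]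
    simp only [smul_eq_mul]
    congr 2; ring
  · have := measurable_abs_rpow (-(α/2))
    have := cψ.measurable
    exact (by fun_prop : Measurable _).aestronglyMeasurable

lemma inner_real {k : ℝ → ℝ} (hk : MemLp (fun x => (k x : ℂ)) 2 (volume : Measure ℝ)) (g : L2R) :
    inner ℂ hk.toLp g = ∫ x, g x * (k x : ℂ) := by
  rw [L2.inner_def]
  refine integral_congr_ae ?_
  filter_upwards [hk.coeFn_toLp] with x hx
  rw [hx]; simp

def Gam {α : ℝ} (h0 : 0 ≤ α) (h1 : α < 1) : Submodule ℂ (L2R × L2R) where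
  carrier := {p | ∀ (η ψ : ℝ → ℝ) (h : CoreR α univ η ψ),
    inner ℂ (memB h0 h).toLp p.1 = inner ℂ (memA h1 h).toLp p.2}
  zero_mem' := fun η ψ h => by simp
  add_mem' := fun {p q} hp hq η ψ h => by
    simp only [Prod.fst_add, Prod.snd_add, inner_add_right, hp η ψ h, hq η ψ h]
  smul_mem' := fun c p hp η ψ h => by
    simp only [Prod.smul_fst, Prod.smul_snd, inner_smul_right, hp η ψ h]

lemma mem_Gam {α : ℝ} {h0 : 0 ≤ α} {h1 : α < 1} {p : L2R × L2R} : p ∈ Gam h0 h1 ↔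
    ∀ (η ψ : ℝ → ℝ) (h : CoreR α univ η ψ),
    inner ℂ (memB h0 h).toLp p.1 = inner ℂ (memA h1 h).toLp p.2 := Iff.rfl

lemma mem_Gam_iff {α : ℝ} (h0 : 0 ≤ α) (h1 : α < 1) {g u : L2R} :
    (g, u) ∈ Gam h0 h1 ↔ InG α g u := by
  rw [mem_Gam]
  constructor
  · intro h
    obtain ⟨a, b, hab⟩ := regularity h0 h1 univ_nonempty isOpen_univ ordConnected_univ g u (fun η ψ hc => by
      rw [← inner_real (memB h0 hc), ← inner_real (memA h1 hc)]
      exact h η ψ hc)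
    exact ⟨a, b, by filter_upwards [hab] with x hx using hx trivial⟩
  · rintro ⟨a, b, hab⟩ η ψ hc
    rw [inner_real (memB h0 hc), inner_real (memA h1 hc)]
    have key := weakIBP h0 h1 a b u hc.toC
    refine Eq.trans ?_ (key.trans ?_)
    · refine integral_congr_ae ?_
      filter_upwards [hab, ae_ne_zero] with x hx hx0
      rw [(deriv_ofReal' hc.sm x).deriv, hx]
      push_cast
      have r := rpow_neg_mul (s := α/2) hx0
      linear_combination (-(Vf α a b u x * ((deriv η x : ℝ) : ℂ))) * r
    · simp

lemma isClosed_Gam {α : ℝ} (h0 : 0 ≤ α) (h1 : α < 1) : IsClosed (Gam h0 h1 : Set (L2R × L2R)) := by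
  have : (Gam h0 h1 : Set (L2R × L2R)) = ⋂ (η : ℝ → ℝ) (ψ : ℝ → ℝ) (h : CoreR α univ η ψ),
      {p | inner ℂ (memB h0 h).toLp p.1 = inner ℂ (memA h1 h).toLp p.2} := by
    ext p; simp only [mem_iInter]; rfl
  rw [this]
  refine isClosed_iInter fun η => isClosed_iInter fun ψ => isClosed_iInter fun h => ?_
  exact isClosed_eq (continuous_const.inner continuous_fst) (continuous_const.inner continuous_snd)

lemma core_InG {α : ℝ} (h0 : 0 ≤ α) (h1 : α < 1) {η ψ : ℝ → ℝ} (h : CoreR α univ η ψ) :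
    InG α (memA h1 h).toLp (memB h0 h).toLp := by
  set B := (memB h0 h).toLp with hB
  have c1 : Continuous (deriv η) := h.sm.continuous_deriv (by norm_num)
  have eP : ∀ x, Pf α (η 0) B x = η x := by
    intro x
    unfold Pf
    have : ∫ t in (0:ℝ)..x, -(((|t| ^ (-(α/2)) : ℝ) : ℂ) * B t) = ∫ t in (0:ℝ)..x, ((deriv η t : ℝ) : ℂ) := by
      refine intervalIntegral.integral_congr_ae ?_
      filter_upwards [(memB h0 h).coeFn_toLp, ae_ne_zero] with t ht ht0 _
      rw [hB, ht]
      have r := rpow_neg_mul (s := α/2) ht0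
      push_cast
      linear_combination ((deriv η t : ℝ) : ℂ) * r
    rw [this, intervalIntegral.integral_eq_sub_of_hasDerivAt (fun t _ => deriv_ofReal' h.sm t)
      ((Complex.continuous_ofReal.comp c1).intervalIntegrable _ _)]
    ring
  have eV : ∀ x, Vf α (ψ 0) (η 0) B x = ψ x := by
    intro x
    unfold Vf
    simp_rw [eP]
    rw [intervalIntegral.integral_eq_sub_of_hasDerivAt (fun t _ => h.toC.hd t)]
    · ring
    · exact ((Complex.continuous_ofReal.comp (continuous_abs_rpow h0)).mul
        (Complex.continuous_ofReal.comp h.sm.continuous)).intervalIntegrable _ _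
  refine ⟨ψ 0, η 0, ?_⟩
  filter_upwards [(memA h1 h).coeFn_toLp] with x hx
  rw [hx, eV]; push_cast; ring

lemma conj_not {z : ℂ} (hz : ∀ t : ℝ, 0 ≤ t → z ≠ (t : ℂ)) : ∀ t : ℝ, 0 ≤ t → star z ≠ (t : ℂ) := by
  intro t ht h
  refine hz t ht ?_
  rw [← star_star z, h]; simp

lemma surj {α : ℝ} (h0 : 0 ≤ α) (h1 : α < 1) {z : ℂ} (hz : ∀ t : ℝ, 0 ≤ t → z ≠ (t : ℂ)) (f : L2R) :
    ∃ g u : L2R, InG α g u ∧ u - z • g = f := by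
  obtain ⟨C, hC, hest⟩ := estimate h0 h1 hz
  obtain ⟨C', hC', hest'⟩ := estimate h0 h1 (conj_not hz)
  let T : L2R × L2R →L[ℂ] L2R := ContinuousLinearMap.snd ℂ L2R L2R - z • ContinuousLinearMap.fst ℂ L2R L2R
  let S : Gam h0 h1 →L[ℂ] L2R := T.comp (Gam h0 h1).subtypeL
  have hS : ∀ p : Gam h0 h1, S p = p.1.2 - z • p.1.1 := fun p => rfl
  have : CompleteSpace (Gam h0 h1) := (isClosed_Gam h0 h1).completeSpace_coe
  have hcl : IsClosed (range S) := by
    have ha : AntilipschitzWith (C + 1 + ‖z‖ * C).toNNReal S := by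
      refine AddMonoidHomClass.antilipschitz_of_bound S fun p => ?_
      have e1 : ‖p.1.1‖ ≤ C * ‖S p‖ := hest _ _ ((mem_Gam_iff h0 h1).1 p.2)
      have e2 : ‖p.1.2‖ ≤ ‖S p‖ + ‖z‖ * ‖p.1.1‖ := by
        have : p.1.2 = S p + z • p.1.1 := by rw [hS]; abel
        calc ‖p.1.2‖ = ‖S p + z • p.1.1‖ := by rw [← this]
          _ ≤ ‖S p‖ + ‖z • p.1.1‖ := norm_add_le _ _
          _ = _ := by rw [norm_smul]
      rw [Real.coe_toNNReal _ (by positivity)]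
      have e3 : ‖p‖ ≤ ‖p.1.1‖ + ‖p.1.2‖ := by
        change max ‖p.1.1‖ ‖p.1.2‖ ≤ _
        exact max_le (by linarith [norm_nonneg p.1.2]) (by linarith [norm_nonneg p.1.1])
      have := mul_le_mul_of_nonneg_left e1 (norm_nonneg z)
      linarith
    exact ha.isClosed_range S.uniformContinuous
  have htop : (LinearMap.range S.toLinearMap) = ⊤ := by
    have hcl' : IsClosed ((LinearMap.range S.toLinearMap : Submodule ℂ L2R) : Set L2R) := by
      rw [LinearMap.coe_range]; exact hcl
    rw [← hcl'.submodule_topologicalClosure_eq, Submodule.topologicalClosure_eq_top_iff, Submodule.eq_bot_iff]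
    intro k hk
    rw [Submodule.mem_orthogonal] at hk
    have hm : (k, star z • k) ∈ Gam h0 h1 := by
      rw [mem_Gam]
      intro η ψ h
      have := hk _ ⟨⟨_, (mem_Gam_iff h0 h1).2 (core_InG h0 h1 h)⟩, rfl⟩
      change inner ℂ ((memB h0 h).toLp - z • (memA h1 h).toLp) k = 0 at this
      rw [inner_sub_left, inner_smul_left, sub_eq_zero] at this
      rw [inner_smul_right]
      exact this
    have := hest' _ _ ((mem_Gam_iff h0 h1).1 hm)
    rw [sub_self, norm_zero, mul_zero] at this
    exact norm_le_zero_iff.mp this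
  obtain ⟨p, hp⟩ : f ∈ LinearMap.range S.toLinearMap := by rw [htop]; trivial
  exact ⟨p.1.1, p.1.2, (mem_Gam_iff h0 h1).1 p.2, hp⟩

lemma part_one {α : ℝ} (h0 : 0 ≤ α) (h1 : α < 1) {z : ℂ} (hz : ∀ t : ℝ, 0 ≤ t → z ≠ (t : ℂ)) (f : L2R) :
    ∃! g : L2R, InDomB α g ∧ ∃ u : L2R, ActsAs α g u ∧ u - z • g = f := by
  obtain ⟨g, u, hg, hf⟩ := surj h0 h1 hz f
  refine ⟨g, ⟨hg.inDomB h0 h1, u, hg.actsAs h0 h1, hf⟩, ?_⟩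
  rintro g' ⟨hd, u', ha, hf'⟩
  obtain ⟨C, hC, hest⟩ := estimate h0 h1 hz
  have hm := (Gam h0 h1).sub_mem ((mem_Gam_iff h0 h1).2 (inG_of h0 h1 hd ha)) ((mem_Gam_iff h0 h1).2 hg)
  have := hest _ _ ((mem_Gam_iff h0 h1).1 hm)
  have e : u' - u - z • (g' - g) = 0 := by
    rw [smul_sub]
    have : u' - z • g' = u - z • g := by rw [hf, hf']
    rw [← sub_eq_zero] at this
    rw [← this]; abel
  rw [e, norm_zero, mul_zero] at this
  exact sub_eq_zero.mp (norm_le_zero_iff.mp this)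

lemma testfun_ibp {φ ζ : ℝ → ℂ} (sφ : ContDiff ℝ (⊤ : ℕ∞) φ) (cφ : HasCompactSupport φ)
    (sζ : ContDiff ℝ (⊤ : ℕ∞) ζ) :
    ∫ x, φ x * deriv ζ x = -∫ x, deriv φ x * ζ x := by
  have c1 : Continuous (deriv φ) := sφ.continuous_deriv (by norm_num)
  have c2 : Continuous (deriv ζ) := sζ.continuous_deriv (by norm_num)
  refine integral_mul_deriv_eq_deriv_mul_of_integrable (u := φ) (v := ζ)
    (fun x _ => (sφ.differentiable (by norm_num) x).hasDerivAt)
    (fun x _ => (sζ.differentiable (by norm_num) x).hasDerivAt) ?_ ?_ ?_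
  · exact (sφ.continuous.mul c2).integrable_of_hasCompactSupport cφ.mul_right
  · exact (c1.mul sζ.continuous).integrable_of_hasCompactSupport cφ.deriv.mul_right
  · exact (sφ.continuous.mul sζ.continuous).integrable_of_hasCompactSupport cφ.mul_right

lemma testfun_graph (α : ℝ) {φ : ℝ → ℂ} (hφ : TestFun φ) :
    ∃ g u : L2R, GraphB α g u ∧ (∀ᵐ x, g x = φ x) ∧
      ∀ᵐ x : ℝ, u x = -(deriv (deriv φ) x) + ((α * (α + 2) / 4 / x ^ 2 : ℝ) : ℂ) * φ x := by
  obtain ⟨sm, cs, ss⟩ := hφ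
  have n0 : (0:ℝ) ∉ tsupport φ := fun h => ss h rfl
  set D : ℝ → ℂ := fun x => |x| ^ (-2 : ℝ) • φ x with hD
  have sD : ContDiff ℝ (⊤ : ℕ∞) D := smooth_smul (-2) sm n0
  have tD : tsupport D ⊆ tsupport φ := tsupport_wsmul (-2) φ
  have cD : HasCompactSupport D := cs.of_isClosed_subset (isClosed_tsupport _) tD
  have eD : ∀ x, ((α * (α + 2) / 4 / x ^ 2 : ℝ) : ℂ) * φ x = ((α * (α + 2) / 4 : ℝ) : ℂ) * D x := by
    intro x
    simp only [hD, Complex.real_smul]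
    rw [← mul_assoc, ← Complex.ofReal_mul]
    congr 2
    rw [Real.rpow_neg (abs_nonneg x), show (2:ℝ) = ((2:ℕ):ℝ) by norm_num, Real.rpow_natCast, sq_abs]
    rw [div_eq_mul_inv]
  have sd : ContDiff ℝ (⊤ : ℕ∞) (deriv φ) := (contDiff_infty_iff_deriv.mp sm).2
  have sdd : ContDiff ℝ (⊤ : ℕ∞) (deriv (deriv φ)) := (contDiff_infty_iff_deriv.mp sd).2
  have hdd : Continuous (deriv (deriv φ)) := sdd.continuous
  have hDc := sD.continuous
  set U : ℝ → ℂ := fun x => -(deriv (deriv φ) x) + ((α * (α + 2) / 4 : ℝ) : ℂ) * D x with hU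
  have cU : Continuous U := by fun_prop
  have csU : HasCompactSupport U := cs.deriv.deriv.neg.add cD.mul_left
  have mφ : MemLp φ 2 (volume : Measure ℝ) := sm.continuous.memLp_of_hasCompactSupport cs
  have mU : MemLp U 2 (volume : Measure ℝ) := cU.memLp_of_hasCompactSupport csU
  have act : ActsAs α mφ.toLp mU.toLp := by
    intro ζ hζ
    have sζ := hζ.1
    have sdζ : ContDiff ℝ (⊤ : ℕ∞) (deriv ζ) := (contDiff_infty_iff_deriv.mp sζ).2
    have sddζ : ContDiff ℝ (⊤ : ℕ∞) (deriv (deriv ζ)) := (contDiff_infty_iff_deriv.mp sdζ).2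
    have i1 := testfun_ibp sm cs sdζ
    have i2 := testfun_ibp sd cs.deriv sζ
    have j1 : Integrable (fun x => φ x * deriv (deriv ζ) x) :=
      (sm.continuous.mul sddζ.continuous).integrable_of_hasCompactSupport cs.mul_right
    have j2 : Integrable (fun x => deriv (deriv φ) x * ζ x) :=
      (hdd.mul sζ.continuous).integrable_of_hasCompactSupport cs.deriv.deriv.mul_right
    have j1' : Integrable (fun x => -(φ x * deriv (deriv ζ) x)) := j1.neg
    have j2' : Integrable (fun x => -(deriv (deriv φ) x * ζ x)) := j2.neg
    have j3 : Integrable (fun x => ((α * (α + 2) / 4 : ℝ) : ℂ) * (D x * ζ x)) :=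
      ((hDc.mul sζ.continuous).integrable_of_hasCompactSupport cD.mul_right).const_mul _
    calc _ = ∫ x, (-(φ x * deriv (deriv ζ) x) + ((α * (α + 2) / 4 : ℝ) : ℂ) * (D x * ζ x)) := by
          refine integral_congr_ae ?_
          filter_upwards [mφ.coeFn_toLp] with x hx
          rw [hx]
          linear_combination ζ x * eD x
      _ = ∫ x, (-(deriv (deriv φ) x * ζ x) + ((α * (α + 2) / 4 : ℝ) : ℂ) * (D x * ζ x)) := by
          rw [integral_add j1' j3, integral_add j2' j3, integral_neg, integral_neg, i1, i2, neg_neg]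
      _ = _ := by
          refine integral_congr_ae ?_
          filter_upwards [mU.coeFn_toLp] with x hx
          rw [hx]
          simp only [hU]; ring
  refine ⟨mφ.toLp, mU.toLp, ⟨⟨⟨_, act⟩, φ, 0, 0, mφ.coeFn_toLp, sm.continuous.continuousOn, ?_⟩, act⟩,
    mφ.coeFn_toLp, ?_⟩
  · have hz : φ =ᶠ[nhds 0] 0 := notMem_tsupport_iff_eventuallyEq.mp n0
    have key : ∀ (s : Set ℝ) (r : ℝ → ℂ), Tendsto (fun x => r x * φ x) (nhdsWithin 0 s) (nhds 0) := by
      intro s r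
      refine tendsto_const_nhds.congr' ?_
      filter_upwards [mem_nhdsWithin_of_mem_nhds hz] with x hx
      have hx : φ x = 0 := hx
      rw [hx, mul_zero]
    refine ⟨key _ _, key _ _, ?_, ?_⟩
    · simpa using key (Ioi 0) (fun x => ((|x| ^ (-(1 + α / 2)) : ℝ) : ℂ))
    · simpa using key (Iio 0) (fun x => ((|x| ^ (-(1 + α / 2)) : ℝ) : ℂ))
  · filter_upwards [mU.coeFn_toLp] with x hx
    rw [hx, eD]

lemma weyl_step {α : ℝ} (h0 : 0 ≤ α) (k : ℝ) (hk : 0 ≤ k) {χ : ℝ → ℝ} (sχ : ContDiff ℝ (⊤ : ℕ∞) χ)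
    (cχ : HasCompactSupport χ) (tχ : tsupport χ ⊆ Ioo 1 2) (N : ℝ) (hN : 1 ≤ N) (c : ℝ) :
    ∃ g u : L2R, GraphB α g u ∧ ‖g‖ ^ 2 = c ^ 2 * (N * ∫ x, χ x ^ 2) ∧
      ‖u - ((k ^ 2 : ℝ) : ℂ) • g‖ ^ 2 ≤ c ^ 2 * (1 / N ^ 2) *
        (N * ∫ x, (|deriv (deriv χ) x| + 2 * k * |deriv χ x| + α * (α + 2) / 4 * |χ x|) ^ 2) := by
  have hN0 : 0 < N := by linarith
  have sd : ContDiff ℝ (⊤ : ℕ∞) (deriv χ) := (contDiff_infty_iff_deriv.mp sχ).2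
  have sdd : ContDiff ℝ (⊤ : ℕ∞) (deriv (deriv χ)) := (contDiff_infty_iff_deriv.mp sd).2
  set M : ℝ → ℝ := fun x => |deriv (deriv χ) x| + 2 * k * |deriv χ x| + α * (α + 2) / 4 * |χ x| with hM
  set e : ℝ → ℂ := fun x => Complex.exp (Complex.I * k * x) with he
  have hed : ∀ x, HasDerivAt e (Complex.I * k * e x) x := by
    intro x
    have h1 : HasDerivAt (fun y : ℝ => (y : ℂ)) 1 x := by
      simpa using (hasDerivAt_id x).ofReal_comp
    have := (h1.const_mul (Complex.I * k)).cexp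
    rw [mul_one, mul_comm (Complex.exp _)] at this
    exact this
  have hen : ∀ x, ‖e x‖ = 1 := by
    intro x
    have : Complex.I * k * x = ((k * x : ℝ) : ℂ) * Complex.I := by push_cast; ring
    simp only [he]
    rw [this, Complex.norm_exp_ofReal_mul_I]
  have hqd : ∀ q : ℝ → ℝ, ContDiff ℝ (⊤ : ℕ∞) q → ∀ x,
      HasDerivAt (fun x : ℝ => ((q (x / N) : ℝ) : ℂ)) (((deriv q (x / N) / N : ℝ)) : ℂ) x := by
    intro q hq x
    have h1 : HasDerivAt (fun x : ℝ => x / N) (1 / N) x := (hasDerivAt_id x).div_const N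
    have h2 : HasDerivAt q (deriv q (x/N)) (x / N) := (hq.differentiable (by norm_num) _).hasDerivAt
    have h3 := (h2.comp x h1).ofReal_comp
    rw [mul_one_div] at h3
    exact h3
  set φ : ℝ → ℂ := fun x => (c : ℂ) * (((χ (x / N) : ℝ) : ℂ) * e x) with hφ
  have d1 : deriv φ = fun x => (c : ℂ) * ((((deriv χ (x / N) / N : ℝ)) : ℂ) * e x
      + ((χ (x / N) : ℝ) : ℂ) * (Complex.I * k * e x)) := by
    funext x
    exact (((hqd χ sχ x).mul (hed x)).const_mul (c : ℂ)).deriv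
  have d2 : ∀ x, deriv (deriv φ) x = (c : ℂ) * ((((deriv (deriv χ) (x / N) / N : ℝ)) : ℂ) / N
      + 2 * (Complex.I * k) * (((deriv χ (x / N) / N : ℝ)) : ℂ) - (k:ℂ) ^ 2 * ((χ (x / N) : ℝ) : ℂ)) * e x := by
    intro x
    have a1 : HasDerivAt (fun x : ℝ => (((deriv χ (x / N) / N : ℝ)) : ℂ))
        ((((deriv (deriv χ) (x / N) / N : ℝ)) : ℂ) / N) x := by
      have := (hqd _ sd x).div_const (N : ℂ)
      simpa using this
    have a2 := ((a1.mul (hed x)).add ((hqd χ sχ x).mul ((hed x).const_mul (Complex.I * k)))).const_mul (c : ℂ)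
    rw [d1]
    refine Eq.trans a2.deriv ?_
    have := Complex.I_sq
    linear_combination ((c : ℂ) * k ^ 2 * ((χ (x / N) : ℝ) : ℂ) * e x) * this
  have supp : ∀ x, x ∉ Icc N (2 * N) → x / N ∉ tsupport χ := by
    intro x hx ht
    have := tχ ht
    refine hx ⟨?_, ?_⟩
    · have := (lt_div_iff₀ hN0).1 this.1; linarith
    · have := (div_lt_iff₀ hN0).1 this.2; linarith
  have tφ : tsupport φ ⊆ Icc N (2 * N) := by
    refine closure_minimal (fun x hx => ?_) isClosed_Icc
    by_contra hn
    refine hx ?_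
    simp only [hφ]
    rw [image_eq_zero_of_notMem_tsupport (supp x hn)]; simp
  have sφ : ContDiff ℝ (⊤ : ℕ∞) φ := by
    have s1 : ContDiff ℝ (⊤ : ℕ∞) (fun x : ℝ => ((χ (x / N) : ℝ) : ℂ)) :=
      Complex.ofRealCLM.contDiff.comp (sχ.comp (contDiff_id.div_const N))
    have s2 : ContDiff ℝ (⊤ : ℕ∞) e :=
      (contDiff_const.mul (Complex.ofRealCLM.contDiff (n := ((⊤ : ℕ∞) : WithTop ℕ∞)))).cexp
    exact contDiff_const.mul (s1.mul s2)
  have tf : TestFun φ := ⟨sφ, isCompact_Icc.of_isClosed_subset (isClosed_tsupport _) tφ, fun x hx => by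
    have := (tφ hx).1
    exact (by linarith : (0:ℝ) < x).ne'⟩
  obtain ⟨g, u, hG, hg, hu⟩ := testfun_graph α tf
  refine ⟨g, u, hG, ?_, ?_⟩
  · rw [l2_norm_sq]
    have : ∫ x, ‖g x‖ ^ 2 = ∫ x, c ^ 2 * (fun y => χ y ^ 2) (x / N) := by
      refine integral_congr_ae ?_
      filter_upwards [hg] with x hx
      rw [hx]
      simp only [hφ]
      rw [norm_mul, norm_mul, hen, Complex.norm_real, Complex.norm_real, mul_one, mul_pow,
        Real.norm_eq_abs, Real.norm_eq_abs, sq_abs, sq_abs]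
    rw [this, integral_const_mul, Measure.integral_comp_div (fun y => χ y ^ 2), abs_of_pos hN0, smul_eq_mul]
  · rw [l2_norm_sq]
    have cM : Continuous M := by
      have := sdd.continuous
      have := sd.continuous
      have := sχ.continuous
      fun_prop
    have csM : HasCompactSupport (fun x => M x ^ 2) := by
      refine cχ.mono' fun x hx => ?_
      by_contra hn
      refine hx ?_
      have z1 : χ x = 0 := image_eq_zero_of_notMem_tsupport hn
      have z2 : deriv χ x = 0 := image_eq_zero_of_notMem_tsupport fun h => hn (tsupport_deriv_subset h)
      have z3 : deriv (deriv χ) x = 0 :=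
        image_eq_zero_of_notMem_tsupport fun h => hn (tsupport_deriv_subset (tsupport_deriv_subset h))
      simp [hM, z1, z2, z3]
    have iM : Integrable (fun x => M x ^ 2) := (cM.pow 2).integrable_of_hasCompactSupport csM
    have iM' : Integrable (fun x => c ^ 2 * (1 / N ^ 2) * (fun y => M y ^ 2) (x / N)) :=
      (iM.comp_div hN0.ne').const_mul _
    have : ∫ x, c ^ 2 * (1 / N ^ 2) * (fun y => M y ^ 2) (x / N)
        = c ^ 2 * (1 / N ^ 2) * (N * ∫ x, M x ^ 2) := by
      rw [integral_const_mul, Measure.integral_comp_div (fun y => M y ^ 2), abs_of_pos hN0, smul_eq_mul]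
    rw [← this]
    refine integral_mono_ae (l2_sq_int _) iM' ?_
    filter_upwards [hg, hu, Lp.coeFn_sub u (((k ^ 2 : ℝ) : ℂ) • g), Lp.coeFn_smul ((k ^ 2 : ℝ) : ℂ) g] with x x1 x2 x3 x4
    rw [x3, Pi.sub_apply, x4, Pi.smul_apply, x1, x2, d2]
    set C := α * (α + 2) / 4 with hC
    have hC0 : 0 ≤ C := by positivity
    set y := x / N with hy
    have E : -((c : ℂ) * ((((deriv (deriv χ) y / N : ℝ)) : ℂ) / N
      + 2 * (Complex.I * k) * (((deriv χ y / N : ℝ)) : ℂ) - (k:ℂ) ^ 2 * ((χ y : ℝ) : ℂ)) * e x)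
      + ((C / x ^ 2 : ℝ) : ℂ) * φ x - ((k ^ 2 : ℝ) : ℂ) • φ x
      = (c : ℂ) * (-((deriv (deriv χ) y / N / N : ℝ) : ℂ) - Complex.I * ((2 * k * (deriv χ y / N) : ℝ) : ℂ)
        + ((C / x ^ 2 * χ y : ℝ) : ℂ)) * e x := by
      simp only [hφ, smul_eq_mul]
      push_cast; ring
    rw [E, norm_mul, norm_mul, hen, mul_one, Complex.norm_real, mul_pow, Real.norm_eq_abs, sq_abs, mul_assoc (c ^ 2)]
    refine mul_le_mul_of_nonneg_left ?_ (sq_nonneg c)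
    rw [← one_div_pow, ← mul_pow]
    refine pow_le_pow_left₀ (norm_nonneg _) ?_ 2
    have t1 : ‖((deriv (deriv χ) y / N / N : ℝ) : ℂ)‖ ≤ 1 / N * |deriv (deriv χ) y| := by
      rw [Complex.norm_real, Real.norm_eq_abs, abs_div, abs_div, abs_of_pos hN0, one_div_mul_eq_div]
      exact div_le_self (by positivity) hN
    have t2 : ‖Complex.I * ((2 * k * (deriv χ y / N) : ℝ) : ℂ)‖ = 1 / N * (2 * k * |deriv χ y|) := by
      rw [norm_mul, Complex.norm_I, one_mul, Complex.norm_real, Real.norm_eq_abs, abs_mul, abs_div,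
        abs_of_pos hN0, abs_of_nonneg (by positivity : 0 ≤ 2 * k)]
      ring
    have t3 : ‖((C / x ^ 2 * χ y : ℝ) : ℂ)‖ ≤ 1 / N * (C * |χ y|) := by
      rw [Complex.norm_real, Real.norm_eq_abs, abs_mul, abs_of_nonneg (by positivity : 0 ≤ C / x ^ 2)]
      by_cases hx : x ∈ Icc N (2 * N)
      · have q : C / x ^ 2 ≤ C / N := by
          refine div_le_div_of_nonneg_left hC0 hN0 ?_
          nlinarith [hx.1]
        calc _ ≤ C / N * |χ y| := mul_le_mul_of_nonneg_right q (abs_nonneg _)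
          _ = _ := by ring
      · have : χ y = 0 := image_eq_zero_of_notMem_tsupport (supp x hx)
        simp [this]
    refine (norm_add_le _ _).trans ?_
    have := norm_sub_le (-((deriv (deriv χ) y / N / N : ℝ) : ℂ)) (Complex.I * ((2 * k * (deriv χ y / N) : ℝ) : ℂ))
    rw [norm_neg] at this
    simp only [hM]
    linarith

lemma part_two {α : ℝ} (h0 : 0 ≤ α) (lam : ℝ) (hl : 0 ≤ lam) :
    ∃ g u : ℕ → L2R,
        (∀ n : ℕ, GraphB α (g n) (u n) ∧ ‖g n‖ = 1) ∧
        Tendsto (fun n : ℕ => ‖u n - (lam : ℂ) • g n‖) atTop (nhds 0) := by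
  obtain ⟨χ, sχ, cχ, tχ, -, y, -, hy⟩ := exists_bump (s := Ioo (1:ℝ) 2) ⟨3/2, by norm_num, by norm_num⟩ isOpen_Ioo
  have hpos : 0 < ∫ x, χ x ^ 2 := by
    refine (sχ.continuous.pow 2).integral_pos_of_hasCompactSupport_nonneg_nonzero
      (cχ.comp_left (g := fun x : ℝ => x ^ 2) (by simp)) (fun x => sq_nonneg _) (x := y) (pow_ne_zero 2 hy)
  set A := ∫ x, χ x ^ 2 with hA
  set k := Real.sqrt lam with hkd
  have hk2 : k ^ 2 = lam := Real.sq_sqrt hl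
  set B := ∫ x, (|deriv (deriv χ) x| + 2 * k * |deriv χ x| + α * (α + 2) / 4 * |χ x|) ^ 2 with hB
  have hB0 : 0 ≤ B := integral_nonneg fun x => sq_nonneg _
  have step : ∀ n : ℕ, ∃ g u : L2R, GraphB α g u ∧ ‖g‖ = 1 ∧
      ‖u - (lam : ℂ) • g‖ ≤ Real.sqrt (B / A) * (1 / ((n : ℝ) + 1)) := by
    intro n
    set N : ℝ := (n : ℝ) + 1 with hN
    have hN1 : 1 ≤ N := by rw [hN]; linarith [Nat.cast_nonneg (α := ℝ) n]
    have hN0 : 0 < N := by linarith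
    obtain ⟨g, u, hG, e1, e2⟩ := weyl_step h0 k (Real.sqrt_nonneg _) sχ cχ tχ N hN1 (1 / Real.sqrt (N * A))
    have hc : (1 / Real.sqrt (N * A)) ^ 2 = 1 / (N * A) := by
      rw [one_div_pow, Real.sq_sqrt (by positivity)]
    rw [hc] at e1 e2
    refine ⟨g, u, hG, ?_, ?_⟩
    · rw [← hA, one_div_mul_cancel (by positivity)] at e1
      exact (pow_eq_one_iff_of_nonneg (norm_nonneg _) two_ne_zero).1 e1
    · rw [hk2, ← hB] at e2
      refine (pow_le_pow_iff_left₀ (norm_nonneg _) (by positivity) two_ne_zero).1 (e2.trans (le_of_eq ?_))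
      rw [mul_pow, Real.sq_sqrt (by positivity)]
      field_simp
  choose g u hG hn hb using step
  refine ⟨g, u, fun n => ⟨hG n, hn n⟩, ?_⟩
  refine squeeze_zero (fun n => norm_nonneg _) hb ?_
  simpa using tendsto_one_div_add_atTop_nhds_zero_nat.const_mul (Real.sqrt (B / A))

/-- For every `α ∈ [0,1)`, the spectrum of the bridging operator `A_α^B` is exactly `[0, +∞)`:
(i) for every `z ∈ ℂ ∖ [0,+∞)`, the map `g ↦ A_α^B g - z g` is a bijection of `𝒟(A_α^B)` onto
`L²(ℝ)`; (ii) every `λ ≥ 0` admits a normalized Weyl sequence. -/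
theorem bridging_spectrum (α : ℝ) (hα : α ∈ Set.Ico (0 : ℝ) 1) :
    (∀ z : ℂ, (∀ t : ℝ, 0 ≤ t → z ≠ (t : ℂ)) →
      ∀ f : L2R, ∃! g : L2R, InDomB α g ∧ ∃ u : L2R, ActsAs α g u ∧ u - z • g = f) ∧
    (∀ lam : ℝ, 0 ≤ lam →
      ∃ g u : ℕ → L2R,
        (∀ n : ℕ, GraphB α (g n) (u n) ∧ ‖g n‖ = 1) ∧
        Tendsto (fun n : ℕ => ‖u n - (lam : ℂ) • g n‖) atTop (nhds 0)) := by
  exact ⟨fun z hz f => part_one hα.1 hα.2 hz f, fun lam hl => part_two hα.1 lam hl⟩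

end
end

section
/- For every α ∈ [0,1) and every k ∈ ℤ, every g ∈ L²(ℝ) satisfying (−d²/dx² + k²|x|^{2α} + α(α+2)/(4x²)) g ∈ L²(ℝ^±) distributionally on each half-line admits a representative continuous on ℝ∖{0} for which the limits g_0^± := lim_{x→0^±} |x|^{α/2} g(x) and g_1^± := lim_{x→0^±} |x|^{−(1+α/2)} ( g(x) − g_0^± |x|^{−α/2} ) exist and are finite. -/
open MeasureTheory Filter Set

noncomputable section

/-- `h = -g'' + k²|x|^{2α} g + C_α |x|⁻² g` in the distributional sense on `ℝ ∖ {0}`. -/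
def ActsAsK (α : ℝ) (k : ℤ) (g h : L2R) : Prop :=
  ∀ φ : ℝ → ℂ, TestFun φ →
    ∫ x : ℝ, g x * (-(deriv (deriv φ) x) +
        (((k : ℝ) ^ 2 * |x| ^ (2 * α) + α * (α + 2) / 4 / x ^ 2 : ℝ) : ℂ) * φ x)
      = ∫ x : ℝ, h x * φ x

/-- Real power, as a complex-valued function. -/
def Vp (s : ℝ) (x : ℝ) : ℂ := ((x ^ s : ℝ) : ℂ)

/-- Test functions on the open half-line. -/
def TestPos (φ : ℝ → ℂ) : Prop :=
  ContDiff ℝ (⊤ : ℕ∞) φ ∧ HasCompactSupport φ ∧ tsupport φ ⊆ Ioi (0 : ℝ)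

lemma Vp_hasDerivAt (s x : ℝ) (hx : 0 < x) :
    HasDerivAt (Vp s) ((s : ℂ) * Vp (s - 1) x) x := by
  have := (Real.hasDerivAt_rpow_const (x := x) (p := s) (Or.inl hx.ne')).ofReal_comp
  unfold Vp
  simpa using this

lemma Vp_contDiffAt (s x : ℝ) (hx : 0 < x) (n : WithTop ℕ∞) : ContDiffAt ℝ n (Vp s) x := by
  unfold Vp
  have h1 : ContDiffAt ℝ n (fun y : ℝ => y ^ s) x := Real.contDiffAt_rpow_const_of_ne hx.ne'
  exact (Complex.ofRealCLM.contDiff.contDiffAt).comp x h1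

lemma Vp_mul (s t x : ℝ) (hx : 0 < x) : Vp s x * Vp t x = Vp (s + t) x := by
  unfold Vp
  rw [Real.rpow_add hx]; push_cast; rfl

lemma Vp_continuousOn (s : ℝ) : ContinuousOn (Vp s) (Ioi 0) := fun x hx =>
  (Vp_hasDerivAt s x hx).continuousAt.continuousWithinAt

lemma Vp_measurable (s : ℝ) : Measurable (Vp s) := by
  unfold Vp
  fun_prop

lemma TestPos.zero_of_nonpos {φ : ℝ → ℂ} (h : TestPos φ) {x : ℝ} (hx : x ≤ 0) : φ x = 0 := by
  by_contra h0
  have := h.2.2 (subset_tsupport _ h0)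
  exact absurd this (not_lt.mpr hx)

lemma TestPos.bounds {φ : ℝ → ℂ} (h : TestPos φ) :
    ∃ a R : ℝ, 0 < a ∧ a < R ∧ ∀ x, x ∉ Icc a R → φ x = 0 := by
  by_cases hne : (tsupport φ).Nonempty
  · obtain ⟨a, ha, ha'⟩ := h.2.1.isCompact.exists_isLeast hne
    obtain ⟨b, hb, hb'⟩ := h.2.1.isCompact.exists_isGreatest hne
    have ha0 : 0 < a := h.2.2 ha
    refine ⟨a, b + 1, ha0, ?_, ?_⟩
    · have := ha' hb; linarith
    · intro x hx
      by_contra h0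
      have hm := subset_tsupport _ h0
      exact hx ⟨ha' hm, by have := hb' hm; linarith⟩
  · refine ⟨1, 2, by norm_num, by norm_num, fun x _ => ?_⟩
    by_contra h0
    exact hne ⟨x, subset_tsupport _ h0⟩

lemma TestPos.Vp_contDiff {φ : ℝ → ℂ} (h : TestPos φ) (s : ℝ) :
    ContDiff ℝ (⊤ : ℕ∞) (fun x => Vp s x * φ x) := by
  rw [contDiff_iff_contDiffAt]
  intro x
  by_cases hx : 0 < x
  · exact (Vp_contDiffAt s x hx _).mul h.1.contDiffAt
  · have hx' : x ∉ tsupport φ := fun hm => hx (h.2.2 hm)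
    have := notMem_tsupport_iff_eventuallyEq.mp hx'
    have h2 : (fun x => Vp s x * φ x) =ᶠ[nhds x] fun _ => 0 := by
      filter_upwards [this] with y hy
      simp [hy]
    exact contDiffAt_const.congr_of_eventuallyEq h2

/-- Primitive of `Vp s * η`. -/
def Hp (η : ℝ → ℂ) (s x : ℝ) : ℂ := ∫ t in (0:ℝ)..x, Vp s t * η t

lemma Hp_hasDerivAt {η : ℝ → ℂ} (h : TestPos η) (s x : ℝ) :
    HasDerivAt (Hp η s) (Vp s x * η x) x := by
  have hc := (h.Vp_contDiff s).continuous
  exact intervalIntegral.integral_hasDerivAt_right (hc.intervalIntegrable _ _)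
    (hc.stronglyMeasurableAtFilter _ _) hc.continuousAt

lemma Hp_contDiff {η : ℝ → ℂ} (h : TestPos η) (s : ℝ) : ContDiff ℝ (⊤ : ℕ∞) (Hp η s) := by
  have hd : deriv (Hp η s) = fun x => Vp s x * η x := funext fun x => (Hp_hasDerivAt h s x).deriv
  rw [contDiff_infty_iff_deriv]
  exact ⟨fun x => (Hp_hasDerivAt h s x).differentiableAt, hd ▸ h.Vp_contDiff s⟩

lemma Hp_zero_left {η : ℝ → ℂ} {a R : ℝ} (ha : 0 < a)
    (hz : ∀ x, x ∉ Icc a R → η x = 0) (s : ℝ) {x : ℝ} (hx : x < a) : Hp η s x = 0 := by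
  unfold Hp
  apply intervalIntegral.integral_zero_ae
  refine Eventually.of_forall fun t ht => ?_
  rw [hz t, mul_zero]
  intro h'
  rcases ht with ⟨_, h2⟩
  have : max 0 x < a := max_lt ha hx
  linarith [h'.1]

lemma Hp_zero_right {η : ℝ → ℂ} {a R : ℝ} (ha : 0 < a) (haR : a < R)
    (hz : ∀ x, x ∉ Icc a R → η x = 0) (s : ℝ) (hm : ∫ t, Vp s t * η t = 0)
    {x : ℝ} (hx : R ≤ x) : Hp η s x = 0 := by
  unfold Hp
  rw [intervalIntegral.integral_eq_integral_of_support_subset, hm]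
  intro t ht
  by_contra h
  apply ht
  simp only
  rw [hz t, mul_zero]
  intro h'
  exact h ⟨by linarith [h'.1], by linarith [h'.2]⟩

/-- Solution of `-φ'' + C x⁻² φ = η` by variation of parameters. -/
def Phi (α : ℝ) (η : ℝ → ℂ) (x : ℝ) : ℂ :=
  (1 + α : ℂ)⁻¹ * (Vp (-(α / 2)) x * Hp η (1 + α / 2) x - Vp (1 + α / 2) x * Hp η (-(α / 2)) x)

lemma Phi_spec {α : ℝ} (hα : 0 ≤ α) {η : ℝ → ℂ} (h : TestPos η)
    (h1 : ∫ t, Vp (-(α / 2)) t * η t = 0) (h2 : ∫ t, Vp (1 + α / 2) t * η t = 0) :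
    TestPos (Phi α η) ∧ ∀ x, -(deriv (deriv (Phi α η)) x) +
      ((α * (α + 2) / 4 / x ^ 2 : ℝ) : ℂ) * Phi α η x = η x := by
  obtain ⟨a, R, ha, haR, hz⟩ := h.bounds
  have hl : ∀ x, x < a → Phi α η x = 0 := fun x hx => by
    unfold Phi; rw [Hp_zero_left ha hz _ hx, Hp_zero_left ha hz _ hx]; simp
  have hr : ∀ x, R ≤ x → Phi α η x = 0 := fun x hx => by
    unfold Phi; rw [Hp_zero_right ha haR hz _ h1 hx, Hp_zero_right ha haR hz _ h2 hx]; simp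
  have hts : tsupport (Phi α η) ⊆ Icc a R := by
    apply closure_minimal _ isClosed_Icc
    intro x hx
    by_contra hn
    apply hx
    by_cases hxa : x < a
    · exact hl x hxa
    · exact hr x (by by_contra h'; exact hn ⟨by linarith, by linarith⟩)
  have hne : (1 + α : ℂ) ≠ 0 := by
    have : (1 + α : ℝ) ≠ 0 := by linarith
    exact_mod_cast this
  refine ⟨⟨?_, isCompact_Icc.of_isClosed_subset (isClosed_tsupport _) hts, fun x hx => lt_of_lt_of_le ha (hts hx).1⟩, ?_⟩
  · rw [contDiff_iff_contDiffAt]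
    intro x
    by_cases hx : 0 < x
    · exact contDiffAt_const.mul (((Vp_contDiffAt _ x hx _).mul (Hp_contDiff h _).contDiffAt).sub
        ((Vp_contDiffAt _ x hx _).mul (Hp_contDiff h _).contDiffAt))
    · have h2 : Phi α η =ᶠ[nhds x] fun _ => 0 := by
        filter_upwards [Iio_mem_nhds (show x < a by linarith)] with y hy
        exact hl y hy
      exact contDiffAt_const.congr_of_eventuallyEq h2
  · intro x
    by_cases hx : 0 < x
    · have e1 : ∀ y, 0 < y → HasDerivAt (Phi α η) ((1 + α : ℂ)⁻¹ *
          (((-(α / 2) : ℝ) : ℂ) * Vp (-(α / 2) - 1) y * Hp η (1 + α / 2) y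
            - ((1 + α / 2 : ℝ) : ℂ) * Vp (1 + α / 2 - 1) y * Hp η (-(α / 2)) y)) y := by
        intro y hy
        have := (((Vp_hasDerivAt (-(α/2)) y hy).mul (Hp_hasDerivAt h (1 + α/2) y)).sub
          ((Vp_hasDerivAt (1+α/2) y hy).mul (Hp_hasDerivAt h (-(α/2)) y))).const_mul ((1 + α : ℂ)⁻¹)
        refine HasDerivAt.congr_deriv (this.congr_of_eventuallyEq (Eventually.of_forall fun z => rfl)) ?_
        ring
      have e2 : deriv (Phi α η) =ᶠ[nhds x] fun y => ((1 + α : ℂ)⁻¹ *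
          (((-(α / 2) : ℝ) : ℂ) * Vp (-(α / 2) - 1) y * Hp η (1 + α / 2) y
            - ((1 + α / 2 : ℝ) : ℂ) * Vp (1 + α / 2 - 1) y * Hp η (-(α / 2)) y)) := by
        filter_upwards [Ioi_mem_nhds hx] with y hy
        exact (e1 y hy).deriv
      have e3 := ((((Vp_hasDerivAt (-(α/2) - 1) x hx).const_mul ((-(α / 2) : ℝ) : ℂ)).mul
          (Hp_hasDerivAt h (1 + α/2) x)).sub
          (((Vp_hasDerivAt (1+α/2-1) x hx).const_mul ((1 + α / 2 : ℝ) : ℂ)).mul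
          (Hp_hasDerivAt h (-(α/2)) x))).const_mul ((1 + α : ℂ)⁻¹)
      have e4 := (e3.congr_of_eventuallyEq (e2.trans (Eventually.of_forall fun z => rfl))).deriv
      rw [e4]
      have hxc : (x : ℂ) ≠ 0 := by exact_mod_cast hx.ne'
      have k1 : ∀ s, Vp (s - 1) x = Vp s x / x := fun s => by
        unfold Vp; rw [Real.rpow_sub_one hx.ne']; push_cast; rfl
      have k2 : Vp (1 + α / 2) x = x / Vp (-(α / 2)) x := by
        unfold Vp
        rw [Real.rpow_add hx, Real.rpow_neg hx.le]; push_cast; simp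
      have k3 : Vp (-(α / 2)) x ≠ 0 := by
        unfold Vp
        exact_mod_cast (Real.rpow_pos_of_pos hx _).ne'
      unfold Phi
      simp only [k1]
      rw [k2]
      push_cast
      field_simp
      ring
    · have h2 : Phi α η =ᶠ[nhds x] fun _ => 0 := by
        filter_upwards [Iio_mem_nhds (show x < a by linarith)] with y hy
        exact hl y hy
      have h3 := h2.deriv
      have h4 := h3.deriv_eq
      rw [h4, h2.eq_of_nhds, h.zero_of_nonpos (not_lt.mp hx)]
      simp

lemma fub {F K : ℝ → ℂ} {R : ℝ} (hR : 0 < R) (hF : IntegrableOn F (Ioc 0 R))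
    (hK : Integrable K) (hKz : ∀ x, x ∉ Ioc 0 R → K x = 0) (hm : ∫ t, K t = 0)
    (hF0 : ∀ x, x ≤ 0 → F x = 0) :
    ∫ x, F x * (∫ t in (0:ℝ)..x, K t) = - ∫ t, K t * ∫ x in (0:ℝ)..t, F x := by
  set F' := (Ioc 0 R).indicator F with hF'
  have hFi : Integrable F' := hF.integrable_indicator measurableSet_Ioc
  have hprod : Integrable (Function.uncurry fun x t : ℝ => (Ioi x).indicator (fun t => F' x * K t) t)
      (volume.prod volume) := by
    have := (hFi.mul_prod hK).indicator (s := {z : ℝ × ℝ | z.1 < z.2})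
      (measurableSet_lt measurable_fst measurable_snd)
    refine this.congr (Eventually.of_forall fun z => ?_)
    simp [Function.uncurry, indicator]
  have hsw := integral_integral_swap hprod
  have hl : ∀ x, F x * (∫ t in (0:ℝ)..x, K t) =
      - ∫ t, (Ioi x).indicator (fun t => F' x * K t) t := by
    intro x
    by_cases hx : x ∈ Ioc 0 R
    · rw [integral_indicator measurableSet_Ioi, integral_const_mul]
      have h1 : F' x = F x := indicator_of_mem hx _
      have h2 : ∫ t in (0:ℝ)..x, K t = ∫ t in Iic x, K t := by
        rw [intervalIntegral.integral_of_le hx.1.le]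
        symm
        apply setIntegral_eq_of_subset_of_forall_sdiff_eq_zero measurableSet_Iic
        · exact Ioc_subset_Iic_self
        · intro t ht
          apply hKz
          intro h'
          exact ht.2 ⟨h'.1, ht.1⟩
      have h3 := integral_add_compl (measurableSet_Iic (a := x)) hK
      rw [hm, compl_Iic] at h3
      rw [h1, h2, eq_neg_of_add_eq_zero_left h3]
      ring
    · have h1 : F' x = 0 := indicator_of_notMem hx _
      simp only [h1, zero_mul, indicator_zero, integral_zero, neg_zero]
      by_cases hx0 : x ≤ 0
      · simp [hF0 x hx0]
      · rw [intervalIntegral.integral_eq_integral_of_support_subset, hm, mul_zero]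
        intro t ht
        by_contra hh
        apply ht
        apply hKz
        intro h'
        apply hh
        refine ⟨h'.1, ?_⟩
        by_contra h3
        exact hx ⟨by linarith, by linarith [h'.2]⟩
  have hr : ∀ t, K t * (∫ x in (0:ℝ)..t, F x) =
      ∫ x, (Ioi x).indicator (fun t => F' x * K t) t := by
    intro t
    by_cases ht : t ∈ Ioc 0 R
    · have : ∀ x, (Ioi x).indicator (fun t => F' x * K t) t
          = K t * (Ioo 0 t).indicator F x := by
        intro x
        by_cases h1 : x < t
        · rw [indicator_of_mem (show t ∈ Ioi x from h1)]
          by_cases h2 : 0 < x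
          · rw [indicator_of_mem (show x ∈ Ioo 0 t from ⟨h2, h1⟩), hF',
              indicator_of_mem (show x ∈ Ioc 0 R from ⟨h2, by linarith [ht.2]⟩)]
            ring
          · rw [indicator_of_notMem (fun h : x ∈ Ioo 0 t => h2 h.1), hF',
              indicator_of_notMem (fun h : x ∈ Ioc 0 R => h2 h.1)]
            ring
        · rw [indicator_of_notMem (show t ∉ Ioi x from h1),
            indicator_of_notMem (fun h : x ∈ Ioo 0 t => h1 h.2)]
          ring
      simp_rw [this]
      rw [integral_const_mul, integral_indicator measurableSet_Ioo,
        intervalIntegral.integral_of_le ht.1.le, integral_Ioc_eq_integral_Ioo]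
    · have h1 := hKz t ht
      have : ∀ x, (Ioi x).indicator (fun t => F' x * K t) t = 0 := by
        intro x
        simp [indicator, h1]
      simp [this, h1]
  simp_rw [hl, hr]
  rw [integral_neg, hsw]

/-- Truncation of `Vp s * f` to the positive half-line. -/
def Fp (f : ℝ → ℂ) (s : ℝ) : ℝ → ℂ := (Ioi (0:ℝ)).indicator (fun x => Vp s x * f x)

lemma Vp_memLp {s : ℝ} (hs : -(1/2) < s) (R : ℝ) :
    MemLp (Vp s) 2 (volume.restrict (Ioc 0 R)) := by
  rw [memLp_two_iff_integrable_sq_norm (Vp_measurable s).aestronglyMeasurable]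
  have h := (intervalIntegral.intervalIntegrable_rpow' (a := 0) (b := R)
    (show -1 < 2 * s by linarith)).1
  refine h.congr_fun (fun x hx => ?_) measurableSet_Ioc
  simp only [Vp, Complex.norm_real, Real.norm_eq_abs, sq_abs]
  rw [← Real.rpow_natCast, ← Real.rpow_mul hx.1.le]
  congr 1
  push_cast; ring

lemma Fp_intervalIntegrable {f : ℝ → ℂ} (hf : ∀ R, MemLp f 2 (volume.restrict (Ioc 0 R)))
    {s : ℝ} (hs : -(1/2) < s) (a b : ℝ) : IntervalIntegrable (Fp f s) volume a b := by
  have key : ∀ R, IntegrableOn (Fp f s) (Iic R) := by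
    intro R
    have h1 : IntegrableOn (fun x => Vp s x * f x) (Ioc 0 R) :=
      (Vp_memLp hs R).integrable_mul (hf R)
    unfold Fp
    rw [IntegrableOn, integrable_indicator_iff measurableSet_Ioi, IntegrableOn,
      Measure.restrict_restrict measurableSet_Ioi, Ioi_inter_Iic]
    exact h1
  refine ⟨(key b).mono_set Ioc_subset_Iic_self, (key a).mono_set Ioc_subset_Iic_self⟩

/-- The test functions on the half-line, as a vector space. -/
def TS : Submodule ℂ (ℝ → ℂ) where
  carrier := {φ | TestPos φ}
  zero_mem' := ⟨contDiff_const, HasCompactSupport.zero, by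
    rw [show (0 : ℝ → ℂ) = fun _ => 0 from rfl, tsupport]; simp⟩
  add_mem' := by
    intro a b ha hb
    refine ⟨ha.1.add hb.1, ha.2.1.add hb.2.1, ?_⟩
    exact (tsupport_add a b).trans (union_subset ha.2.2 hb.2.2)
  smul_mem' := by
    intro c a ha
    exact ⟨contDiff_const.smul ha.1, ha.2.1.smul_left (f := fun _ => c), 
      (tsupport_smul_subset_right (fun _ => c) a).trans ha.2.2⟩

/-- Integration against `w`. -/
def mkL (w : ℝ → ℂ) (hw : ∀ η, TestPos η → Integrable (fun x => w x * η x)) : TS →ₗ[ℂ] ℂ where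
  toFun η := ∫ x, w x * (η : ℝ → ℂ) x
  map_add' := by
    intro a b
    rw [← integral_add (hw _ a.2) (hw _ b.2)]
    congr 1; ext x; simp [mul_add]
  map_smul' := by
    intro c a
    simp only [RingHom.id_apply, smul_eq_mul]
    rw [← integral_const_mul]
    congr 1; ext x; simp; ring

/-- The particular solution. -/
def Pp (α : ℝ) (f : ℝ → ℂ) (x : ℝ) : ℂ :=
  (1 + α : ℂ)⁻¹ * (Vp (-(α / 2)) x * (∫ t in (0:ℝ)..x, Fp f (1 + α / 2) t)
    - Vp (1 + α / 2) x * ∫ t in (0:ℝ)..x, Fp f (-(α / 2)) t)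

lemma TestPos.Vp_hcs {η : ℝ → ℂ} (h : TestPos η) (s : ℝ) :
    HasCompactSupport (fun x => Vp s x * η x) := h.2.1.mul_left

lemma TestPos.Vp_int {η : ℝ → ℂ} (h : TestPos η) (s : ℝ) :
    Integrable (fun x => Vp s x * η x) :=
  (h.Vp_contDiff s).continuous.integrable_of_hasCompactSupport (h.Vp_hcs s)

lemma Vp_Prim_int {η f : ℝ → ℂ} (h : TestPos η)
    (hf : ∀ R, MemLp f 2 (volume.restrict (Ioc 0 R))) {s : ℝ} (hs : -(1/2) < s) (r : ℝ) :
    Integrable (fun x => Vp r x * η x * ∫ t in (0:ℝ)..x, Fp f s t) := by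
  have hc := intervalIntegral.continuous_primitive (Fp_intervalIntegrable hf hs) 0
  exact ((h.Vp_contDiff r).continuous.mul hc).integrable_of_hasCompactSupport
    ((h.Vp_hcs r).mul_right)

lemma Pp_int {α : ℝ} (hα : α ∈ Ico (0:ℝ) 1) {η f : ℝ → ℂ} (h : TestPos η)
    (hf : ∀ R, MemLp f 2 (volume.restrict (Ioc 0 R))) :
    Integrable (fun x => Pp α f x * η x) := by
  have h1 := Vp_Prim_int h hf (s := 1 + α / 2) (by linarith [hα.1]) (-(α / 2))
  have h2 := Vp_Prim_int h hf (s := -(α / 2)) (by linarith [hα.2]) (1 + α / 2)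
  refine ((h1.sub h2).const_mul ((1 + α : ℂ)⁻¹)).congr (Eventually.of_forall fun x => ?_)
  simp only [Pp, Pi.sub_apply]
  ring

lemma fub2 {η f : ℝ → ℂ} (h : TestPos η) 
    (hf : ∀ R, MemLp f 2 (volume.restrict (Ioc 0 R))) {s : ℝ} (hs : -(1/2) < s) (r : ℝ)
    (hm : ∫ t, Vp r t * η t = 0) :
    ∫ x, Fp f s x * Hp η r x = - ∫ x, Vp r x * η x * ∫ t in (0:ℝ)..x, Fp f s t := by
  obtain ⟨a, R, ha, haR, hz⟩ := h.bounds
  refine fub (R := R) (ha.trans haR) (Fp_intervalIntegrable hf hs 0 R).1 (h.Vp_int r) ?_ hm ?_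
  · intro x hx
    rw [hz x, mul_zero]
    intro h'
    exact hx ⟨by linarith [h'.1], h'.2⟩
  · intro x hx
    exact indicator_of_notMem (by simpa using hx) _

lemma Fp_Hp_int {η f : ℝ → ℂ} (h : TestPos η) 
    (hf : ∀ R, MemLp f 2 (volume.restrict (Ioc 0 R))) {s : ℝ} (hs : -(1/2) < s) (r : ℝ)
    (hm : ∫ t, Vp r t * η t = 0) : Integrable (fun x => Fp f s x * Hp η r x) := by
  obtain ⟨a, R, ha, haR, hz⟩ := h.bounds
  have hl : LocallyIntegrable (Fp f s) := by
    rw [locallyIntegrable_iff]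
    intro K hK
    obtain ⟨a, ha⟩ := hK.bddBelow
    obtain ⟨b, hb⟩ := hK.bddAbove
    refine (Fp_intervalIntegrable hf hs (a - 1) b).1.mono_set fun x hx => ⟨?_, hb hx⟩
    linarith [ha hx]
  have hcs : HasCompactSupport (Hp η r) := by
    refine HasCompactSupport.intro (isCompact_Icc (a := a) (b := R)) fun x hx => ?_
    by_cases hxa : x < a
    · exact Hp_zero_left ha hz _ hxa
    · exact Hp_zero_right ha haR hz _ hm (by by_contra h'; exact hx ⟨by linarith, by linarith⟩)
  exact hl.integrable_smul_right_of_hasCompactSupport (Hp_contDiff h r).continuous hcs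

lemma f_Phi {α : ℝ} (hα : α ∈ Ico (0:ℝ) 1) {η f : ℝ → ℂ} (h : TestPos η)
    (hf : ∀ R, MemLp f 2 (volume.restrict (Ioc 0 R)))
    (h1 : ∫ t, Vp (-(α / 2)) t * η t = 0) (h2 : ∫ t, Vp (1 + α / 2) t * η t = 0) :
    ∫ x, f x * Phi α η x = ∫ x, Pp α f x * η x := by
  have s1 : -(1/2) < 1 + α / 2 := by linarith [hα.1]
  have s2 : -(1/2) < -(α / 2) := by linarith [hα.2]
  have hΦ := (Phi_spec hα.1 h h1 h2).1
  have e1 : ∀ x, f x * Phi α η x = (1 + α : ℂ)⁻¹ * (Fp f (-(α / 2)) x * Hp η (1 + α / 2) x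
      - Fp f (1 + α / 2) x * Hp η (-(α / 2)) x) := by
    intro x
    by_cases hx : 0 < x
    · have : ∀ s, Fp f s x = Vp s x * f x := fun s => indicator_of_mem (show x ∈ Ioi 0 from hx) _
      rw [this, this, Phi]; ring
    · have : ∀ s, Fp f s x = 0 := fun s => indicator_of_notMem (show x ∉ Ioi 0 from hx) _
      rw [this, this, hΦ.zero_of_nonpos (not_lt.mp hx)]; ring
  have e2 : ∀ x, Pp α f x * η x = (1 + α : ℂ)⁻¹ *
      (Vp (-(α / 2)) x * η x * (∫ t in (0:ℝ)..x, Fp f (1 + α / 2) t)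
      - Vp (1 + α / 2) x * η x * ∫ t in (0:ℝ)..x, Fp f (-(α / 2)) t) := by
    intro x; rw [Pp]; ring
  simp_rw [e1, e2]
  rw [integral_const_mul, integral_const_mul,
    integral_sub (Fp_Hp_int h hf s2 _ h2) (Fp_Hp_int h hf s1 _ h1),
    integral_sub (Vp_Prim_int h hf s1 _) (Vp_Prim_int h hf s2 _),
    fub2 h hf s2 _ h2, fub2 h hf s1 _ h1]
  ring

lemma Prim_tendsto {f : ℝ → ℂ}
    (hf : ∀ R, MemLp f 2 (volume.restrict (Ioc 0 R))) {s : ℝ} (hs : -(1/2) < s) :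
    Tendsto (fun x => ∫ t in (0:ℝ)..x, Fp f s t) (nhdsWithin 0 (Ioi 0)) (nhds 0) := by
  have hc := intervalIntegral.continuous_primitive (Fp_intervalIntegrable hf hs) 0
  have := hc.tendsto 0
  simp only [intervalIntegral.integral_same] at this
  exact this.mono_left nhdsWithin_le_nhds

lemma Vp_tendsto {s : ℝ} (hs : 0 < s) :
    Tendsto (Vp s) (nhdsWithin 0 (Ioi 0)) (nhds 0) := by
  have h1 : Continuous (Vp s) := by
    unfold Vp
    exact Complex.continuous_ofReal.comp (Real.continuous_rpow_const hs.le)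
  have := h1.tendsto 0
  rw [show Vp s 0 = 0 by simp [Vp, Real.zero_rpow hs.ne']] at this
  exact this.mono_left nhdsWithin_le_nhds

lemma mid_tendsto {α : ℝ} (hα : α ∈ Ico (0:ℝ) 1) {f : ℝ → ℂ}
    (hf : ∀ R, MemLp f 2 (volume.restrict (Ioc 0 R))) :
    Tendsto (fun x => Vp (-(1 + α)) x * ∫ t in (0:ℝ)..x, Fp f (1 + α / 2) t)
      (nhdsWithin 0 (Ioi 0)) (nhds 0) := by
  have s1 : -(1/2) < 1 + α / 2 := by linarith [hα.1]
  have s2 : -(1/2) < -(α / 2) := by linarith [hα.2]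
  have hi := fun a b => (Fp_intervalIntegrable hf s2 a b).norm
  have hc := intervalIntegral.continuous_primitive hi 0
  have ht := hc.tendsto 0
  simp only [intervalIntegral.integral_same] at ht
  have ht := ht.mono_left (nhdsWithin_le_nhds (s := Ioi 0))
  refine squeeze_zero_norm' ?_ ht
  filter_upwards [self_mem_nhdsWithin] with x hx
  have hx : 0 < x := hx
  rw [← intervalIntegral.integral_const_mul]
  refine intervalIntegral.norm_integral_le_of_norm_le hx.le ?_ (hi 0 x)
  refine Eventually.of_forall fun t ht => ?_
  have ht0 : t ∈ Ioi (0:ℝ) := ht.1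
  unfold Fp
  rw [indicator_of_mem ht0, indicator_of_mem ht0, norm_mul, norm_mul, norm_mul, ← mul_assoc]
  refine mul_le_mul_of_nonneg_right ?_ (norm_nonneg _)
  simp only [Vp, Complex.norm_real, Real.norm_eq_abs]
  rw [abs_of_pos (Real.rpow_pos_of_pos hx _), abs_of_pos (Real.rpow_pos_of_pos ht.1 _),
    abs_of_pos (Real.rpow_pos_of_pos ht.1 _)]
  have e : t ^ (1 + α / 2) = t ^ (1 + α) * t ^ (-(α / 2)) := by
    rw [← Real.rpow_add ht.1]; congr 1; ring
  rw [e, ← mul_assoc]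
  have h1 : x ^ (-(1 + α)) * t ^ (1 + α) ≤ 1 := by
    rw [Real.rpow_neg hx.le, inv_mul_le_iff₀ (Real.rpow_pos_of_pos hx _), mul_one]
    exact Real.rpow_le_rpow ht.1.le ht.2 (by linarith [hα.1])
  nlinarith [Real.rpow_pos_of_pos ht.1 (-(α / 2))]

lemma half_f {α : ℝ} (hα : α ∈ Ico (0:ℝ) 1) (k : ℤ) {g h : ℝ → ℂ}
    (hg : MemLp g 2 volume) (hh : MemLp h 2 volume) (R : ℝ) :
    MemLp (fun x => h x - (((k : ℝ) ^ 2 * |x| ^ (2 * α) : ℝ) : ℂ) * g x) 2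
      (volume.restrict (Ioc 0 R)) := by
  have hgr := hg.restrict (Ioc 0 R)
  have hhr := hh.restrict (Ioc 0 R)
  refine hhr.sub ?_
  have hm : Measurable fun x : ℝ => (((k : ℝ) ^ 2 * |x| ^ (2 * α) : ℝ) : ℂ) := by fun_prop
  refine hgr.of_le_mul (c := (k : ℝ) ^ 2 * R ^ (2 * α))
    (hm.aestronglyMeasurable.mul hgr.aestronglyMeasurable) ?_
  rw [ae_restrict_iff' measurableSet_Ioc]
  refine Eventually.of_forall fun x hx => ?_
  rw [norm_mul, Complex.norm_real, Real.norm_eq_abs, abs_of_nonneg (by positivity)]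
  refine mul_le_mul_of_nonneg_right ?_ (norm_nonneg _)
  refine mul_le_mul_of_nonneg_left ?_ (by positivity)
  rw [abs_of_pos hx.1]
  exact Real.rpow_le_rpow hx.1.le hx.2 (by linarith [hα.1])

lemma Pp_continuousOn {α : ℝ} (hα : α ∈ Ico (0:ℝ) 1) {f : ℝ → ℂ}
    (hf : ∀ R, MemLp f 2 (volume.restrict (Ioc 0 R))) : ContinuousOn (Pp α f) (Ioi 0) := by
  have s1 : -(1/2) < 1 + α / 2 := by linarith [hα.1]
  have s2 : -(1/2) < -(α / 2) := by linarith [hα.2]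
  have c1 := intervalIntegral.continuous_primitive (Fp_intervalIntegrable hf s1) 0
  have c2 := intervalIntegral.continuous_primitive (Fp_intervalIntegrable hf s2) 0
  exact continuousOn_const.mul (((Vp_continuousOn _).mul c1.continuousOn).sub
    ((Vp_continuousOn _).mul c2.continuousOn))

lemma half_line {α : ℝ} (hα : α ∈ Ico (0:ℝ) 1) (k : ℤ) {g h : ℝ → ℂ}
    (hg : MemLp g 2 volume) (hh : MemLp h 2 volume)
    (hw : ∀ φ : ℝ → ℂ, TestPos φ → ∫ x : ℝ, g x * (-(deriv (deriv φ) x) +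
        (((k : ℝ) ^ 2 * |x| ^ (2 * α) + α * (α + 2) / 4 / x ^ 2 : ℝ) : ℂ) * φ x)
      = ∫ x : ℝ, h x * φ x) :
    ∃ G : ℝ → ℂ, (∀ᵐ x : ℝ, x ∈ Ioi (0:ℝ) → g x = G x) ∧ ContinuousOn G (Ioi 0) ∧
      ∃ g0 g1 : ℂ,
      Tendsto (fun x : ℝ => ((|x| ^ (α / 2) : ℝ) : ℂ) * G x) (nhdsWithin 0 (Ioi 0)) (nhds g0) ∧
      Tendsto (fun x : ℝ => ((|x| ^ (-(1 + α / 2)) : ℝ) : ℂ) *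
        (G x - g0 * ((|x| ^ (-(α / 2)) : ℝ) : ℂ))) (nhdsWithin 0 (Ioi 0)) (nhds g1) := by
  set f : ℝ → ℂ := fun x => h x - (((k : ℝ) ^ 2 * |x| ^ (2 * α) : ℝ) : ℂ) * g x with hfdef
  have hf : ∀ R, MemLp f 2 (volume.restrict (Ioc 0 R)) := half_f hα k hg hh
  have s1 : -(1/2) < 1 + α / 2 := by linarith [hα.1]
  have s2 : -(1/2) < -(α / 2) := by linarith [hα.2]
  have hgl : LocallyIntegrable g := hg.locallyIntegrable (by norm_num)
  have hhl : LocallyIntegrable h := hh.locallyIntegrable (by norm_num)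
  have hgη : ∀ η, TestPos η → Integrable (fun x => g x * η x) := fun η hη =>
    hgl.integrable_smul_right_of_hasCompactSupport hη.1.continuous hη.2.1
  have hT : ∀ η, TestPos η → Integrable (fun x => (g x - Pp α f x) * η x) := by
    intro η hη
    refine ((hgη η hη).sub (Pp_int hα hη hf)).congr (Eventually.of_forall fun x => ?_)
    simp only [Pi.sub_apply]; ring
  have key : ∀ η, TestPos η → ∫ t, Vp (-(α / 2)) t * η t = 0 →
      ∫ t, Vp (1 + α / 2) t * η t = 0 → ∫ x, (g x - Pp α f x) * η x = 0 := by
    intro η hη h1 h2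
    obtain ⟨hΦ, hode⟩ := Phi_spec hα.1 hη h1 h2
    have hc : Continuous fun x : ℝ => (((k : ℝ) ^ 2 * |x| ^ (2 * α) : ℝ) : ℂ) := by
      refine Complex.continuous_ofReal.comp (continuous_const.mul ?_)
      exact (Real.continuous_rpow_const (by linarith [hα.1])).comp continuous_abs
    have i1 : Integrable (fun x => g x * ((((k : ℝ) ^ 2 * |x| ^ (2 * α) : ℝ) : ℂ) * Phi α η x)) :=
      hgl.integrable_smul_right_of_hasCompactSupport (hc.mul hΦ.1.continuous) hΦ.2.1.mul_left
    have i2 : Integrable (fun x => h x * Phi α η x) :=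
      hhl.integrable_smul_right_of_hasCompactSupport hΦ.1.continuous hΦ.2.1
    have e := hw _ hΦ
    have e1 : ∀ x, g x * (-(deriv (deriv (Phi α η)) x) +
        (((k : ℝ) ^ 2 * |x| ^ (2 * α) + α * (α + 2) / 4 / x ^ 2 : ℝ) : ℂ) * Phi α η x)
        = g x * η x + g x * ((((k : ℝ) ^ 2 * |x| ^ (2 * α) : ℝ) : ℂ) * Phi α η x) := by
      intro x
      rw [← hode x, Complex.ofReal_add]
      ring
    simp_rw [e1] at e
    rw [integral_add (hgη η hη) i1] at e
    have e2 : ∫ x, f x * Phi α η x = ∫ x, g x * η x := by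
      rw [eq_sub_of_add_eq e, ← integral_sub i2 i1]
      congr 1; ext x; simp only [hfdef]; ring
    have e3 : ∫ x, (g x - Pp α f x) * η x = (∫ x, g x * η x) - ∫ x, Pp α f x * η x := by
      rw [← integral_sub (hgη η hη) (Pp_int hα hη hf)]
      congr 1; ext x; ring
    rw [e3, ← e2, f_Phi hα hη hf h1 h2, sub_self]
  let L : Bool → (TS →ₗ[ℂ] ℂ) := fun b =>
    if b then mkL (Vp (-(α / 2))) (fun η hη => hη.Vp_int _)
    else mkL (Vp (1 + α / 2)) (fun η hη => hη.Vp_int _)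
  have hmem : mkL (fun x => g x - Pp α f x) hT ∈ Submodule.span ℂ (range L) := by
    apply mem_span_of_iInf_ker_le_ker
    intro η hη
    simp only [Submodule.mem_iInf, LinearMap.mem_ker] at hη
    exact key η η.2 (hη true) (hη false)
  obtain ⟨c, hc⟩ := (Submodule.mem_span_range_iff_exists_fun ℂ).1 hmem
  set A := c true
  set B := c false
  have hAB : ∀ η, TestPos η → ∫ x, (g x - Pp α f x) * η x =
      A * (∫ x, Vp (-(α / 2)) x * η x) + B * ∫ x, Vp (1 + α / 2) x * η x := by
    intro η hη
    have := congrArg (fun M => M ⟨η, hη⟩) hc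
    simp only [Fintype.sum_bool, LinearMap.add_apply, LinearMap.smul_apply, smul_eq_mul] at this
    exact this.symm
  have hlI : LocallyIntegrableOn (fun x => g x - (Pp α f x + A * Vp (-(α / 2)) x
      + B * Vp (1 + α / 2) x)) (Ioi 0) := by
    refine (hgl.locallyIntegrableOn _).sub (ContinuousOn.locallyIntegrableOn ?_ measurableSet_Ioi)
    exact ((Pp_continuousOn hα hf).add (continuousOn_const.mul (Vp_continuousOn _))).add
      (continuousOn_const.mul (Vp_continuousOn _))
  have hae := isOpen_Ioi.ae_eq_zero_of_integral_contDiff_smul_eq_zero hlI (by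
    intro ψ hψ1 hψ2 hψ3
    have hη : TestPos (fun x => (ψ x : ℂ)) := by
      have hs : tsupport (fun x => (ψ x : ℂ)) ⊆ tsupport ψ := by
        apply closure_mono
        intro x hx
        simpa using hx
      exact ⟨Complex.ofRealCLM.contDiff.comp hψ1, hψ2.isCompact.of_isClosed_subset
        (isClosed_tsupport _) hs, hs.trans hψ3⟩
    have e := hAB _ hη
    have e4 : ∀ x, ψ x • (g x - (Pp α f x + A * Vp (-(α / 2)) x + B * Vp (1 + α / 2) x))
        = (g x - Pp α f x) * (ψ x : ℂ) - (A * (Vp (-(α / 2)) x * (ψ x : ℂ))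
          + B * (Vp (1 + α / 2) x * (ψ x : ℂ))) := by
      intro x; rw [Complex.real_smul]; ring
    simp_rw [e4]
    have j1 := (hη.Vp_int (-(α / 2))).const_mul A
    have j2 := (hη.Vp_int (1 + α / 2)).const_mul B
    have j3 : Integrable (fun x => A * (Vp (-(α / 2)) x * (ψ x : ℂ))
        + B * (Vp (1 + α / 2) x * (ψ x : ℂ))) := j1.add j2
    rw [integral_sub (hT _ hη) j3, integral_add j1 j2, integral_const_mul,
      integral_const_mul, e, sub_self])
  refine ⟨fun x => Pp α f x + A * Vp (-(α / 2)) x + B * Vp (1 + α / 2) x, ?_, ?_, A, B, ?_, ?_⟩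
  · filter_upwards [hae] with x hx hx0
    exact sub_eq_zero.mp (hx hx0)
  · exact ((Pp_continuousOn hα hf).add (continuousOn_const.mul (Vp_continuousOn _))).add
      (continuousOn_const.mul (Vp_continuousOn _))
  · have t1 := Prim_tendsto hf s1
    have t2 := Prim_tendsto hf s2
    have t3 := Vp_tendsto (s := 1 + α) (by linarith [hα.1])
    have t := ((t1.sub (t3.mul t2)).const_mul ((1 + α : ℂ)⁻¹)).add
      ((tendsto_const_nhds (x := A)).add (t3.const_mul B))
    simp only [mul_zero, sub_zero, zero_add, add_zero] at t
    refine t.congr' ?_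
    filter_upwards [self_mem_nhdsWithin] with x hx
    have hx : 0 < x := hx
    rw [abs_of_pos hx]
    change _ = Vp (α / 2) x * _
    have m1 : Vp (α / 2) x * Vp (-(α / 2)) x = 1 := by
      rw [Vp_mul _ _ _ hx]; simp [Vp]
    have m2 : Vp (α / 2) x * Vp (1 + α / 2) x = Vp (1 + α) x := by
      rw [Vp_mul _ _ _ hx]; congr 1; ring
    rw [Pp, ← m2]
    linear_combination (-((1 + α : ℂ)⁻¹ * (∫ t in (0:ℝ)..x, Fp f (1 + α / 2) t) + A)) * m1
  · have t1 := mid_tendsto hα hf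
    have t2 := Prim_tendsto hf s2
    have t := ((t1.sub t2).const_mul ((1 + α : ℂ)⁻¹)).add (tendsto_const_nhds (x := B))
    simp only [mul_zero, sub_zero, zero_add] at t
    refine t.congr' ?_
    filter_upwards [self_mem_nhdsWithin] with x hx
    have hx : 0 < x := hx
    rw [abs_of_pos hx]
    change _ = Vp (-(1 + α / 2)) x * (_ - A * Vp (-(α / 2)) x)
    have m1 : Vp (-(1 + α / 2)) x * Vp (1 + α / 2) x = 1 := by
      rw [Vp_mul _ _ _ hx]; simp [Vp]
    have m2 : Vp (-(1 + α / 2)) x * Vp (-(α / 2)) x = Vp (-(1 + α)) x := by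
      rw [Vp_mul _ _ _ hx]; congr 1; ring
    rw [Pp, ← m2]
    linear_combination (((1 + α : ℂ)⁻¹ * (∫ t in (0:ℝ)..x, Fp f (-(α / 2)) t) - B)) * m1

/-- For every `α ∈ [0,1)` and `k ∈ ℤ`, every `g ∈ L²(ℝ)` with
`(-d²/dx² + k²|x|^{2α} + C_α/x²) g ∈ L²` distributionally away from the origin admits a
representative continuous on `ℝ ∖ {0}` for which the boundary limits `g₀^±`, `g₁^±`
exist and are finite. -/
theorem fibre_boundary_limits_exist (α : ℝ) (hα : α ∈ Set.Ico (0 : ℝ) 1) (k : ℤ)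
    (g : L2R) (hg : ∃ h : L2R, ActsAsK α k g h) :
    ∃ G : ℝ → ℂ, (∀ᵐ x : ℝ, g x = G x) ∧ ContinuousOn G {x : ℝ | x ≠ 0} ∧
      ∃ g0p g0m g1p g1m : ℂ, HasBoundary α G g0p g0m g1p g1m := by
  obtain ⟨h, hgh⟩ := hg
  obtain ⟨Gp, hp1, hp2, g0p, g1p, hp3, hp4⟩ := half_line hα k (Lp.memLp g) (Lp.memLp h) (by
    intro φ hφ
    exact hgh φ ⟨hφ.1, hφ.2.1, fun x hx => (ne_of_gt (hφ.2.2 hx))⟩)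
  have hmp := Measure.measurePreserving_neg (volume : Measure ℝ)
  obtain ⟨Gm, hm1, hm2, g0m, g1m, hm3, hm4⟩ := half_line (g := fun x => g (-x))
    (h := fun x => h (-x)) hα k ((Lp.memLp g).comp_measurePreserving hmp)
    ((Lp.memLp h).comp_measurePreserving hmp) (by
    intro φ hφ
    have ht : TestFun (fun x => φ (-x)) := by
      refine ⟨hφ.1.comp contDiff_neg, hφ.2.1.comp_homeomorph (Homeomorph.neg ℝ), ?_⟩
      intro x hx
      have : -x ∈ tsupport φ := by
        have := tsupport_comp_subset_preimage φ (f := fun x : ℝ => -x) continuous_neg hx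
        exact this
      have h0 : 0 < -x := hφ.2.2 this
      exact (neg_pos.mp h0).ne
    have e := hgh _ ht
    have d1 : deriv (fun x => φ (-x)) = fun x => - deriv φ (-x) := by
      funext x; exact deriv_comp_neg φ x
    have d2 : deriv (deriv (fun x => φ (-x))) = fun x => deriv (deriv φ) (-x) := by
      rw [d1]; funext x
      rw [deriv.fun_neg, deriv_comp_neg, neg_neg]
    rw [d2, ← integral_neg_eq_self, ← integral_neg_eq_self (fun x => h x * φ (-x))] at e
    simpa only [neg_neg, abs_neg, neg_sq] using e)
  have hneg : Tendsto (fun x : ℝ => -x) (nhdsWithin 0 (Iio 0)) (nhdsWithin 0 (Ioi 0)) := by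
    refine tendsto_nhdsWithin_iff.mpr ⟨?_, ?_⟩
    · have := (continuous_neg (G := ℝ)).tendsto 0
      rw [neg_zero] at this
      exact this.mono_left nhdsWithin_le_nhds
    · filter_upwards [self_mem_nhdsWithin] with x hx
      exact neg_pos.mpr (show x < 0 from hx)
  set G : ℝ → ℂ := fun x => if 0 < x then Gp x else Gm (-x) with hG
  have hGp : ∀ x, 0 < x → G x = Gp x := fun x hx => by simp [hG, hx]
  have hGm : ∀ x, x < 0 → G x = Gm (-x) := fun x hx => by simp [hG, not_lt.mpr hx.le]
  refine ⟨G, ?_, ?_, g0p, g0m, g1p, g1m, ?_, ?_, ?_, ?_⟩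
  · have hm1' := hmp.quasiMeasurePreserving.ae hm1
    have h0 : ∀ᵐ x : ℝ, x ≠ 0 := by simp [ae_iff, measure_singleton]
    filter_upwards [hp1, hm1', h0] with x h1 h2 h3
    rcases lt_or_gt_of_ne h3 with h4 | h4
    · rw [hGm x h4]
      have := h2 (neg_pos.mpr h4)
      simpa using this
    · rw [hGp x h4]
      exact h1 h4
  · intro x hx
    apply ContinuousAt.continuousWithinAt
    rcases lt_or_gt_of_ne (show x ≠ 0 from hx) with h4 | h4
    · have c : ContinuousAt (fun y => Gm (-y)) x := by
        have c1 : ContinuousAt Gm (-x) := hm2.continuousAt (Ioi_mem_nhds (neg_pos.mpr h4))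
        exact ContinuousAt.comp (f := fun y : ℝ => -y) c1 continuous_neg.continuousAt
      refine c.congr ?_
      filter_upwards [Iio_mem_nhds h4] with y hy
      exact (hGm y hy).symm
    · refine (hp2.continuousAt (Ioi_mem_nhds h4)).congr ?_
      filter_upwards [Ioi_mem_nhds h4] with y hy
      exact (hGp y hy).symm
  · refine hp3.congr' ?_
    filter_upwards [self_mem_nhdsWithin] with x hx
    rw [hGp x hx]
  · refine (hm3.comp hneg).congr' ?_
    filter_upwards [self_mem_nhdsWithin] with x hx
    rw [hGm x hx]; simp
  · refine hp4.congr' ?_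
    filter_upwards [self_mem_nhdsWithin] with x hx
    rw [hGp x hx]
  · refine (hm4.comp hneg).congr' ?_
    filter_upwards [self_mem_nhdsWithin] with x hx
    rw [hGm x hx]; simp

end
end
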